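/- Let p ≥ 1 and suppose u₀ ∈ C⁰(ℝⁿ) is positive, radially symmetric and nonincreasing with respect to |x|, satisfies u₀(x) → 0 as |x| → ∞, and ∫_{{x : u₀(x) < η}} (ln ln(1/u₀(x)))^{−κ} dx < ∞ for some κ > 0 and some η > 0. Then there exist t₀ > e and C > 0 such that the minimal solution u of the Cauchy problem (0) satisfies ‖u(·,t)‖_{L^∞(ℝⁿ)} ≤ C · t^{−1/p} · (ln ln t)^{2κ/(np)} for all t ≥ t₀. -/

import Mathlib

open Real Set MeasureTheory Metric Filter

/-- The Laplacian of a function on `ℝⁿ`, written via iterated Fréchet derivatives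
in the coordinate directions. -/
noncomputable def lap {n : ℕ} (f : EuclideanSpace ℝ (Fin n) → ℝ)
    (x : EuclideanSpace ℝ (Fin n)) : ℝ :=
  ∑ i : Fin n, fderiv ℝ (fun y => fderiv ℝ f y (EuclideanSpace.single i 1)) x
    (EuclideanSpace.single i 1)

/-- `u` is a positive classical solution of the Cauchy problem `u_t = u^p Δu`,
`u(·,0) = u₀`, on `ℝⁿ × (0,T)`: it is continuous on `ℝⁿ × [0,T)`, attains the initial
data, is positive and spatially `C²` for `0 < t < T`, and satisfies the PDE pointwise. -/
def IsSolOn (n : ℕ) (p : ℝ) (u₀ : EuclideanSpace ℝ (Fin n) → ℝ)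
    (u : EuclideanSpace ℝ (Fin n) → ℝ → ℝ) (T : ℝ) : Prop :=
  ContinuousOn (fun z : (EuclideanSpace ℝ (Fin n)) × ℝ => u z.1 z.2) {z | 0 ≤ z.2 ∧ z.2 < T} ∧
  (∀ x, u x 0 = u₀ x) ∧
  (∀ x, ∀ t, 0 < t → t < T → 0 < u x t) ∧
  (∀ t, 0 < t → t < T → ContDiff ℝ 2 (fun y => u y t)) ∧
  (∀ x, ∀ t, 0 < t → t < T →
    HasDerivAt (fun s => u x s) (u x t ^ p * lap (fun y => u y t) x) t)

/-- `u` is a global positive classical solution of the Cauchy problem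
`u_t = u^p Δu` on `ℝⁿ × (0,∞)`, `u(·,0) = u₀`. -/
def IsSol (n : ℕ) (p : ℝ) (u₀ : EuclideanSpace ℝ (Fin n) → ℝ)
    (u : EuclideanSpace ℝ (Fin n) → ℝ → ℝ) : Prop :=
  ContinuousOn (fun z : (EuclideanSpace ℝ (Fin n)) × ℝ => u z.1 z.2) {z | 0 ≤ z.2} ∧
  (∀ x, u x 0 = u₀ x) ∧
  (∀ x, ∀ t, 0 < t → 0 < u x t) ∧
  (∀ t, 0 < t → ContDiff ℝ 2 (fun y => u y t)) ∧
  (∀ x, ∀ t, 0 < t →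
    HasDerivAt (fun s => u x s) (u x t ^ p * lap (fun y => u y t) x) t)

/-- `u` is the minimal global positive classical solution of the Cauchy problem:
whenever `T ∈ (0,∞]` and `v` is a positive classical solution on `ℝⁿ × (0,T)`, then
`u ≤ v` there.  (Quantifying over all finite `T > 0` covers `T = ∞`, since the
restriction of a global solution solves the problem on every `(0,T)`.) -/
def IsMinimalSol (n : ℕ) (p : ℝ) (u₀ : EuclideanSpace ℝ (Fin n) → ℝ)
    (u : EuclideanSpace ℝ (Fin n) → ℝ → ℝ) : Prop :=
  IsSol n p u₀ u ∧
  ∀ T > (0:ℝ), ∀ v, IsSolOn n p u₀ v T → ∀ x, ∀ t, 0 ≤ t → t < T → u x t ≤ v x t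

lemma MP {ι : Type*} (S : Finset ι) (Q : ι → ℝ → ℝ) (a b : ℝ)
    (hc : ∀ i ∈ S, ContinuousOn (Q i) (Icc a b))
    (h0 : ∀ i ∈ S, Q i a < 0)
    (hd : ∀ t ∈ Ioc a b, ∀ i ∈ S, Q i t = 0 → (∀ j ∈ S, Q j t ≤ 0) →
      ∃ d < 0, HasDerivAt (Q i) d t) :
    ∀ t ∈ Icc a b, ∀ i ∈ S, Q i t < 0 := by
  classical
  by_contra hcon
  push Not at hcon
  obtain ⟨t1, ht1, i1, hi1, hQ1⟩ := hcon
  set K : Set ℝ := ⋃ i ∈ S, (Icc a b ∩ (Q i) ⁻¹' Ici 0) with hK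
  have hKc : IsClosed K := by
    apply Set.Finite.isClosed_biUnion S.finite_toSet
    intro i hi
    exact (hc i hi).preimage_isClosed_of_isClosed isClosed_Icc isClosed_Ici
  have hKsub : K ⊆ Icc a b := by
    intro x hx
    simp only [hK, mem_iUnion] at hx
    obtain ⟨i, hi, hx⟩ := hx
    exact hx.1
  have hKne : K.Nonempty := ⟨t1, by simp only [hK, mem_iUnion]; exact ⟨i1, hi1, ht1, hQ1⟩⟩
  have hKcomp : IsCompact K := isCompact_Icc.of_isClosed_subset hKc hKsub
  have hs := hKcomp.sInf_mem hKne
  set s := sInf K with hsdef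
  have hsI := hKsub hs
  have hlt : ∀ r ∈ Icc a b, r < s → ∀ j ∈ S, Q j r < 0 := by
    intro r hr hrs j hj
    by_contra hh
    push Not at hh
    have : r ∈ K := by simp only [hK, mem_iUnion]; exact ⟨j, hj, hr, hh⟩
    exact absurd (csInf_le hKcomp.bddBelow this) (not_le.mpr hrs)
  have has : a < s := by
    rcases lt_or_eq_of_le hsI.1 with h | h
    · exact h
    · exfalso
      simp only [hK, mem_iUnion] at hs
      obtain ⟨i, hi, -, hx⟩ := hs
      rw [← h] at hx
      exact absurd (h0 i hi) (not_lt.mpr hx)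
  have hle : ∀ j ∈ S, Q j s ≤ 0 := by
    intro j hj
    have h1 : Tendsto (Q j) (nhdsWithin s (Ico a s)) (nhds (Q j s)) :=
      ((hc j hj) s hsI).mono_left (nhdsWithin_mono _ (fun x hx => ⟨hx.1, hx.2.le.trans hsI.2⟩))
    have hne : (nhdsWithin s (Ico a s)).NeBot := by
      rw [nhdsWithin_Ico_eq_nhdsLT has]; infer_instance
    refine le_of_tendsto h1 ?_
    filter_upwards [self_mem_nhdsWithin] with x hx
    exact (hlt x ⟨hx.1, hx.2.le.trans hsI.2⟩ hx.2 j hj).le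
  have hs' := hs
  simp only [hK, mem_iUnion] at hs'
  obtain ⟨i, hi, -, hx⟩ := hs'
  have hQ0 : Q i s = 0 := le_antisymm (hle i hi) hx
  obtain ⟨d, hd0, hder⟩ := hd s ⟨has, hsI.2⟩ i hi hQ0 hle
  have h2 := hder.hasDerivWithinAt (s := Iio s)
  rw [hasDerivWithinAt_iff_tendsto_slope' (by simp)] at h2
  have h3 : ∀ᶠ x in nhdsWithin s (Iio s), slope (Q i) s x < 0 := h2.eventually (gt_mem_nhds hd0)
  have h4 : ∀ᶠ x in nhdsWithin s (Iio s), x ∈ Ioo a s := Ioo_mem_nhdsLT has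
  obtain ⟨x, hx1, hx2⟩ := (h3.and h4).exists
  have := hlt x ⟨hx2.1.le, hx2.2.le.trans hsI.2⟩ hx2.2 i hi
  rw [slope_def_field, hQ0, sub_zero, div_neg_iff] at hx1
  rcases hx1 with h | h
  · linarith [h.1]
  · linarith [h.2, hx2.2]

/-- Discrete radial Laplacian in the variable `ξ = |x|²`. -/
noncomputable def Lq (ν h : ℝ) (v : ℕ → ℝ) (i : ℕ) : ℝ :=
  ((4 * (i : ℝ) + ν) * (v (i + 1) - v i) + 4 * (i : ℝ) * (v (i - 1) - v i)) / h

structure LSol (p ν h T m M : ℝ) (N : ℕ) (u : ℕ → ℝ → ℝ) : Prop where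
  hp : 1 ≤ p
  hν : 2 ≤ ν
  hh : 0 < h
  hT : 0 < T
  hm : 0 < m
  hM : 1 ≤ M
  lo : ∀ i, ∀ t ∈ Icc 0 T, m ≤ u i t
  hi : ∀ i, ∀ t ∈ Icc 0 T, u i t ≤ M
  hd : ∀ i < N, ∀ t ∈ Icc 0 T, HasDerivAt (u i) (u i t ^ p * Lq ν h (fun j => u j t) i) t
  hN : ∀ i, N ≤ i → ∀ t, u i t = m
  init : ∀ i, u (i + 1) 0 ≤ u i 0

lemma Lq_le_of_max {ν h : ℝ} (hν : 0 ≤ ν) (hh : 0 < h) {v : ℕ → ℝ} {i : ℕ}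
    (h1 : v (i + 1) ≤ v i) (h2 : v (i - 1) ≤ v i) : Lq ν h v i ≤ 0 := by
  unfold Lq
  apply div_nonpos_of_nonpos_of_nonneg _ hh.le
  have hi : (0:ℝ) ≤ i := Nat.cast_nonneg i
  nlinarith [mul_nonneg hi (sub_nonneg.2 h2), mul_nonneg (by positivity : (0:ℝ) ≤ 4 * (i:ℝ) + ν) (sub_nonneg.2 h1)]

lemma Lq_ge_of_min {ν h : ℝ} (hν : 0 ≤ ν) (hh : 0 < h) {v : ℕ → ℝ} {i : ℕ}
    (h1 : v i ≤ v (i + 1)) (h2 : v i ≤ v (i - 1)) : 0 ≤ Lq ν h v i := by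
  unfold Lq
  have hi : (0:ℝ) ≤ i := Nat.cast_nonneg i
  apply div_nonneg _ hh.le
  nlinarith [mul_nonneg hi (sub_nonneg.2 h2), mul_nonneg (by positivity : (0:ℝ) ≤ 4 * (i:ℝ) + ν) (sub_nonneg.2 h1)]

noncomputable def extL (N : ℕ) (m : ℝ) (y : Fin N → ℝ) (i : ℕ) : ℝ :=
  if h : i < N then y ⟨i, h⟩ else m

lemma exists_LSol (p ν h T m M : ℝ) (N : ℕ) (g : ℕ → ℝ) (hp : 1 ≤ p) (hν : 2 ≤ ν) (hh : 0 < h)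
    (hT : 0 < T) (hm : 0 < m) (hM : 1 ≤ M) (hgm : ∀ i, m ≤ g i) (hgM : ∀ i, g i ≤ M)
    (hg : ∀ i, g (i + 1) ≤ g i) (hgN : ∀ i, N ≤ i → g i = m) :
    ∃ u, LSol p ν h T m M N u ∧ ∀ i, u i 0 = g i := by
  classical
  have hmM : m ≤ M := (hgm 0).trans (hgM 0)
  let G : (Fin N → ℝ) → (Fin N → ℝ) := fun y i => (extL N m y i) ^ p * Lq ν h (extL N m y) i
  have hext : ∀ j, ContDiff ℝ 1 (fun y : Fin N → ℝ => extL N m y j) := by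
    intro j
    unfold extL
    by_cases hj : j < N
    · simp only [hj, dif_pos]; fun_prop
    · simp only [hj, dif_neg, not_false_iff]; fun_prop
  have hG : ContDiff ℝ 1 G := by
    rw [contDiff_pi]
    intro i
    have h1 : ContDiff ℝ 1 (fun x : ℝ => x ^ p) := by
      have := Real.contDiff_rpow_const_of_le (p := p) (n := 1) (by exact_mod_cast hp)
      exact_mod_cast this
    have e1 := hext i
    have e2 := hext (i + 1)
    have e3 := hext (i - 1)
    refine (h1.comp e1).mul ?_
    unfold Lq
    refine ContDiff.div_const ?_ _
    exact (contDiff_const.mul (e2.sub e1)).add (contDiff_const.mul (e3.sub e1))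
  let c : (Fin N → ℝ) → (Fin N → ℝ) := fun y i => max m (min M (y i))
  let box : Set (Fin N → ℝ) := Icc (fun _ => m) (fun _ => M)
  have hbox : IsCompact box := isCompact_Icc
  have hcbox : ∀ y, c y ∈ box := by
    intro y
    exact ⟨fun i => le_max_left _ _, fun i => max_le hmM (min_le_left _ _)⟩
  have hcL : LipschitzWith 1 c := by
    apply LipschitzWith.of_dist_le_mul
    intro x y
    rw [dist_pi_le_iff (by positivity)]
    intro i
    refine le_trans ?_ (mul_le_mul_of_nonneg_left (dist_le_pi_dist x y i) (by positivity))
    have h1 : LipschitzWith 1 (fun y : ℝ => y) := LipschitzWith.id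
    exact ((h1.const_min M).const_max m).dist_le_mul (x i) (y i)
  obtain ⟨K, hK⟩ := (hG.locallyLipschitz.locallyLipschitzOn (s := box)).exists_lipschitzOnWith_of_compact hbox
  obtain ⟨B, hB⟩ := hbox.exists_bound_of_continuousOn hG.continuous.continuousOn
  let L : NNReal := ⟨max B 0, le_max_right _ _⟩
  let a : NNReal := L * ⟨T + 1, by linarith⟩
  let F : (Fin N → ℝ) → (Fin N → ℝ) := fun y => G (c y)
  have h0mem : (0:ℝ) ∈ Icc (-1:ℝ) (T + 1) := ⟨by norm_num, by linarith⟩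
  have hPL : IsPicardLindelof (fun _ : ℝ => F) (⟨0, h0mem⟩ : Icc (-1:ℝ) (T + 1)) (fun i : Fin N => g i) a 0 L K := by
    apply IsPicardLindelof.of_time_independent
    · intro x _
      exact (hB _ (hcbox x)).trans (le_max_left _ _)
    · have := hK.comp (hcL.lipschitzOnWith (s := univ)) (fun x _ => hcbox x)
      rw [mul_one] at this
      exact this.mono (subset_univ _)
    · have hL0 : (0:ℝ) ≤ L := L.2
      have : max (T + 1 - 0) (0 - -1) ≤ T + 1 := by
        apply max_le <;> linarith
      have h5 := mul_le_mul_of_nonneg_left this hL0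
      have h6 : (a : ℝ) - ((0 : NNReal) : ℝ) = L * (T + 1) := by
        rw [NNReal.coe_zero, sub_zero]; rfl
      rw [h6]
      exact h5
  obtain ⟨α, hα0, hα⟩ := hPL.exists_eq_forall_mem_Icc_hasDerivWithinAt₀
  have hα' : ∀ t ∈ Icc 0 T, ∀ i, HasDerivAt (fun s => α s i) (F (α t) i) t := by
    intro t ht i
    have h1 := (hα t ⟨by linarith [ht.1], by linarith [ht.2]⟩).hasDerivAt
      (Icc_mem_nhds (by linarith [ht.1]) (by linarith [ht.2]))
    exact hasDerivAt_pi.1 h1 i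
  simp only at hα0
  have hcont : ∀ i, ContinuousOn (fun s => α s i) (Icc 0 T) := fun i t ht =>
    (hα' t ht i).continuousAt.continuousWithinAt
  have hec : ∀ y j, m ≤ extL N m (c y) j ∧ extL N m (c y) j ≤ M := by
    intro y j
    unfold extL
    split_ifs with hj
    · exact ⟨(hcbox y).1 _, (hcbox y).2 _⟩
    · exact ⟨le_rfl, hmM⟩
  have hupper : ∀ t ∈ Icc 0 T, ∀ i, α t i ≤ M := by
    intro t ht i
    refine le_of_forall_pos_le_add ?_
    intro ε hε
    have hT1 : 0 < 1 + T := by linarith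
    have := MP Finset.univ (fun i s => α s i - M - ε / (1 + T) * (1 + s)) 0 T
      (fun i _ => ((hcont i).sub continuousOn_const).sub (by fun_prop))
      (fun i _ => by
        have : ε / (1 + T) > 0 := by positivity
        simp only [hα0]; linarith [hgM i])
      (fun s hs i _ hQ _ => by
        have hsI : s ∈ Icc 0 T := ⟨hs.1.le, hs.2⟩
        have hpos : 0 < ε / (1 + T) := by positivity
        refine ⟨F (α s) i - 0 - ε / (1 + T) * 1, ?_, ?_⟩
        · have hgt : M < α s i := by
            have := mul_pos hpos (by linarith [hs.1] : 0 < 1 + s)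
            linarith
          have : F (α s) i ≤ 0 := by
            have hce : extL N m (c (α s)) i = M := by
              unfold extL
              simp only [i.2, dif_pos, c, Fin.eta]
              rw [min_eq_left hgt.le, max_eq_right hmM]
            apply mul_nonpos_of_nonneg_of_nonpos
            · exact rpow_nonneg (hm.le.trans (hec _ _).1) _
            · apply Lq_le_of_max (by linarith) hh <;> (rw [hce]; exact (hec _ _).2)
          linarith
        · have h2 : HasDerivAt (fun s : ℝ => ε / (1 + T) * (1 + s)) (ε / (1 + T) * 1) s :=
            ((hasDerivAt_id s).const_add 1).const_mul _
          have h3 : HasDerivAt (fun _ : ℝ => M) 0 s := hasDerivAt_const _ _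
          exact ((hα' s hsI i).sub h3).sub h2)
      t ht i (Finset.mem_univ _)
    have h4 : ε / (1 + T) * (1 + t) ≤ ε := by
      rw [div_mul_eq_mul_div, div_le_iff₀ hT1]
      nlinarith [ht.2]
    linarith
  have hlower : ∀ t ∈ Icc 0 T, ∀ i, m ≤ α t i := by
    intro t ht i
    refine le_of_forall_pos_le_add ?_
    intro ε hε
    have hT1 : 0 < 1 + T := by linarith
    have := MP Finset.univ (fun i s => m - α s i - ε / (1 + T) * (1 + s)) 0 T
      (fun i _ => (continuousOn_const.sub (hcont i)).sub (by fun_prop))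
      (fun i _ => by
        have : ε / (1 + T) > 0 := by positivity
        simp only [hα0]; linarith [hgm i])
      (fun s hs i _ hQ _ => by
        have hsI : s ∈ Icc 0 T := ⟨hs.1.le, hs.2⟩
        have hpos : 0 < ε / (1 + T) := by positivity
        refine ⟨0 - F (α s) i - ε / (1 + T) * 1, ?_, ?_⟩
        · have hgt : α s i < m := by
            have := mul_pos hpos (by linarith [hs.1] : 0 < 1 + s)
            linarith
          have : 0 ≤ F (α s) i := by
            have hce : extL N m (c (α s)) i = m := by
              unfold extL
              simp only [i.2, dif_pos, c, Fin.eta]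
              rw [min_eq_right (hgt.le.trans hmM), max_eq_left hgt.le]
            apply mul_nonneg
            · exact rpow_nonneg (hm.le.trans (hec _ _).1) _
            · apply Lq_ge_of_min (by linarith) hh <;> (rw [hce]; exact (hec _ _).1)
          linarith
        · have h2 : HasDerivAt (fun s : ℝ => ε / (1 + T) * (1 + s)) (ε / (1 + T) * 1) s :=
            ((hasDerivAt_id s).const_add 1).const_mul _
          have h3 : HasDerivAt (fun _ : ℝ => m) 0 s := hasDerivAt_const _ _
          exact (h3.sub (hα' s hsI i)).sub h2)
      t ht i (Finset.mem_univ _)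
    have h4 : ε / (1 + T) * (1 + t) ≤ ε := by
      rw [div_mul_eq_mul_div, div_le_iff₀ hT1]
      nlinarith [ht.2]
    linarith
  have hcα : ∀ t ∈ Icc 0 T, c (α t) = α t := by
    intro t ht
    funext i
    simp only [c]
    rw [min_eq_right (hupper t ht i), max_eq_right (hlower t ht i)]
  have hu0 : ∀ i, extL N m (α 0) i = g i := by
    intro i
    unfold extL
    split_ifs with hi
    · rw [hα0]
    · exact (hgN i (not_lt.1 hi)).symm
  refine ⟨fun i t => extL N m (α t) i, ⟨hp, hν, hh, hT, hm, hM, ?_, ?_, ?_, ?_, ?_⟩, hu0⟩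
  · intro i t ht
    have := (hec (α t) i).1
    rwa [hcα t ht] at this
  · intro i t ht
    have := (hec (α t) i).2
    rwa [hcα t ht] at this
  · intro i hi t ht
    have h1 := hα' t ht ⟨i, hi⟩
    simp only [F, G] at h1
    rw [hcα t ht] at h1
    have h2 : (fun t => extL N m (α t) i) = fun s => α s ⟨i, hi⟩ := by
      funext s
      simp [extL, hi]
    rw [h2]
    exact h1
  · intro i hi t
    simp [extL, not_lt.2 hi]
  · intro i
    simp only [hu0]
    exact hg i

noncomputable def sL (ν h : ℝ) (u : ℕ → ℝ → ℝ) (i : ℕ) (t : ℝ) : ℝ := Lq ν h (fun j => u j t) i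

noncomputable def zL (p ν h : ℝ) (N : ℕ) (u : ℕ → ℝ → ℝ) (i : ℕ) (t : ℝ) : ℝ :=
  if i < N then u i t ^ p * sL ν h u i t else 0

namespace LSol
variable {p ν h T m M : ℝ} {N : ℕ} {u : ℕ → ℝ → ℝ}

lemma pos (S : LSol p ν h T m M N u) {i : ℕ} {t : ℝ} (ht : t ∈ Icc 0 T) : 0 < u i t :=
  S.hm.trans_le (S.lo i t ht)

lemma der (S : LSol p ν h T m M N u) (i : ℕ) {t : ℝ} (ht : t ∈ Icc 0 T) :
    HasDerivAt (u i) (zL p ν h N u i t) t := by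
  unfold zL
  split_ifs with hi
  · exact S.hd i hi t ht
  · have : u i = fun _ => m := funext (S.hN i (not_lt.1 hi))
    rw [this]
    exact hasDerivAt_const _ _

lemma cont (S : LSol p ν h T m M N u) (i : ℕ) : ContinuousOn (u i) (Icc 0 T) :=
  fun _ ht => (S.der i ht).continuousAt.continuousWithinAt

lemma derLq {ν h : ℝ} {v : ℕ → ℝ → ℝ} {w : ℕ → ℝ} {t : ℝ} (hv : ∀ i, HasDerivAt (v i) (w i) t) (i : ℕ) :
    HasDerivAt (fun s => Lq ν h (fun j => v j s) i) (Lq ν h w i) t := by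
  unfold Lq
  exact ((((hv (i+1)).sub (hv i)).const_mul _).add (((hv (i-1)).sub (hv i)).const_mul _)).div_const _

lemma derz (S : LSol p ν h T m M N u) {i : ℕ} (hi : i < N) {t : ℝ} (ht : t ∈ Icc 0 T) :
    HasDerivAt (zL p ν h N u i) (u i t ^ p * Lq ν h (fun j => zL p ν h N u j t) i
      + p * zL p ν h N u i t ^ 2 / u i t) t := by
  have h1 : zL p ν h N u i = fun t => u i t ^ p * sL ν h u i t := by
    funext s; simp [zL, hi]
  have h2 := (S.der i ht).rpow_const (p := p) (Or.inr S.hp)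
  have h3 := derLq (ν := ν) (h := h) (fun i => S.der i ht) i
  have h4 := h2.mul h3
  rw [h1]
  refine h4.congr_deriv ?_
  have hz : zL p ν h N u i t = u i t ^ p * sL ν h u i t := by rw [h1]
  have hu := S.pos (i := i) ht
  simp only [zL, hi, if_true]
  rw [rpow_sub_one hu.ne']
  unfold sL
  field_simp
  ring

lemma contz (S : LSol p ν h T m M N u) (i : ℕ) : ContinuousOn (zL p ν h N u i) (Icc 0 T) := by
  intro t ht
  by_cases hi : i < N
  · exact (S.derz hi ht).continuousAt.continuousWithinAt
  · have : zL p ν h N u i = fun _ => 0 := by funext s; simp [zL, hi]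
    rw [this]; exact continuousWithinAt_const

lemma zL_eq {i : ℕ} (hi : i < N) (t : ℝ) : zL p ν h N u i t = u i t ^ p * sL ν h u i t := by
  simp [zL, hi]

lemma zL_ge {i : ℕ} (hi : N ≤ i) (t : ℝ) : zL p ν h N u i t = 0 := by
  simp [zL, not_lt.2 hi]

/-- Aronson–Bénilan type lower bound. -/
lemma BC (S : LSol p ν h T m M N u) (i : ℕ) {t : ℝ} (ht : t ∈ Icc 0 T) :
    0 ≤ u i t / p + t * zL p ν h N u i t := by
  have hp0 : 0 < p := by linarith [S.hp]
  by_cases hi : i < N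
  swap
  · rw [zL_ge (not_lt.1 hi)]
    have := S.pos (i := i) ht
    simp; positivity
  suffices H : ∀ ε > 0, 0 ≤ u i t / p + t * zL p ν h N u i t + ε by
    exact le_of_forall_pos_le_add H
  intro ε hε
  have hT1 : 0 < 1 + T := by linarith [S.hT]
  set e := ε / (1 + T) with he
  have hepos : 0 < e := by positivity
  have key := MP (Finset.range N) (fun i s => -(u i s / p + s * zL p ν h N u i s) - e * (1 + s)) 0 T
    (fun i _ => by
      have h1 := S.cont i
      have h2 := S.contz i
      fun_prop)
    (fun i _ => by
      have := S.pos (i := i) (t := 0) ⟨le_rfl, S.hT.le⟩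
      have h2 : 0 < u i 0 / p := by positivity
      simp only [zero_mul]; linarith)
    (fun s hs i hi hQ hall => by
      have hsI : s ∈ Icc 0 T := ⟨hs.1.le, hs.2⟩
      rw [Finset.mem_range] at hi
      set Z : ℕ → ℝ := fun j => u j s / p + s * zL p ν h N u j s with hZ
      have hu := S.pos (i := i) hsI
      have hZi : Z i = -(e * (1 + s)) := by simp only [hZ]; linarith
      have hes : 0 < e * (1 + s) := mul_pos hepos (by linarith [hs.1])
      have hmin : ∀ j, Z i ≤ Z j := by
        intro j
        by_cases hj : j < N
        · have := hall j (Finset.mem_range.2 hj)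
          simp only [hZ] at hZi ⊢; linarith
        · have h1 : Z j = u j s / p := by simp only [hZ]; rw [zL_ge (not_lt.1 hj)]; ring
          have h2 := S.pos (i := j) hsI
          have h3 : 0 < u j s / p := by positivity
          linarith
      have hL : 0 ≤ Lq ν h Z i := Lq_ge_of_min (by linarith [S.hν]) S.hh (hmin _) (hmin _)
      have hz : zL p ν h N u i s < 0 := by
        by_contra hcon
        push Not at hcon
        have h3 : 0 < u i s / p := by positivity
        have : 0 ≤ s * zL p ν h N u i s := mul_nonneg hs.1.le hcon
        have : Z i > 0 := by simp only [hZ]; linarith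
        linarith
      refine ⟨_, ?_, ((((S.der i hsI).div_const p).add ((hasDerivAt_id s).mul (S.derz hi hsI))).neg).sub
        (((hasDerivAt_id s).const_add 1).const_mul e)⟩
      have hLZ : Lq ν h Z i = sL ν h u i s / p + s * Lq ν h (fun j => zL p ν h N u j s) i := by
        simp only [hZ, Lq, sL]
        ring
      have hzz := zL_eq (p := p) (ν := ν) (h := h) (u := u) hi s
      have hid : zL p ν h N u i s / p + (1 * zL p ν h N u i s + s * (u i s ^ p * Lq ν h (fun j => zL p ν h N u j s) i
          + p * zL p ν h N u i s ^ 2 / u i s)) = u i s ^ p * Lq ν h Z i + p * zL p ν h N u i s / u i s * Z i := by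
        rw [hLZ]
        simp only [hZ]
        have : u i s ^ p * (sL ν h u i s / p + s * Lq ν h (fun j => zL p ν h N u j s) i) =
           zL p ν h N u i s / p + s * (u i s ^ p * Lq ν h (fun j => zL p ν h N u j s) i) := by
          rw [hzz]; ring
        rw [this]
        field_simp
        ring
      have h1 : 0 ≤ u i s ^ p * Lq ν h Z i := mul_nonneg (rpow_nonneg hu.le _) hL
      have h2 : 0 ≤ p * zL p ν h N u i s / u i s * Z i := by
        apply mul_nonneg_of_nonpos_of_nonpos
        · apply div_nonpos_of_nonpos_of_nonneg _ hu.le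
          nlinarith
        · linarith
      simp only [id]
      linarith)
    t ht i (Finset.mem_range.2 hi)
  have h4 : e * (1 + t) ≤ ε := by
    rw [he, div_mul_eq_mul_div, div_le_iff₀ hT1]
    nlinarith [ht.2]
  linarith

/-- spatial monotonicity -/
lemma mono (S : LSol p ν h T m M N u) (i : ℕ) {t : ℝ} (ht : t ∈ Icc 0 T) :
    u (i + 1) t ≤ u i t := by
  by_cases hi : i < N
  swap
  · rw [S.hN i (not_lt.1 hi), S.hN (i+1) (by omega)]
  have hM0 : 0 < M := by linarith [S.hM]
  have hν0 : 0 < ν := by linarith [S.hν]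
  set lam : ℝ := ν * M ^ p / h + 1 with hlam
  suffices H : ∀ ε > 0, u (i+1) t ≤ u i t + ε * exp (lam * t) by
    refine le_of_forall_pos_le_add ?_
    intro ε hε
    have := H (ε / exp (lam * t)) (by positivity)
    rwa [div_mul_cancel₀ _ (exp_pos _).ne'] at this
  intro ε hε
  have key := MP (Finset.range N) (fun i s => (u (i+1) s - u i s) - ε * exp (lam * s)) 0 T
    (fun i _ => by
      have h1 := S.cont i
      have h2 := S.cont (i+1)
      fun_prop)
    (fun i _ => by
      have := S.init i
      have : 0 < ε * exp (lam * 0) := by positivity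
      linarith)
    (fun s hs i hi hQ hall => by
      have hsI : s ∈ Icc 0 T := ⟨hs.1.le, hs.2⟩
      rw [Finset.mem_range] at hi
      set W := ε * exp (lam * s) with hW
      have hW0 : 0 < W := by positivity
      have hwi : u (i+1) s - u i s = W := by linarith
      have hall' : ∀ j, u (j+1) s - u j s ≤ W := by
        intro j
        by_cases hj : j < N
        · have := hall j (Finset.mem_range.2 hj); linarith
        · rw [S.hN j (not_lt.1 hj), S.hN (j+1) (by omega)]; linarith
      have hiN : i + 1 < N := by
        by_contra hcon
        rw [S.hN (i+1) (not_lt.1 hcon)] at hwi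
        linarith [S.lo i s hsI]
      have h1 : 0 ≤ sL ν h u i s := by
        unfold sL Lq
        apply div_nonneg _ S.hh.le
        rcases i with _ | k
        · simp only [Nat.cast_zero]; nlinarith
        · have := hall' k
          have hk : (0:ℝ) ≤ ((k+1 : ℕ):ℝ) := Nat.cast_nonneg _
          simp only [Nat.add_sub_cancel]
          nlinarith [mul_nonneg hk (sub_nonneg.2 this)]
      have h2 : sL ν h u (i+1) s ≤ ν * W / h := by
        unfold sL Lq
        apply div_le_div_of_nonneg_right _ S.hh.le
        have := hall' (i+1)
        have hk : (0:ℝ) ≤ ((i+1 : ℕ):ℝ) := Nat.cast_nonneg _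
        simp only [Nat.add_sub_cancel]
        nlinarith [mul_nonneg (by positivity : (0:ℝ) ≤ 4 * ((i+1 : ℕ):ℝ) + ν) (sub_nonneg.2 this)]
      refine ⟨_, ?_, ((S.der (i+1) hsI).sub (S.der i hsI)).sub
        ((((hasDerivAt_id s).const_mul lam).exp).const_mul ε)⟩
      have h3 : zL p ν h N u (i+1) s ≤ M ^ p * (ν * W / h) := by
        rw [zL_eq hiN]
        have hu := S.pos (i := i+1) hsI
        have : u (i+1) s ^ p ≤ M ^ p := rpow_le_rpow hu.le (S.hi _ _ hsI) (by linarith [S.hp])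
        have h5 : 0 ≤ ν * W / h := by have := S.hh; positivity
        exact (mul_le_mul_of_nonneg_left h2 (rpow_nonneg hu.le _)).trans
          (mul_le_mul_of_nonneg_right this h5)
      have h4 : 0 ≤ zL p ν h N u i s := by
        rw [zL_eq hi]
        exact mul_nonneg (rpow_nonneg (S.pos hsI).le _) h1
      have h5 : ε * (exp (lam * id s) * (lam * 1)) = lam * W := by simp only [hW, id]; ring
      rw [h5, hlam]
      have : M ^ p * (ν * W / h) = ν * M ^ p / h * W := by ring
      nlinarith)
    t ht i (Finset.mem_range.2 hi)
  linarith

lemma anti (S : LSol p ν h T m M N u) {t : ℝ} (ht : t ∈ Icc 0 T) : Antitone (fun i => u i t) :=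
  antitone_nat_of_succ_le (fun i => S.mono i ht)

lemma s_lower (S : LSol p ν h T m M N u) {i : ℕ} (hi : i < N) {t : ℝ} (ht : t ∈ Ioc 0 T) :
    -(u i t ^ (1 - p) / (p * t)) ≤ sL ν h u i t := by
  have hI : t ∈ Icc 0 T := ⟨ht.1.le, ht.2⟩
  have h1 := S.BC i hI
  rw [zL_eq hi] at h1
  have hu := S.pos (i := i) hI
  have hp0 : 0 < p := by linarith [S.hp]
  have hup : 0 < u i t ^ p := rpow_pos_of_pos hu p
  rw [rpow_sub hu, rpow_one, ← sub_nonneg]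
  have ht0 := ht.1
  have : sL ν h u i t - -(u i t / u i t ^ p / (p * t)) = (u i t / p + t * (u i t ^ p * sL ν h u i t)) / (t * u i t ^ p) := by
    field_simp
    ring
  rw [this]
  positivity

lemma grad_bd (S : LSol p ν h T m M N u) {t : ℝ} (ht : t ∈ Ioc 0 T) : ∀ i < N,
    u i t - u (i+1) t ≤ h * (u i t ^ (1 - p) / (ν * p * t)) := by
  have hI : t ∈ Icc 0 T := ⟨ht.1.le, ht.2⟩
  have hp0 : 0 < p := by linarith [S.hp]
  have hν0 : 0 < ν := by linarith [S.hν]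
  have ht0 := ht.1
  have hh := S.hh
  have key : ∀ i < N, (4 * (i:ℝ) + ν) * (u i t - u (i+1) t) ≤ 4 * i * (u (i-1) t - u i t) + h * (u i t ^ (1 - p) / (p * t)) := by
    intro i hi
    have h1 := S.s_lower hi ht
    unfold sL Lq at h1
    rw [le_div_iff₀ hh] at h1
    simp only at h1
    linarith
  intro i
  induction i with
  | zero =>
    intro hi
    have := key 0 hi
    simp only [Nat.cast_zero] at this
    have h2 : u 0 t ^ (1 - p) / (ν * p * t) = (u 0 t ^ (1 - p) / (p * t)) / ν := by
      field_simp
    rw [h2, ← mul_div_assoc, le_div_iff₀ hν0]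
    linarith
  | succ k ih =>
    intro hi
    have h1 := key (k+1) hi
    have h2 := ih (by omega)
    simp only [Nat.add_sub_cancel] at h1
    have h3 : u k t ^ (1-p) ≤ u (k+1) t ^ (1-p) :=
      rpow_le_rpow_of_nonpos (S.pos hI) (S.mono k hI) (by linarith [S.hp])
    set B := u (k+1) t ^ (1 - p) / (ν * p * t) with hB
    have h4 : u (k+1) t ^ (1 - p) / (p * t) = ν * B := by rw [hB]; field_simp
    have h5 : u k t ^ (1 - p) / (ν * p * t) ≤ B := by rw [hB]; gcongr
    have h6 : u k t - u (k+1) t ≤ h * B := h2.trans (mul_le_mul_of_nonneg_left h5 hh.le)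
    rw [h4] at h1
    have hk : (0:ℝ) < 4 * ((k+1 : ℕ):ℝ) + ν := by positivity
    have hk' : (0:ℝ) ≤ 4 * ((k+1 : ℕ):ℝ) := by positivity
    have h7 := mul_le_mul_of_nonneg_left h6 hk'
    refine le_of_mul_le_mul_left ?_ hk
    linarith

lemma rpow_tangent {p x y : ℝ} (hp : 1 ≤ p) (hx : 0 < x) (hy : 0 ≤ y) :
    x ^ p + p * x ^ (p - 1) * (y - x) ≤ y ^ p := by
  have h1 := one_add_mul_self_le_rpow_one_add (s := y / x - 1) (by have : 0 ≤ y / x := by positivity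
                                                                   linarith) hp
  have h2 : (1 + (y / x - 1)) = y / x := by ring
  rw [h2, div_rpow hy hx.le, le_div_iff₀ (rpow_pos_of_pos hx p)] at h1
  rw [rpow_sub_one hx.ne']
  refine le_trans (le_of_eq ?_) h1
  field_simp

lemma pow_lower (S : LSol p ν h T m M N u) {t : ℝ} (ht : t ∈ Ioc 0 T) : ∀ i ≤ N,
    u 0 t ^ p - i * h / (ν * t) ≤ u i t ^ p := by
  have hI : t ∈ Icc 0 T := ⟨ht.1.le, ht.2⟩
  have hp0 : 0 < p := by linarith [S.hp]
  have hν0 : 0 < ν := by linarith [S.hν]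
  have ht0 := ht.1
  intro i
  induction i with
  | zero => intro _; simp
  | succ k ih =>
    intro hk
    have h1 := ih (by omega)
    have h2 := S.grad_bd ht k (by omega)
    have hu := S.pos (i := k) hI
    have h3 := rpow_tangent S.hp hu (S.pos (i := k+1) hI).le
    have hq : 0 < u k t ^ (p - 1) := rpow_pos_of_pos hu _
    have h4 : p * u k t ^ (p-1) * (u k t - u (k+1) t) ≤ h / (ν * t) := by
      refine (mul_le_mul_of_nonneg_left h2 (by positivity)).trans (le_of_eq ?_)
      have : u k t ^ (1 - p) = (u k t ^ (p-1))⁻¹ := by rw [← rpow_neg hu.le]; congr 1; ring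
      rw [this]
      field_simp
    push_cast
    have h5 : ((k:ℝ) + 1) * h / (ν * t) = k * h / (ν * t) + h / (ν * t) := by ring
    rw [h5]
    nlinarith

lemma tu_mono (S : LSol p ν h T m M N u) (i : ℕ) : MonotoneOn (fun t => t * u i t) (Icc 0 T) := by
  have hder : ∀ t ∈ Icc 0 T, HasDerivAt (fun t => t * u i t) (1 * u i t + t * zL p ν h N u i t) t :=
    fun t ht => (hasDerivAt_id t).mul (S.der i ht)
  apply monotoneOn_of_deriv_nonneg (convex_Icc 0 T)
  · exact fun t ht => (hder t ht).continuousAt.continuousWithinAt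
  · intro t ht
    rw [interior_Icc] at ht
    exact (hder t ⟨ht.1.le, ht.2.le⟩).differentiableAt.differentiableWithinAt
  · intro t ht
    rw [interior_Icc] at ht
    have hI : t ∈ Icc 0 T := ⟨ht.1.le, ht.2.le⟩
    rw [(hder t hI).deriv]
    have h1 := S.BC i hI
    have h2 : u i t / p ≤ u i t := div_le_self (S.pos hI).le S.hp
    linarith

end LSol

lemma exists_H (p : ℝ) : ∃ H : ℝ → ℝ, ∀ x > 0, HasDerivAt H (x ^ (-p)) x := by
  by_cases hp : p = 1
  · refine ⟨log, fun x hx => ?_⟩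
    rw [hp, rpow_neg_one]
    exact hasDerivAt_log hx.ne'
  · refine ⟨fun x => x ^ (1 - p) / (1 - p), fun x hx => ?_⟩
    have h1 := (hasDerivAt_rpow_const (x := x) (p := 1 - p) (Or.inl hx.ne')).div_const (1 - p)
    refine h1.congr_deriv ?_
    have : 1 - p ≠ 0 := sub_ne_zero.2 (Ne.symm hp)
    rw [show 1 - p - 1 = -p by ring]
    field_simp

lemma H_ineq {p : ℝ} (hp : 1 ≤ p) {H : ℝ → ℝ} (hH : ∀ x > 0, HasDerivAt H (x ^ (-p)) x) {a b : ℝ}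
    (ha : 0 < a) (hab : a ≤ b) : b ^ (1 - p) * log (b / a) ≤ H b - H a := by
  have hb : 0 < b := ha.trans_le hab
  have hder : ∀ x > 0, HasDerivAt (fun x => H x - b ^ (1 - p) * log x) (x ^ (-p) - b ^ (1 - p) * x⁻¹) x :=
    fun x hx => (hH x hx).sub ((hasDerivAt_log hx.ne').const_mul _)
  have hm : MonotoneOn (fun x => H x - b ^ (1 - p) * log x) (Icc a b) := by
    apply monotoneOn_of_deriv_nonneg (convex_Icc a b)
    · exact fun t ht => (hder t (ha.trans_le ht.1)).continuousAt.continuousWithinAt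
    · intro t ht
      rw [interior_Icc] at ht
      exact (hder t (ha.trans ht.1)).differentiableAt.differentiableWithinAt
    · intro t ht
      rw [interior_Icc] at ht
      have ht0 := ha.trans ht.1
      rw [(hder t ht0).deriv]
      have h1 : t ^ (-p) = t ^ (1 - p) * t⁻¹ := by
        rw [← rpow_neg_one t, ← rpow_add ht0]; congr 1; ring
      have h2 : b ^ (1 - p) ≤ t ^ (1 - p) := rpow_le_rpow_of_nonpos ht0 ht.2.le (by linarith)
      rw [h1, ← sub_mul]
      exact mul_nonneg (by linarith) (inv_nonneg.2 ht0.le)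
  have := hm ⟨le_rfl, hab⟩ ⟨hab, le_rfl⟩ hab
  simp only at this
  rw [log_div hb.ne' ha.ne']
  linarith

namespace LSol
variable {p ν h T m M : ℝ} {N : ℕ} {u : ℕ → ℝ → ℝ}

lemma conts (S : LSol p ν h T m M N u) (i : ℕ) : ContinuousOn (sL ν h u i) (Icc 0 T) :=
  fun _ ht => (derLq (fun i => S.der i ht) i).continuousAt.continuousWithinAt

set_option maxHeartbeats 2000000 in
lemma decay (S : LSol p ν h T m M N u) {τ : ℝ} (hτ2 : 2 ≤ τ) (hτT : τ ≤ T) (hτM : exp 1 * M ≤ τ)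
    {I0 : ℕ} (hI0 : 1 ≤ I0) (hinit : ∀ i ≥ I0, u i 0 ≤ (τ ^ 132)⁻¹) (hN : ν * τ * M ^ p < N * h) :
    u 0 τ ^ p ≤ (4 * (I0 + 1) * h + 1) / τ := by
  have hτ0 : 0 < τ := by linarith
  have hτI : τ ∈ Icc 0 T := ⟨hτ0.le, hτT⟩
  have hsub : Icc 0 τ ⊆ Icc 0 T := Icc_subset_Icc_right hτT
  set A := u 0 τ with hA
  have hA0 : 0 < A := S.pos hτI
  have hν0 : 0 < ν := by linarith [S.hν]
  have hp := S.hp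
  have hh := S.hh
  have hM0 : 0 < M := by linarith [S.hM]
  have hI0' : (1:ℝ) ≤ I0 := by exact_mod_cast hI0
  by_cases hc1 : τ * A < 1
  · have h1 : A ≤ 1 / τ := by rw [le_div_iff₀ hτ0]; linarith
    have hA1 : A ≤ 1 := h1.trans (by rw [div_le_one hτ0]; linarith)
    have h2 : A ^ p ≤ A := by
      simpa using rpow_le_rpow_of_exponent_ge hA0 hA1 hp
    refine (h2.trans h1).trans ?_
    gcongr
    have : 0 ≤ 4 * ((I0:ℝ) + 1) * h := by positivity
    linarith
  push Not at hc1
  set X := ν * τ * A ^ p / 2 with hX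
  by_cases hc2 : X ≤ (2 * I0 + 2) * h
  · rw [le_div_iff₀ hτ0]
    have hAp : 0 ≤ A ^ p := rpow_nonneg hA0.le _
    have : τ * A ^ p ≤ X := by
      rw [hX]
      nlinarith [mul_nonneg hτ0.le hAp, S.hν]
    nlinarith [mul_pos (by linarith : (0:ℝ) < I0 + 1) hh]
  exfalso
  push Not at hc2
  set I1 := ⌊X / h⌋₊ with hI1
  have hX0 : 0 < X := by rw [hX]; positivity
  have hXh : (2 * I0 + 2 : ℝ) < X / h := by rwa [lt_div_iff₀ hh]
  have hI1le : (I1:ℝ) ≤ X / h := Nat.floor_le (by positivity)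
  have hI1lt : X / h < I1 + 1 := Nat.lt_floor_add_one _
  have hI1I0 : 2 * I0 + 2 ≤ I1 := Nat.le_floor (by push_cast; exact hXh.le)
  have hI1pos : (0:ℝ) < I1 := by
    have : 0 < I1 := by omega
    exact_mod_cast this
  have hI1X : (I1:ℝ) * h ≤ X := by rwa [le_div_iff₀ hh] at hI1le
  have hAM : A ≤ M := S.hi 0 τ hτI
  have hXM : X ≤ ν * τ * M ^ p := by
    have : A ^ p ≤ M ^ p := rpow_le_rpow hA0.le hAM (by linarith)
    have h2 : ν * τ * A ^ p ≤ ν * τ * M ^ p := mul_le_mul_of_nonneg_left this (by positivity)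
    have h3 : 0 ≤ ν * τ * A ^ p := by positivity
    rw [hX]; linarith
  have hI1N : I1 < N := by
    have : (I1:ℝ) * h < N * h := by linarith
    exact_mod_cast lt_of_mul_lt_mul_right this hh.le
  -- lower bound at time τ
  have hlow : ∀ i ≤ I1, A / 2 ≤ u i τ := by
    intro i hi
    have h1 := S.pow_lower (t := τ) ⟨hτ0, hτT⟩ i (by omega)
    have h2 : (i:ℝ) * h / (ν * τ) ≤ A ^ p / 2 := by
      rw [div_le_iff₀ (by positivity)]
      have : (i:ℝ) ≤ I1 := by exact_mod_cast hi
      have : (i:ℝ) * h ≤ I1 * h := mul_le_mul_of_nonneg_right this hh.le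
      have : A ^ p / 2 * (ν * τ) = X := by rw [hX]; ring
      linarith
    have h3 : (A / 2) ^ p ≤ A ^ p / 2 := by
      rw [div_rpow hA0.le (by norm_num)]
      have : (2:ℝ) ≤ 2 ^ p := by
        simpa using rpow_le_rpow_of_exponent_le (by norm_num : (1:ℝ) ≤ 2) hp
      gcongr
    have h4 : (A/2) ^ p ≤ u i τ ^ p := by linarith
    exact (rpow_le_rpow_iff (by positivity) (S.pos hτI).le (by linarith)).1 h4
  set δ : ℝ := (τ ^ 132)⁻¹ with hδ
  have hδ0 : 0 < δ := by positivity
  have hlog2 : log 2 ≤ log τ := log_le_log (by norm_num) hτ2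
  have hlogτ : 0 < log τ := log_pos (by linarith)
  have hlogA : -log τ ≤ log A := by
    have := log_nonneg hc1
    rw [log_mul hτ0.ne' hA0.ne'] at this
    linarith
  have hlogδ : log δ = -(132 * log τ) := by
    rw [hδ, log_inv, log_pow]; norm_num
  have hlogq : 130 * log τ ≤ log (A / 2 / δ) := by
    rw [log_div (by positivity) hδ0.ne', log_div hA0.ne' (by norm_num), hlogδ]
    linarith
  have hδA : δ ≤ A / 2 := by
    by_contra hcon
    push Not at hcon
    have : A / 2 / δ < 1 := by rwa [div_lt_one hδ0]
    have := log_neg (by positivity) this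
    linarith
  obtain ⟨H, hH⟩ := exists_H p
  set Λ := A ^ (1 - p) * (130 * log τ) with hΛ
  have hA1p : 0 < A ^ (1 - p) := rpow_pos_of_pos hA0 _
  have hΛ0 : 0 < Λ := by positivity
  have hIntg : ∀ i, IntervalIntegrable (u i) volume 0 τ := fun i =>
    ((S.cont i).mono hsub).intervalIntegrable_of_Icc hτ0.le
  set U : ℕ → ℝ := fun i => ∫ t in (0:ℝ)..τ, u i t with hU
  have hLU : ∀ i, Lq ν h U i = ∫ t in (0:ℝ)..τ, sL ν h u i t := by
    intro i
    simp only [sL, Lq]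
    rw [intervalIntegral.integral_div, intervalIntegral.integral_add, intervalIntegral.integral_const_mul,
      intervalIntegral.integral_const_mul, intervalIntegral.integral_sub (hIntg _) (hIntg _),
      intervalIntegral.integral_sub (hIntg _) (hIntg _)]
    · exact ((hIntg _).sub (hIntg _)).const_mul _
    · exact ((hIntg _).sub (hIntg _)).const_mul _
  have hLUge : ∀ i, I0 ≤ i → i ≤ I1 → Λ ≤ Lq ν h U i := by
    intro i hi1 hi2
    have hiN : i < N := by omega
    have h1 : ∫ t in (0:ℝ)..τ, sL ν h u i t = H (u i τ) - H (u i 0) := by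
      apply intervalIntegral.integral_eq_sub_of_hasDerivAt (f := fun t => H (u i t))
      · intro t ht
        rw [uIcc_of_le hτ0.le] at ht
        have htI := hsub ht
        have hu := S.pos (i := i) htI
        have h2 := (hH _ hu).comp t (S.der i htI)
        refine h2.congr_deriv ?_
        rw [zL_eq hiN, ← mul_assoc, ← rpow_add hu]
        simp
      · exact ((S.conts i).mono hsub).intervalIntegrable_of_Icc hτ0.le
    rw [hLU, h1]
    have h0 : (0:ℝ) ∈ Icc 0 T := ⟨le_rfl, S.hT.le⟩
    have ha := S.pos (i := i) h0
    have hb := hlow i hi2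
    have haδ : u i 0 ≤ δ := hinit i hi1
    have hub : u i τ ≤ A := S.anti hτI (Nat.zero_le i)
    refine le_trans ?_ (H_ineq hp hH ha (haδ.trans (hδA.trans hb)))
    have h5 : A ^ (1-p) ≤ u i τ ^ (1-p) := rpow_le_rpow_of_nonpos (S.pos hτI) hub (by linarith)
    have h6 : 130 * log τ ≤ log (u i τ / u i 0) := by
      refine hlogq.trans (log_le_log (by positivity) ?_)
      exact div_le_div₀ (S.pos hτI).le hb ha haδ
    exact mul_le_mul h5 h6 (by positivity) (rpow_nonneg (S.pos hτI).le _)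
  have hUanti : ∀ i, U (i+1) ≤ U i := by
    intro i
    apply intervalIntegral.integral_mono_on hτ0.le (hIntg _) (hIntg _)
    intro t ht
    exact S.mono i (hsub ht)
  set g := h * Λ / (4 * I1) with hg
  have hg0 : 0 < g := by positivity
  have hestep : ∀ j, I0 ≤ j + 1 → j + 1 ≤ I1 → U (j+1) - U (j+2) + g ≤ U j - U (j+1) := by
    intro j h1 h2
    have h3 := hLUge (j+1) h1 h2
    unfold Lq at h3
    rw [le_div_iff₀ hh] at h3
    simp only [Nat.add_sub_cancel] at h3
    have h4 := hUanti (j+1)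
    have hj : (0:ℝ) < ((j+1 : ℕ):ℝ) := by positivity
    have hj1 : ((j+1 : ℕ):ℝ) ≤ I1 := by exact_mod_cast h2
    have h5 : 4 * ((j+1 : ℕ):ℝ) * g ≤ Λ * h := by
      rw [hg, mul_div_assoc', div_le_iff₀ (by positivity)]
      nlinarith [mul_pos hh hΛ0]
    have h6 : 4 * ((j+1 : ℕ):ℝ) * (U (j+1) - U (j+2) + g) ≤ 4 * ((j+1 : ℕ):ℝ) * (U j - U (j+1)) := by
      nlinarith [mul_nonneg hν0.le (sub_nonneg.2 h4)]
    exact le_of_mul_le_mul_left h6 (by positivity)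
  have he : ∀ k, I0 + k ≤ I1 → k * g ≤ U (I1 - k) - U (I1 - k + 1) := by
    intro k
    induction k with
    | zero => intro _; simpa using hUanti I1
    | succ k ih =>
      intro hk
      have h1 := ih (by omega)
      have h2 := hestep (I1 - (k+1)) (by omega) (by omega)
      have h3 : I1 - (k+1) + 1 = I1 - k := by omega
      have h4 : I1 - (k+1) + 2 = I1 - k + 1 := by omega
      rw [h3, h4] at h2
      rw [h3]
      push_cast
      linarith
  have hUpos : ∀ i, 0 ≤ U i := fun i =>
    intervalIntegral.integral_nonneg hτ0.le (fun t ht => (S.pos (hsub ht)).le)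
  have hUk : ∀ k, I0 + k ≤ I1 → g * (k:ℝ)^2 / 2 ≤ U (I1 - k) := by
    intro k
    induction k with
    | zero => intro _; simpa using hUpos I1
    | succ k ih =>
      intro hk
      have h1 := ih (by omega)
      have h2 := he (k+1) hk
      have h3 : I1 - (k+1) + 1 = I1 - k := by omega
      rw [h3] at h2
      push_cast at h2 ⊢
      have h4 : g * ((k:ℝ) + 1) ^ 2 / 2 = g * (k:ℝ) ^ 2 / 2 + (k + 1) * g - g / 2 := by ring
      linarith
  have hlower := hUk (I1 - I0) (by omega)
  have hI10 : I1 - (I1 - I0) = I0 := by omega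
  rw [hI10, Nat.cast_sub (by omega)] at hlower
  have hI1I0' : (2 * I0 + 2 : ℝ) ≤ I1 := by exact_mod_cast hI1I0
  have hlower2 : Λ * X / 64 ≤ U I0 := by
    refine le_trans ?_ hlower
    have h1 : ((I1:ℝ) / 2) ^ 2 ≤ ((I1:ℝ) - I0) ^ 2 := by
      apply pow_le_pow_left₀ (by positivity); linarith
    have h2 : X ≤ 2 * I1 * h := by
      rw [div_lt_iff₀ hh] at hI1lt
      nlinarith
    have h3 : Λ * X / 64 ≤ h * Λ * I1 / 32 := by
      nlinarith
    have h4 : g * ((I1:ℝ) / 2) ^ 2 / 2 = h * Λ * I1 / 32 := by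
      rw [hg]; field_simp; ring
    have h5 : g * ((I1:ℝ) / 2) ^ 2 ≤ g * ((I1:ℝ) - I0) ^ 2 := mul_le_mul_of_nonneg_left h1 hg0.le
    linarith
  have hupper : U I0 ≤ 1 + τ * A * log (τ * M) := by
    have hMinv : 0 < 1 / M := by positivity
    have hMinv1 : 1 / M ≤ τ := by
      have : 1 / M ≤ 1 := by rw [div_le_one hM0]; exact S.hM
      linarith
    have hi1 : IntervalIntegrable (u I0) volume 0 (1/M) :=
      ((S.cont I0).mono (Icc_subset_Icc_right (hMinv1.trans hτT))).intervalIntegrable_of_Icc hMinv.le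
    have hi2 : IntervalIntegrable (u I0) volume (1/M) τ :=
      ((S.cont I0).mono (Icc_subset_Icc hMinv.le hτT)).intervalIntegrable_of_Icc hMinv1
    have h0 : U I0 = (∫ t in (0:ℝ)..(1/M), u I0 t) + ∫ t in (1/M)..τ, u I0 t :=
      (intervalIntegral.integral_add_adjacent_intervals hi1 hi2).symm
    have h1 : (∫ t in (0:ℝ)..(1/M), u I0 t) ≤ 1 := by
      have : (∫ t in (0:ℝ)..(1/M), u I0 t) ≤ ∫ t in (0:ℝ)..(1/M), M := by
        apply intervalIntegral.integral_mono_on hMinv.le hi1 (by simp)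
        intro t ht
        exact S.hi _ _ ⟨ht.1, ht.2.trans (hMinv1.trans hτT)⟩
      refine this.trans (le_of_eq ?_)
      rw [intervalIntegral.integral_const]
      simp [hM0.ne']
    have hc : ContinuousOn (fun t : ℝ => τ * A * t⁻¹) (Icc (1/M) τ) := by
      apply ContinuousOn.mul continuousOn_const
      apply continuousOn_inv₀.mono
      intro t ht
      simpa using (hMinv.trans_le ht.1).ne'
    have h2 : (∫ t in (1/M)..τ, u I0 t) ≤ τ * A * log (τ * M) := by
      have : (∫ t in (1/M)..τ, u I0 t) ≤ ∫ t in (1/M)..τ, τ * A * t⁻¹ := by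
        apply intervalIntegral.integral_mono_on hMinv1 hi2 (hc.intervalIntegrable_of_Icc hMinv1)
        intro t ht
        have ht0 : 0 < t := hMinv.trans_le ht.1
        have htT : t ∈ Icc 0 T := ⟨ht0.le, ht.2.trans hτT⟩
        have := S.tu_mono I0 htT hτI ht.2
        simp only at this
        have h3 : u I0 τ ≤ A := S.anti hτI (Nat.zero_le I0)
        rw [← div_eq_mul_inv, le_div_iff₀ ht0]
        nlinarith
      refine this.trans (le_of_eq ?_)
      rw [intervalIntegral.integral_const_mul, integral_inv_of_pos hMinv hτ0]
      congr 2
      field_simp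
    linarith
  have hMlog : 1 + log M ≤ log τ := by
    have := log_le_log (by positivity) hτM
    rwa [log_mul (exp_pos 1).ne' hM0.ne', log_exp] at this
  have hM1 : 0 ≤ log M := log_nonneg S.hM
  rw [log_mul hτ0.ne' hM0.ne'] at hupper
  have hΛX : Λ * X = ν * (τ * A) * (65 * log τ) := by
    rw [hΛ, hX]
    have : A ^ (1-p) * A ^ p = A := by rw [← rpow_add hA0]; simp
    calc _ = ν * τ * (A ^ (1-p) * A ^ p) * (65 * log τ) := by ring
      _ = _ := by rw [this]; ring
  have hfin : ν * (τ * A) * (65 * log τ) / 64 ≤ 1 + τ * A * (log τ + log M) := by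
    rw [← hΛX]; linarith
  have h8 : 0 < τ * A := by positivity
  have h9 : 2 * (τ * A) * (65 * log τ) ≤ ν * (τ * A) * (65 * log τ) := by
    have := S.hν; gcongr
  have h10 : τ * A * (1 + log M) ≤ τ * A * log τ := by gcongr
  nlinarith [mul_pos h8 hlogτ]

end LSol

lemma scal_alg {p h m M Cw Ξ ε θ ai am ui si sm φi φm K R P mp Lψ Cs : ℝ} {zi zm : ℝ}
    (hp : 0 < p) (hm : 0 < m) (hum : m ≤ ui) (hθ : 0 ≤ θ) (hε : 0 < ε) (hai : 0 < ai)
    (hR : 0 < R) (hP : 0 < P) (hCw : 0 ≤ Cw) (hh : 0 < h) (hmp : 0 < mp) (hmpa : mp ≤ ai)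
    (hzi : zi = ai * si) (hzm : zm = am * sm)
    (htouch : φi + θ * zi = ε) (hφ : φi ≤ 0) (hφΞ : -φi ≤ Ξ * Cw) (hεM : ε ≤ M)
    (hk1 : p * (ai / ui) * (-φi) ≤ K) (hk2 : K ≤ P * (-φi)) (hPR : P ≤ p * R * (ai / ui))
    (ham : ai ≤ am) (ham2 : am - ai ≤ P * h * Cw)
    (hL0 : ai * Lψ ≤ 0)
    (hL : ∀ lam, 0 ≤ lam → lam ≤ p * R * (ai / ui) * si → ai * Lψ ≤ lam * (φm + θ * zm - (φi + θ * zi)))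
    (hφm : φm - φi ≤ h * (Cs / 4 + Cw))
    (hC : h * (p / m * R * (Cs / 4 + Cw + P * Cw * (Ξ * Cw + M) / mp)) ≤ 1 / 8)
    (hε8 : p * ε / m ≤ 1 / 8) :
    ai * Lψ - zi / 2 - K * sm + θ * p * zi ^ 2 / ui < 0 := by
  have hui : 0 < ui := hm.trans_le hum
  have hθz : 0 < θ * zi := by linarith
  have hz : 0 < zi := pos_of_mul_pos_right hθz hθ
  have hs : 0 < si := by rw [hzi] at hz; exact pos_of_mul_pos_right hz hai.le
  have h1 : θ * p * zi ^ 2 / ui = p * (ai / ui) * (-φi) * si + p * ε / ui * zi := by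
    have : θ * p * zi ^ 2 / ui = p * zi / ui * (θ * zi) := by ring
    rw [this, show θ * zi = ε - φi by linarith, hzi]
    ring
  have h2 : p * (ai / ui) * (-φi) * si ≤ K * si := mul_le_mul_of_nonneg_right hk1 hs.le
  have h3 : p * ε / ui * zi ≤ 1 / 8 * zi := by
    apply mul_le_mul_of_nonneg_right _ hz.le
    refine le_trans ?_ hε8
    gcongr
  have hK0 : 0 ≤ K := le_trans (by have : 0 ≤ -φi := by linarith
                                   positivity) hk1
  rcases le_or_gt si sm with hc | hc
  · have : K * si ≤ K * sm := mul_le_mul_of_nonneg_left hc hK0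
    linarith
  · set lam := p * R * (ai / ui) * si with hlam
    have hlam0 : 0 ≤ lam := by positivity
    have h4 := hL lam hlam0 le_rfl
    have h5 : K ≤ lam * θ * ai := by
      have : lam * θ * ai = p * R * (ai / ui) * (ε - φi) := by
        rw [hlam, ← htouch, hzi]; ring
      rw [this]
      calc K ≤ P * (-φi) := hk2
        _ ≤ p * R * (ai / ui) * (-φi) := mul_le_mul_of_nonneg_right hPR (by linarith)
        _ ≤ _ := mul_le_mul_of_nonneg_left (by linarith) (by positivity)
    have h6 : K * (si - sm) ≤ lam * θ * ai * (si - sm) := mul_le_mul_of_nonneg_right h5 (by linarith)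
    have h7 : θ * (am - ai) * sm ≤ h * (P * Cw * (Ξ * Cw + M) / mp) := by
      have e1 : θ * si ≤ (Ξ * Cw + M) / mp := by
        rw [le_div_iff₀ hmp]
        have : θ * si * mp ≤ θ * si * ai := mul_le_mul_of_nonneg_left hmpa (by positivity)
        rw [hzi] at htouch
        linarith
      have e2 : θ * sm ≤ θ * si := mul_le_mul_of_nonneg_left hc.le hθ
      have e3 : (am - ai) * (θ * sm) ≤ (am - ai) * (θ * si) := mul_le_mul_of_nonneg_left e2 (by linarith)
      have e4 : (am - ai) * (θ * si) ≤ (P * h * Cw) * ((Ξ * Cw + M) / mp) :=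
        mul_le_mul ham2 e1 (by positivity) (by positivity)
      calc θ * (am - ai) * sm = (am - ai) * (θ * sm) := by ring
        _ ≤ (P * h * Cw) * ((Ξ * Cw + M) / mp) := e3.trans e4
        _ = _ := by ring
    have h8 : φm + θ * zm - (φi + θ * zi) ≤ h * (Cs / 4 + Cw + P * Cw * (Ξ * Cw + M) / mp) - θ * ai * (si - sm) := by
      have : φm + θ * zm - (φi + θ * zi) = (φm - φi) + θ * (am - ai) * sm - θ * ai * (si - sm) := by
        rw [hzi, hzm]; ring
      rw [this]
      have : h * (Cs / 4 + Cw + P * Cw * (Ξ * Cw + M) / mp) = h * (Cs / 4 + Cw) + h * (P * Cw * (Ξ * Cw + M) / mp) := by ring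
      rw [this]
      linarith
    set C' := Cs / 4 + Cw + P * Cw * (Ξ * Cw + M) / mp with hC'
    have h9 := mul_le_mul_of_nonneg_left h8 hlam0
    have h10 : lam * (h * C') ≤ 1 / 8 * zi := by
      by_cases hneg : C' ≤ 0
      · have : lam * (h * C') ≤ 0 := mul_nonpos_of_nonneg_of_nonpos hlam0 (mul_nonpos_of_nonneg_of_nonpos hh.le hneg)
        linarith
      · push Not at hneg
        have e1 : lam * (h * C') = (h * (p / ui * R * C')) * zi := by rw [hlam, hzi]; ring
        rw [e1]
        apply mul_le_mul_of_nonneg_right _ hz.le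
        refine le_trans ?_ hC
        gcongr
    have h11 : lam * (h * C' - θ * ai * (si - sm)) = lam * (h * C') - lam * θ * ai * (si - sm) := by ring
    rw [h11] at h9
    nlinarith

noncomputable def Cw (p ν m t1 : ℝ) : ℝ := m ^ (1 - p) / (ν * p * t1)
noncomputable def Csc (p ν m M t1 Ξ : ℝ) : ℝ :=
  p / m * (M / m) ^ (p - 1) * (ν * Cw p ν m t1 / 4 + Cw p ν m t1 +
    p * M ^ (p - 1) * Cw p ν m t1 * (Ξ * Cw p ν m t1 + M) / m ^ p)

noncomputable def phL (u : ℕ → ℝ → ℝ) (i : ℕ) (t : ℝ) : ℝ := i * (u i t - u (i - 1) t)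

namespace LSol
variable {p ν h T m M : ℝ} {N : ℕ} {u : ℕ → ℝ → ℝ}

lemma ph_identity (ν h : ℝ) (hh : h ≠ 0) (u : ℕ → ℝ → ℝ) (k : ℕ) (t : ℝ) :
    ((k + 1 : ℕ) : ℝ) * (sL ν h u (k+1) t - sL ν h u k t) = Lq ν h (fun j => phL u j t) (k+1) - sL ν h u (k+1) t := by
  rcases k with _ | k
  · simp [sL, Lq, phL]
    field_simp
    ring
  · simp only [sL, Lq, phL, Nat.add_sub_cancel]
    push_cast
    field_simp
    ring

lemma ph_identity2 (ν h : ℝ) (hh : h ≠ 0) (u : ℕ → ℝ → ℝ) (k : ℕ) (t : ℝ) :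
    4 * (phL u (k+1) t - phL u k t) = h * sL ν h u k t + (4 - ν) * (u (k+1) t - u k t) := by
  simp only [sL, Lq, phL, Nat.add_sub_cancel]
  push_cast
  field_simp
  ring

lemma grad_bd' (S : LSol p ν h T m M N u) {t1 t : ℝ} (ht1 : 0 < t1) (ht : t ∈ Icc t1 T) (i : ℕ) :
    u i t - u (i+1) t ≤ h * Cw p ν m t1 := by
  have hp0 : 0 < p := by linarith [S.hp]
  have hν0 : 0 < ν := by linarith [S.hν]
  have hm := S.hm
  have hh := S.hh
  have h0 : 0 ≤ m ^ (1 - p) := rpow_nonneg hm.le _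
  have hI : t ∈ Icc 0 T := ⟨ht1.le.trans ht.1, ht.2⟩
  by_cases hi : i < N
  · refine (S.grad_bd ⟨ht1.trans_le ht.1, ht.2⟩ i hi).trans ?_
    apply mul_le_mul_of_nonneg_left _ hh.le
    unfold Cw
    have := rpow_le_rpow_of_nonpos hm (S.lo i t hI) (by linarith [S.hp] : 1 - p ≤ 0)
    have := ht.1
    gcongr
  · rw [S.hN i (not_lt.1 hi), S.hN (i+1) (by omega)]
    unfold Cw
    rw [sub_self]
    positivity

lemma scaling (S : LSol p ν h T m M N u) {t1 : ℝ} (ht1 : 0 < t1)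
    (hC : h * Csc p ν m M t1 (N * h) ≤ 1 / 8) {t : ℝ} (ht : t ∈ Icc t1 T) (i : ℕ) :
    (t - t1) / 2 * zL p ν h N u i t ≤ i * (u (i-1) t - u i t) + M := by
  have hp1 := S.hp
  have hp0 : 0 < p := by linarith [S.hp]
  have hν0 : 0 < ν := by linarith [S.hν]
  have hm := S.hm
  have hh := S.hh
  have hM0 : 0 < M := by linarith [S.hM]
  have hmM : m ≤ M := (S.lo 0 0 ⟨le_rfl, S.hT.le⟩).trans (S.hi 0 0 ⟨le_rfl, S.hT.le⟩)
  have hsub : Icc t1 T ⊆ Icc 0 T := Icc_subset_Icc_left ht1.le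
  set ε := m / (8 * p) with hε
  have hε0 : 0 < ε := by positivity
  have hεM : ε ≤ M := by
    rw [hε]
    refine le_trans ?_ hmM
    apply div_le_self hm.le; linarith
  have hφneg : ∀ i, ∀ t ∈ Icc 0 T, phL u i t ≤ 0 := by
    intro i t ht
    unfold phL
    have : u i t ≤ u (i-1) t := S.anti ht (Nat.sub_le i 1)
    exact mul_nonpos_of_nonneg_of_nonpos (Nat.cast_nonneg i) (by linarith)
  have hCw0 : 0 ≤ Cw p ν m t1 := by
    unfold Cw
    have h0 : 0 ≤ m ^ (1 - p) := rpow_nonneg hm.le _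
    positivity
  set W := Cw p ν m t1 with hW
  by_cases hi : N ≤ i
  · rw [zL_ge hi]
    have := hφneg i t (hsub ht)
    unfold phL at this
    simp only [mul_zero]; linarith
  have key := MP (Finset.range (N + 1)) (fun i s => (phL u i s + (s - t1) / 2 * zL p ν h N u i s) - ε) t1 T
    (fun i _ => by
      have h1 := (S.cont i).mono hsub
      have h2 := (S.contz i).mono hsub
      have h3 := (S.cont (i-1)).mono hsub
      unfold phL
      fun_prop)
    (fun i _ => by
      have := hφneg i t1 (hsub ⟨le_rfl, ht.1.trans ht.2⟩)
      simp only [sub_self, zero_div, zero_mul]; linarith)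
    (fun s hs i hi hQ hall => by
      have hsI1 : s ∈ Icc t1 T := ⟨hs.1.le, hs.2⟩
      have hsI : s ∈ Icc 0 T := hsub hsI1
      rw [Finset.mem_range] at hi
      have hall' : ∀ j ≤ N, phL u j s + (s - t1) / 2 * zL p ν h N u j s ≤ ε := by
        intro j hj
        have := hall j (Finset.mem_range.2 (by omega)); linarith
      have htouch : phL u i s + (s - t1) / 2 * zL p ν h N u i s = ε := by linarith
      have hθ : 0 ≤ (s - t1) / 2 := by linarith [hs.1]
      have hiN : i < N := by
        rcases Nat.lt_or_ge i N with h | h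
        · exact h
        · exfalso
          rw [zL_ge h] at htouch
          linarith [hφneg i s hsI]
      obtain ⟨k, rfl⟩ : ∃ k, i = k + 1 := by
        rcases i with _ | k
        · exfalso
          have h1 : zL p ν h N u 0 s ≤ 0 := by
            rw [zL_eq hiN]
            apply mul_nonpos_of_nonneg_of_nonpos (rpow_nonneg (S.pos hsI).le _)
            exact Lq_le_of_max hν0.le hh (S.mono 0 hsI) le_rfl
          have := mul_nonpos_of_nonneg_of_nonpos hθ h1
          linarith [hφneg 0 s hsI]
        · exact ⟨k, rfl⟩
      have hkN : k < N := by omega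
      set ψ : ℕ → ℝ := fun j => phL u j s + (s - t1) / 2 * zL p ν h N u j s with hψ
      have hui := S.pos (i := k+1) hsI
      have hum := S.pos (i := k) hsI
      have hmono := S.mono k hsI
      have hmui := S.lo (k+1) s hsI
      set I : ℝ := ((k+1 : ℕ) : ℝ) with hI
      have hI0 : 0 < I := by rw [hI]; positivity
      have hIN : I ≤ N := by rw [hI]; exact_mod_cast hiN.le
      have hgrad := S.grad_bd' ht1 hsI1 k
      have hph : phL u (k+1) s = I * (u (k+1) s - u k s) := by simp [phL, hI]
      have hq : u (k+1) s ^ (p - 1) = u (k+1) s ^ p / u (k+1) s := rpow_sub_one hui.ne' p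
      have hLneg : Lq ν h ψ (k+1) ≤ 0 := by
        apply Lq_le_of_max hν0.le hh
        · simp only [hψ]; rw [htouch]; exact hall' _ (by omega)
        · simp only [hψ]; rw [htouch]; exact hall' _ (by omega)
      have hai : 0 < u (k+1) s ^ p := rpow_pos_of_pos hui _
      -- tangent bounds
      have htan1 := rpow_tangent hp1 hui hum.le
      have htan2 := rpow_tangent hp1 hum hui.le
      have hPm : u k s ^ (p-1) ≤ M ^ (p-1) := rpow_le_rpow hum.le (S.hi _ _ hsI) (by linarith)
      have hMp : 0 < M ^ (p-1) := rpow_pos_of_pos hM0 _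
      have hdiff : u k s ^ p - u (k+1) s ^ p ≤ p * M ^ (p-1) * (u k s - u (k+1) s) := by
        have : p * u k s ^ (p-1) * (u k s - u (k+1) s) ≤ p * M ^ (p-1) * (u k s - u (k+1) s) := by
          apply mul_le_mul_of_nonneg_right _ (by linarith)
          exact mul_le_mul_of_nonneg_left hPm hp0.le
        linarith
      have halg := scal_alg (p := p) (h := h) (m := m) (M := M) (Cw := W) (Ξ := N * h) (ε := ε)
        (θ := (s - t1) / 2) (ai := u (k+1) s ^ p) (am := u k s ^ p) (ui := u (k+1) s)
        (si := sL ν h u (k+1) s) (sm := sL ν h u k s) (φi := phL u (k+1) s) (φm := phL u k s)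
        (K := I * (u k s ^ p - u (k+1) s ^ p)) (R := (M / m) ^ (p-1)) (P := p * M ^ (p-1)) (mp := m ^ p)
        (Lψ := Lq ν h ψ (k+1)) (Cs := ν * W) (zi := zL p ν h N u (k+1) s) (zm := zL p ν h N u k s)
        hp0 hm hmui hθ hε0 hai (by positivity) (by positivity) hCw0 hh (by positivity)
        (rpow_le_rpow hm.le hmui hp0.le) (zL_eq hiN s) (zL_eq hkN s) htouch (hφneg _ s hsI)
        (by
          rw [hph]
          have e1 : I * (u k s - u (k+1) s) ≤ N * (h * W) :=
            mul_le_mul hIN hgrad (by linarith) (by positivity)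
          linarith) hεM
        (by
          rw [hph, ← hq]
          have : p * u (k+1) s ^ (p-1) * (u k s - u (k+1) s) ≤ u k s ^ p - u (k+1) s ^ p := by linarith
          have := mul_le_mul_of_nonneg_left this hI0.le
          linarith)
        (by
          rw [hph]
          have := mul_le_mul_of_nonneg_left hdiff hI0.le
          linarith)
        (by
          rw [← hq, mul_assoc]
          apply mul_le_mul_of_nonneg_left _ hp0.le
          rw [← mul_rpow (by positivity) hui.le]
          apply rpow_le_rpow hM0.le _ (by linarith)
          rw [div_mul_eq_mul_div, le_div_iff₀ hm]
          exact mul_le_mul_of_nonneg_left hmui hM0.le)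
        (rpow_le_rpow hui.le hmono hp0.le)
        (by
          refine hdiff.trans ?_
          have := mul_le_mul_of_nonneg_left hgrad (by positivity : 0 ≤ p * M ^ (p-1))
          linarith)
        (mul_nonpos_of_nonneg_of_nonpos hai.le hLneg)
        (by
          intro lam hlam0 hlam
          have e0 : Lq ν h ψ (k+1) ≤ 4 * I * (ψ k - ψ (k+1)) / h := by
            unfold Lq
            apply div_le_div_of_nonneg_right _ hh.le
            simp only [Nat.add_sub_cancel]
            have h1 : ψ (k+2) ≤ ψ (k+1) := by
              simp only [hψ]; rw [htouch]; exact hall' _ (by omega)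
            have := mul_nonneg (by positivity : 0 ≤ 4 * I + ν) (sub_nonneg.2 h1)
            linarith
          have hd : ψ k - ψ (k+1) ≤ 0 := by
            simp only [hψ]; rw [htouch]; linarith [hall' k (by omega)]
          have e1 : lam ≤ u (k+1) s ^ p * (4 * I / h) := by
            refine hlam.trans ?_
            have hsle : sL ν h u (k+1) s ≤ 4 * I * W := by
              unfold sL Lq
              rw [div_le_iff₀ hh]
              simp only [Nat.add_sub_cancel]
              have h1 := S.mono (k+1) hsI
              have h2 := mul_nonneg (by positivity : 0 ≤ 4 * I + ν) (sub_nonneg.2 h1)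
              have h3 := mul_le_mul_of_nonneg_left hgrad (by positivity : 0 ≤ 4 * I)
              linarith
            have hRpos : 0 < (M / m) ^ (p-1) := by positivity
            have hCC : h * (p / m * (M / m) ^ (p-1) * W) ≤ 1 := by
              refine le_trans ?_ (hC.trans (by norm_num))
              unfold Csc
              rw [← hW]
              gcongr
              have h1 : 0 ≤ ν * W / 4 := by positivity
              have h2 : 0 ≤ p * M ^ (p - 1) * W * (↑N * h * W + M) / m ^ p := by positivity
              linarith
            have hcc2 : p * (M / m) ^ (p-1) * (1 / u (k+1) s) * W ≤ 1 / h := by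
              rw [le_div_iff₀ hh]
              refine le_trans ?_ hCC
              have : h * (p / m * (M / m) ^ (p-1) * W) = p * (M / m) ^ (p-1) * (1 / m) * W * h := by ring
              rw [this]
              gcongr
            calc p * (M / m) ^ (p-1) * (u (k+1) s ^ p / u (k+1) s) * sL ν h u (k+1) s
                ≤ p * (M / m) ^ (p-1) * (u (k+1) s ^ p / u (k+1) s) * (4 * I * W) := by gcongr
              _ = u (k+1) s ^ p * (4 * I) * (p * (M / m) ^ (p-1) * (1 / u (k+1) s) * W) := by ring
              _ ≤ u (k+1) s ^ p * (4 * I) * (1 / h) := by gcongr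
              _ = _ := by ring
          have e2 := mul_le_mul_of_nonneg_left e0 hai.le
          have e3 := mul_le_mul_of_nonpos_right e1 hd
          have e4 : u (k+1) s ^ p * (4 * I * (ψ k - ψ (k+1)) / h) = u (k+1) s ^ p * (4 * I / h) * (ψ k - ψ (k+1)) := by ring
          rw [e4] at e2
          exact e2.trans e3)
        (by
          have h1 := ph_identity2 ν h hh.ne' u k s
          have h2 := S.s_lower hkN (t := s) ⟨ht1.trans hs.1, hs.2⟩
          have h3 : u k s ^ (1 - p) / (p * s) ≤ ν * W := by
            have : ν * W = m ^ (1-p) / (p * t1) := by rw [hW]; unfold Cw; field_simp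
            rw [this]
            have := rpow_le_rpow_of_nonpos hm (S.lo k s hsI) (by linarith [S.hp] : 1 - p ≤ 0)
            have := hs.1.le
            have : 0 ≤ m ^ (1 - p) := rpow_nonneg hm.le _
            gcongr
          have h4 := mul_le_mul_of_nonneg_left (h3.trans (le_refl _)) hh.le
          have h5 : -(h * (ν * W)) ≤ h * sL ν h u k s := by
            have := mul_le_mul_of_nonneg_left (by linarith : -(ν * W) ≤ sL ν h u k s) hh.le
            linarith
          have h6 : 0 ≤ ν * (u k s - u (k+1) s) := mul_nonneg hν0.le (by linarith)
          linarith)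
        (by unfold Csc at hC; exact hC)
        (by rw [hε]; field_simp; linarith)
      have hdφ : HasDerivAt (phL u (k+1)) (I * (zL p ν h N u (k+1) s - zL p ν h N u k s)) s := by
        have := ((S.der (k+1) hsI).sub (S.der k hsI)).const_mul I
        exact this
      have hdθ : HasDerivAt (fun s => (s - t1) / 2) (1 / 2) s :=
        ((hasDerivAt_id s).sub_const t1).div_const 2
      refine ⟨_, ?_, (hdφ.add (hdθ.mul (S.derz hiN hsI))).sub_const ε⟩
      refine lt_of_le_of_lt (le_of_eq ?_) halg
      have hid := ph_identity ν h hh.ne' u k s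
      rw [← hI] at hid
      have hLψ : Lq ν h ψ (k+1) = Lq ν h (fun j => phL u j s) (k+1) + (s - t1) / 2 * Lq ν h (fun j => zL p ν h N u j s) (k+1) := by
        simp only [hψ, Lq]; ring
      have hid2 : Lq ν h (fun j => phL u j s) (k+1) = I * (sL ν h u (k + 1) s - sL ν h u k s) + sL ν h u (k + 1) s := by linarith
      rw [hLψ, hid2, zL_eq hiN, zL_eq hkN]
      ring)
    t ht i (Finset.mem_range.2 (by omega))
  simp only [phL] at key
  linarith

end LSol

lemma Lq_le {ν h : ℝ} (hν : 0 ≤ ν) (hh : 0 < h) {v w : ℕ → ℝ} {i : ℕ}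
    (h1 : v (i + 1) - v i ≤ w (i + 1) - w i) (h2 : v (i - 1) - v i ≤ w (i - 1) - w i) :
    Lq ν h v i ≤ Lq ν h w i := by
  unfold Lq
  apply div_le_div_of_nonneg_right _ hh.le
  have hi : (0:ℝ) ≤ i := Nat.cast_nonneg i
  exact add_le_add (mul_le_mul_of_nonneg_left h1 (by positivity)) (mul_le_mul_of_nonneg_left h2 (by positivity))

lemma Lq_sq {ν h : ℝ} (hh : 0 < h) (c : ℝ) (i : ℕ) :
    Lq ν h (fun l => (h * (l:ℝ) - c) ^ 2) i = 2 * ν * (h * i - c) + 8 * (h * i) + ν * h := by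
  unfold Lq
  rcases i with _ | k
  · simp; field_simp; ring
  · simp only [Nat.add_sub_cancel]
    push_cast
    field_simp
    ring

lemma Lq_smul_add {ν h : ℝ} (v w : ℕ → ℝ) (A B : ℝ) (i : ℕ) :
    Lq ν h (fun l => A * v l + B * w l) i = A * Lq ν h v i + B * Lq ν h w i := by
  unfold Lq; ring

lemma Lq_neg {ν h : ℝ} (v : ℕ → ℝ) (i : ℕ) :
    Lq ν h (fun l => -v l) i = - Lq ν h v i := by
  unfold Lq; ring

lemma sqrt_d2 {k : ℝ} (hk : 1 ≤ k) : √(k+1) + √(k-1) - 2 * √k ≤ -1 / (4 * k * √k) := by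
  set x := √k with hx
  have hx1 : 1 ≤ x := by rw [hx]; exact Real.one_le_sqrt.2 hk
  have hx0 : 0 < x := by linarith
  have hkx : k = x ^ 2 := by rw [hx, sq_sqrt (by linarith)]
  rw [hkx]
  set a := √(x^2+1) with ha
  set b := √(x^2-1) with hb
  have ha2 : a ^ 2 = x ^ 2 + 1 := by rw [ha, sq_sqrt (by positivity)]
  have hb2 : b ^ 2 = x ^ 2 - 1 := by rw [hb, sq_sqrt (by nlinarith)]
  have ha0 : 0 ≤ a := sqrt_nonneg _
  have hb0 : 0 ≤ b := sqrt_nonneg _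
  have hy : (1:ℝ) / (4 * x ^ 3) ≤ x := by
    rw [div_le_iff₀ (by positivity)]
    have : 1 ≤ x ^ 4 := one_le_pow₀ hx1
    nlinarith
  have hab : a * b ≤ x ^ 2 - 1 / (2 * x ^ 2) := by
    apply abs_le_of_sq_le_sq' _ _ |>.2
    · rw [mul_pow, ha2, hb2]
      have : (x ^ 2 - 1 / (2 * x ^ 2)) ^ 2 = x ^ 4 - 1 + (1 / (2 * x ^ 2)) ^ 2 := by
        field_simp; ring
      rw [this]
      nlinarith [sq_nonneg (1 / (2 * x ^ 2))]
    · have : 1 / (2 * x ^ 2) ≤ x ^ 2 := by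
        rw [div_le_iff₀ (by positivity)]
        have : 1 ≤ x ^ 4 := one_le_pow₀ hx1
        nlinarith
      linarith
  have hsum : a + b ≤ 2 * x - 1 / (4 * x ^ 3) := by
    apply abs_le_of_sq_le_sq' _ _ |>.2
    · have e1 : (a + b) ^ 2 = 2 * x ^ 2 + 2 * (a * b) := by nlinarith
      have e2 : (2 * x - 1 / (4 * x ^ 3)) ^ 2 = 4 * x ^ 2 - 1 / x ^ 2 + (1 / (4 * x ^ 3)) ^ 2 := by
        field_simp; ring
      rw [e1, e2]
      have e3 : 1 / x ^ 2 = 2 * (1 / (2 * x ^ 2)) := by field_simp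
      nlinarith [sq_nonneg (1 / (4 * x ^ 3))]
    · linarith
  have e4 : -1 / (4 * x ^ 2 * x) = - (1 / (4 * x ^ 3)) := by field_simp
  rw [e4]
  linarith

lemma sqrt_pair {ν h a0 ai aj Ξ : ℝ} (hν : 0 ≤ ν) (hh : 0 < h) (ha0 : 0 < a0) (hai : a0 ≤ ai) (haj : ai ≤ aj)
    {i j : ℕ} (hij : j < i) (hΞ : h * ((i:ℝ) - j) ≤ Ξ) :
    ai * Lq ν h (fun l => √(h * |(l:ℝ) - j|)) i + aj * Lq ν h (fun l => √(h * |(l:ℝ) - i|)) j ≤ - (a0 / √Ξ) := by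
  obtain ⟨k, rfl⟩ : ∃ k, i = j + (k + 1) := ⟨i - j - 1, by omega⟩
  set κ : ℝ := (k:ℝ) + 1 with hκ
  have hκ1 : 1 ≤ κ := by rw [hκ]; have : (0:ℝ) ≤ k := Nat.cast_nonneg k; linarith
  have hj0 : (0:ℝ) ≤ j := Nat.cast_nonneg j
  have hκ0 : 0 < κ := by linarith
  set D := √(κ+1) + √(κ-1) - 2 * √κ with hD
  have hD2 : D ≤ -1 / (4 * κ * √κ) := sqrt_d2 hκ1
  have hsκ : 0 < √κ := sqrt_pos.2 hκ0
  have hsh : 0 < √h := sqrt_pos.2 hh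
  have e1 : Lq ν h (fun l => √(h * |(l:ℝ) - j|)) (j + (k+1)) = √h * (4 * (j + κ) * D + ν * (√(κ+1) - √κ)) / h := by
    unfold Lq
    have a1 : |((j + (k+1) + 1 : ℕ):ℝ) - j| = κ + 1 := by
      push_cast; rw [abs_of_nonneg] <;> [ (rw [hκ]; ring) ; (ring_nf; positivity)]
    have a2 : |((j + (k+1) : ℕ):ℝ) - j| = κ := by
      push_cast; rw [abs_of_nonneg] <;> [ (rw [hκ]; ring) ; (ring_nf; positivity)]
    have a3 : |((j + (k+1) - 1 : ℕ):ℝ) - j| = κ - 1 := by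
      rw [show j + (k+1) - 1 = j + k by omega]
      push_cast; rw [abs_of_nonneg] <;> [ (rw [hκ]; ring) ; (ring_nf; positivity)]
    simp only [a1, a2, a3]
    rw [sqrt_mul hh.le, sqrt_mul hh.le, sqrt_mul hh.le, hD]
    push_cast
    rw [hκ]
    ring
  have e2 : Lq ν h (fun l => √(h * |(l:ℝ) - (j + (k+1) : ℕ)|)) j = √h * (4 * j * D - ν * (√κ - √(κ-1))) / h := by
    unfold Lq
    have a1 : |((j + 1 : ℕ):ℝ) - (j + (k+1) : ℕ)| = κ - 1 := by
      push_cast; rw [abs_of_nonpos] <;> [ (rw [hκ]; ring) ; (ring_nf; simp)]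
    have a2 : |(j:ℝ) - (j + (k+1) : ℕ)| = κ := by
      push_cast; rw [abs_of_nonpos] <;> [ (rw [hκ]; ring) ; (linarith)]
    simp only [a1, a2]
    rcases j with _ | j
    · simp only [Nat.cast_zero]
      rw [sqrt_mul hh.le, sqrt_mul hh.le]
      ring
    · have a3 : |((j + 1 - 1 : ℕ):ℝ) - (j + 1 + (k+1) : ℕ)| = κ + 1 := by
        rw [Nat.add_sub_cancel]
        push_cast; rw [abs_of_nonpos] <;> [ (rw [hκ]; ring) ; linarith]
      simp only [a3]
      rw [sqrt_mul hh.le, sqrt_mul hh.le, sqrt_mul hh.le, hD]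
      ring
  rw [e1, e2]
  have hDneg : D ≤ 0 := hD2.trans (div_nonpos_of_nonpos_of_nonneg (by norm_num) (by positivity))
  have hinc : 0 ≤ √(κ+1) - √κ := sub_nonneg.2 (sqrt_le_sqrt (by linarith))
  have hconc : √(κ+1) - √κ ≤ √κ - √(κ-1) := by rw [hD] at hDneg; linarith
  have h1 : ai * (ν * (√(κ+1) - √κ)) ≤ aj * (ν * (√κ - √(κ-1))) := by
    apply mul_le_mul haj (mul_le_mul_of_nonneg_left hconc hν) (by positivity) (by linarith)
  have h2 : ai * (4 * (j + κ) * D) ≤ -(a0 / √κ) := by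
    have : ai * (4 * (j + κ)) ≥ a0 * (4 * κ) := by
      apply mul_le_mul hai (by linarith) (by positivity) (by linarith)
    calc ai * (4 * (j + κ) * D) = ai * (4 * (j + κ)) * D := by ring
      _ ≤ a0 * (4 * κ) * D := mul_le_mul_of_nonpos_right this hDneg
      _ ≤ a0 * (4 * κ) * (-1 / (4 * κ * √κ)) := mul_le_mul_of_nonneg_left hD2 (by positivity)
      _ = _ := by field_simp
  have h3 : aj * (4 * j * D) ≤ 0 := by
    apply mul_nonpos_of_nonneg_of_nonpos (by linarith)
    exact mul_nonpos_of_nonneg_of_nonpos (by positivity) hDneg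
  have h4 : ai * (√h * (4 * (j + κ) * D + ν * (√(κ+1) - √κ)) / h) + aj * (√h * (4 * j * D - ν * (√κ - √(κ-1))) / h)
     = √h / h * (ai * (4 * (j + κ) * D) + aj * (4 * j * D) + (ai * (ν * (√(κ+1) - √κ)) - aj * (ν * (√κ - √(κ-1))))) := by ring
  rw [h4]
  have h5 : √h / h * (ai * (4 * (j + κ) * D) + aj * (4 * j * D) + (ai * (ν * (√(κ+1) - √κ)) - aj * (ν * (√κ - √(κ-1)))))
     ≤ √h / h * (-(a0 / √κ)) := by
    apply mul_le_mul_of_nonneg_left _ (by positivity)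
    linarith
  refine h5.trans ?_
  have h6 : √h / h * (-(a0 / √κ)) = -(a0 / √(h * κ)) := by
    rw [sqrt_mul hh.le, sqrt_div_self']
    field_simp
  rw [h6, neg_le_neg_iff]
  have h7 : h * κ ≤ Ξ := by
    refine le_trans (le_of_eq ?_) hΞ
    push_cast; rw [hκ]; ring
  have : 0 < √(h * κ) := sqrt_pos.2 (by positivity)
  have := sqrt_le_sqrt h7
  gcongr

set_option maxHeartbeats 2000000 in
lemma doubling_one {ν h t0 tb a0 Ab Cg C0 Λ K K' Ξ : ℝ} {I1 i0 : ℕ} {y a g : ℕ → ℝ → ℝ} (hν : 0 ≤ ν) (hh : 0 < h)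
    (ht : t0 < tb) (ha0 : 0 < a0) (hC0 : 0 < C0) (hΞ : Ξ = h * I1) (hΞ0 : 0 < Ξ) (hΛ0 : 0 < Λ)
    (hcont : ∀ i ≤ I1, ContinuousOn (y i) (Icc t0 tb))
    (hder : ∀ i < I1, ∀ t ∈ Icc t0 tb, HasDerivAt (y i) (a i t * Lq ν h (fun j => y j t) i + g i t) t)
    (ha : ∀ i ≤ I1, ∀ j ≤ i, ∀ t ∈ Icc t0 tb, a i t ≤ a j t)
    (hal : ∀ i ≤ I1, ∀ t ∈ Icc t0 tb, a0 ≤ a i t) (hau : ∀ i ≤ I1, ∀ t ∈ Icc t0 tb, a i t ≤ Ab)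
    (hg : ∀ i ≤ I1, ∀ t ∈ Icc t0 tb, |g i t| ≤ Cg)
    (hy : ∀ i ≤ I1, ∀ t ∈ Icc t0 tb, |y i t| ≤ C0)
    (hi0 : h * i0 ≤ Ξ / 2) (hK : K = 32 * C0 / Ξ ^ 2) (hK' : K' = 2 * C0 / (tb - t0))
    (hΛ1 : 2 * C0 ≤ Λ * √(Ξ / 4))
    (hΛ2 : Ab * K * ((2 * ν + 8) * Ξ + ν * h) + K' + 2 * Cg < Λ * (a0 / √Ξ))
    {j0 : ℕ} (hj0 : j0 ≤ I1) : y i0 tb - y j0 tb ≤ Λ * √(h * |(i0:ℝ) - j0|) := by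
  have hK0 : 0 < K := by rw [hK]; positivity
  have htb : 0 < tb - t0 := by linarith
  have hK'0 : 0 < K' := by rw [hK']; positivity
  have hi0I : i0 ≤ I1 := by
    have : h * (i0:ℝ) ≤ h * I1 := by linarith
    exact_mod_cast le_of_mul_le_mul_left this hh
  refine le_of_forall_pos_le_add ?_
  intro ε hε
  let B : ℕ × ℕ → ℝ := fun q => Λ * √(h * |(q.1:ℝ) - q.2|) + K * (h * (q.1:ℝ) - h * i0) ^ 2
  have key := MP (Finset.range (I1+1) ×ˢ Finset.range (I1+1))
    (fun q s => (y q.1 s - y q.2 s) - B q - K' * (tb - s) - ε) t0 tb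
    (fun q hq => by
      rw [Finset.mem_product, Finset.mem_range, Finset.mem_range] at hq
      have h1 := hcont q.1 (by omega)
      have h2 := hcont q.2 (by omega)
      fun_prop)
    (fun q hq => by
      rw [Finset.mem_product, Finset.mem_range, Finset.mem_range] at hq
      have h1 := abs_le.1 (hy q.1 (by omega) t0 ⟨le_rfl, ht.le⟩)
      have h2 := abs_le.1 (hy q.2 (by omega) t0 ⟨le_rfl, ht.le⟩)
      have h3 : K' * (tb - t0) = 2 * C0 := by rw [hK']; field_simp
      have h4 : 0 ≤ B q := by simp only [B]; positivity
      rw [h3]; linarith [h1.2, h2.1])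
    (fun s hs q hq hQ hall => by
      obtain ⟨i, j⟩ := q
      rw [Finset.mem_product, Finset.mem_range, Finset.mem_range] at hq
      simp only at hq hQ ⊢
      have hsI : s ∈ Icc t0 tb := ⟨hs.1.le, hs.2⟩
      have hKs : 0 ≤ K' * (tb - s) := mul_nonneg hK'0.le (by linarith [hs.2])
      have hyi := abs_le.1 (hy i (by omega) s hsI)
      have hyj := abs_le.1 (hy j (by omega) s hsI)
      have hB : B (i, j) < 2 * C0 := by linarith [hyi.2, hyj.1]
      have hpart1 : 0 ≤ Λ * √(h * |(i:ℝ) - j|) := by positivity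
      have hpart2 : 0 ≤ K * (h * (i:ℝ) - h * i0) ^ 2 := by positivity
      have hij : i ≠ j := by
        rintro rfl
        have : 0 ≤ B (i, i) := by simp only [B]; positivity
        linarith
      have hb1 : h * |(i:ℝ) - j| < Ξ / 4 := by
        have : Λ * √(h * |(i:ℝ) - j|) < Λ * √(Ξ / 4) := by
          simp only [B] at hB; linarith
        have := lt_of_mul_lt_mul_left this hΛ0.le
        exact lt_of_not_ge fun hc => absurd (sqrt_le_sqrt hc) (not_le.2 this)
      have hb2 : |h * (i:ℝ) - h * i0| < Ξ / 4 := by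
        have h1 : K * (h * (i:ℝ) - h * i0) ^ 2 < 2 * C0 := by
          simp only [B] at hB; linarith
        have h2 : K * (Ξ / 4) ^ 2 = 2 * C0 := by rw [hK]; field_simp; ring
        rw [← h2] at h1
        exact abs_lt_of_sq_lt_sq (lt_of_mul_lt_mul_left h1 hK0.le) (by positivity)
      have hiΞ : h * (i:ℝ) < 3 / 4 * Ξ := by linarith [(abs_lt.1 hb2).2]
      have hjΞ : h * (j:ℝ) < Ξ := by
        have := mul_le_mul_of_nonneg_left (neg_le_abs ((i:ℝ) - j)) hh.le
        linarith
      have hiI : i < I1 := by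
        have : h * (i:ℝ) < h * I1 := by linarith
        exact_mod_cast lt_of_mul_lt_mul_left this hh.le
      have hjI : j < I1 := by
        have : h * (j:ℝ) < h * I1 := by linarith
        exact_mod_cast lt_of_mul_lt_mul_left this hh.le
      have hcmp : ∀ i' ≤ I1, ∀ j' ≤ I1, y i' s - y j' s - B (i', j') ≤ y i s - y j s - B (i, j) := by
        intro i' hi' j' hj'
        have := hall (i', j') (by rw [Finset.mem_product, Finset.mem_range, Finset.mem_range]; simp only; omega)
        simp only at this
        linarith
      have hLi : Lq ν h (fun l => y l s) i ≤ Lq ν h (fun l => B (l, j)) i := by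
        apply Lq_le hν hh
        · linarith [hcmp (i+1) (by omega) j (by omega)]
        · linarith [hcmp (i-1) (by omega) j (by omega)]
      have hLj : - Lq ν h (fun l => y l s) j ≤ Λ * Lq ν h (fun l => √(h * |(l:ℝ) - i|)) j := by
        have h1 : - Lq ν h (fun l => y l s) j ≤ Lq ν h (fun l => B (i, l)) j := by
          rw [← Lq_neg]
          apply Lq_le hν hh
          · linarith [hcmp i (by omega) (j+1) (by omega)]
          · linarith [hcmp i (by omega) (j-1) (by omega)]
        refine h1.trans (le_of_eq ?_)
        simp only [B, Lq]
        rw [abs_sub_comm (i:ℝ) ((j+1 : ℕ):ℝ), abs_sub_comm (i:ℝ) (j:ℝ), abs_sub_comm (i:ℝ) ((j-1 : ℕ):ℝ)]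
        ring
      have hLi2 : Lq ν h (fun l => B (l, j)) i = Λ * Lq ν h (fun l => √(h * |(l:ℝ) - j|)) i
          + K * (2 * ν * (h * i - h * i0) + 8 * (h * i) + ν * h) := by
        rw [← Lq_sq hh, ← Lq_smul_add]
      have hai := hal i (by omega) s hsI
      have haj := hal j (by omega) s hsI
      have hpair : a i s * Lq ν h (fun l => √(h * |(l:ℝ) - j|)) i + a j s * Lq ν h (fun l => √(h * |(l:ℝ) - i|)) j
          ≤ -(a0 / √Ξ) := by
        rcases lt_or_gt_of_ne hij with hlt | hlt
        · rw [add_comm]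
          apply sqrt_pair hν hh ha0 haj (ha j (by omega) i (by omega) s hsI) hlt
          have := mul_le_mul_of_nonneg_left (neg_le_abs ((i:ℝ) - j)) hh.le
          linarith
        · apply sqrt_pair hν hh ha0 hai (ha i (by omega) j (by omega) s hsI) hlt
          have := mul_le_mul_of_nonneg_left (le_abs_self ((i:ℝ) - j)) hh.le
          linarith
      refine ⟨_, ?_, ((((hder i hiI s hsI).sub (hder j hjI s hsI)).sub_const (B (i, j))).sub
        (((hasDerivAt_id s).const_sub tb).const_mul K')).sub_const ε⟩
      have hgi := abs_le.1 (hg i (by omega) s hsI)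
      have hgj := abs_le.1 (hg j (by omega) s hsI)
      have h1 : a i s * Lq ν h (fun l => y l s) i ≤ a i s * (Λ * Lq ν h (fun l => √(h * |(l:ℝ) - j|)) i)
          + a i s * (K * (2 * ν * (h * i - h * i0) + 8 * (h * i) + ν * h)) := by
        rw [← mul_add, ← hLi2]
        exact mul_le_mul_of_nonneg_left hLi (by linarith)
      have h2 : a j s * (- Lq ν h (fun l => y l s) j) ≤ a j s * (Λ * Lq ν h (fun l => √(h * |(l:ℝ) - i|)) j) :=
        mul_le_mul_of_nonneg_left hLj (by linarith)
      have h3 : a i s * (K * (2 * ν * (h * i - h * i0) + 8 * (h * i) + ν * h)) ≤ Ab * K * ((2 * ν + 8) * Ξ + ν * h) := by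
        have hi0n : 0 ≤ h * (i0:ℝ) := by positivity
        have e1 : 2 * ν * (h * i - h * i0) + 8 * (h * i) + ν * h ≤ (2 * ν + 8) * Ξ + ν * h := by
          have := mul_le_mul_of_nonneg_left (by linarith : h * (i:ℝ) - h * i0 ≤ Ξ) (by positivity : 0 ≤ 2 * ν)
          linarith
        have e2 : 0 ≤ (2 * ν + 8) * Ξ + ν * h := by positivity
        calc _ ≤ a i s * (K * ((2 * ν + 8) * Ξ + ν * h)) :=
              mul_le_mul_of_nonneg_left (mul_le_mul_of_nonneg_left e1 hK0.le) (by linarith)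
          _ ≤ Ab * (K * ((2 * ν + 8) * Ξ + ν * h)) :=
              mul_le_mul_of_nonneg_right (hau i (by omega) s hsI) (by positivity)
          _ = _ := by ring
      have h4 := mul_le_mul_of_nonneg_left hpair hΛ0.le
      have h5 : Λ * (a i s * Lq ν h (fun l => √(h * |(l:ℝ) - j|)) i + a j s * Lq ν h (fun l => √(h * |(l:ℝ) - i|)) j)
         = a i s * (Λ * Lq ν h (fun l => √(h * |(l:ℝ) - j|)) i) + a j s * (Λ * Lq ν h (fun l => √(h * |(l:ℝ) - i|)) j) := by ring
      rw [h5] at h4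
      linarith [hgi.2, hgj.1])
    tb ⟨ht.le, le_rfl⟩ (i0, j0) (by rw [Finset.mem_product, Finset.mem_range, Finset.mem_range]; simp only; omega)
  have hB0 : B (i0, j0) = Λ * √(h * |(i0:ℝ) - j0|) := by simp only [B]; ring
  simp only [hB0, sub_self, mul_zero] at key
  linarith

lemma doubling {ν h t0 tb a0 Ab Cg C0 Λ K K' Ξ : ℝ} {I1 i0 : ℕ} {y a g : ℕ → ℝ → ℝ} (hν : 0 ≤ ν) (hh : 0 < h)
    (ht : t0 < tb) (ha0 : 0 < a0) (hC0 : 0 < C0) (hΞ : Ξ = h * I1) (hΞ0 : 0 < Ξ) (hΛ0 : 0 < Λ)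
    (hcont : ∀ i ≤ I1, ContinuousOn (y i) (Icc t0 tb))
    (hder : ∀ i < I1, ∀ t ∈ Icc t0 tb, HasDerivAt (y i) (a i t * Lq ν h (fun j => y j t) i + g i t) t)
    (ha : ∀ i ≤ I1, ∀ j ≤ i, ∀ t ∈ Icc t0 tb, a i t ≤ a j t)
    (hal : ∀ i ≤ I1, ∀ t ∈ Icc t0 tb, a0 ≤ a i t) (hau : ∀ i ≤ I1, ∀ t ∈ Icc t0 tb, a i t ≤ Ab)
    (hg : ∀ i ≤ I1, ∀ t ∈ Icc t0 tb, |g i t| ≤ Cg)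
    (hy : ∀ i ≤ I1, ∀ t ∈ Icc t0 tb, |y i t| ≤ C0)
    (hi0 : h * i0 ≤ Ξ / 2) (hK : K = 32 * C0 / Ξ ^ 2) (hK' : K' = 2 * C0 / (tb - t0))
    (hΛ1 : 2 * C0 ≤ Λ * √(Ξ / 4))
    (hΛ2 : Ab * K * ((2 * ν + 8) * Ξ + ν * h) + K' + 2 * Cg < Λ * (a0 / √Ξ))
    {j0 : ℕ} (hj0 : j0 ≤ I1) : |y i0 tb - y j0 tb| ≤ Λ * √(h * |(i0:ℝ) - j0|) := by
  rw [abs_le']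
  constructor
  · exact doubling_one hν hh ht ha0 hC0 hΞ hΞ0 hΛ0 hcont hder ha hal hau hg hy hi0 hK hK' hΛ1 hΛ2 hj0
  · have := doubling_one (y := fun i t => - y i t) (a := a) (g := fun i t => - g i t) hν hh ht ha0 hC0 hΞ hΞ0 hΛ0
      (fun i hi => (hcont i hi).neg)
      (fun i hi t ht => by
        have h1 := (hder i hi t ht).neg
        refine h1.congr_deriv ?_
        rw [Lq_neg]; ring) ha hal hau
      (fun i hi t ht => by rw [abs_neg]; exact hg i hi t ht)
      (fun i hi t ht => by rw [abs_neg]; exact hy i hi t ht) hi0 hK hK' hΛ1 hΛ2 hj0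
    linarith

lemma timemod_one {ν h t0 tb Ab Cg C0 C ε : ℝ} {I1 i0 : ℕ} {y a g : ℕ → ℝ → ℝ} (hν : 0 ≤ ν) (hh : 0 < h)
    (hcont : ∀ i ≤ I1, ContinuousOn (y i) (Icc t0 tb))
    (hder : ∀ i < I1, ∀ t ∈ Icc t0 tb, HasDerivAt (y i) (a i t * Lq ν h (fun j => y j t) i + g i t) t)
    (hal : ∀ i ≤ I1, ∀ t ∈ Icc t0 tb, 0 ≤ a i t) (hau : ∀ i ≤ I1, ∀ t ∈ Icc t0 tb, a i t ≤ Ab)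
    (hg : ∀ i ≤ I1, ∀ t ∈ Icc t0 tb, |g i t| ≤ Cg)
    (hy : ∀ i ≤ I1, ∀ t ∈ Icc t0 tb, |y i t| ≤ C0) (hC : 0 ≤ C) (hε : 0 ≤ ε) (hAb : 0 ≤ Ab) (hCg : 0 ≤ Cg)
    (hi0 : i0 ≤ I1) (hinit : ∀ i ≤ I1, |y i t0 - y i0 t0| ≤ ε + C * (h * i - h * i0) ^ 2)
    (hbig : 2 * C0 ≤ C * (h * I1 - h * i0) ^ 2) {t : ℝ} (ht : t ∈ Icc t0 tb) :
    y i0 t - y i0 t0 ≤ ε + (Ab * C * ((2 * ν + 8) * (h * I1) + ν * h) + Cg) * (t - t0) := by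
  set K := Ab * C * ((2 * ν + 8) * (h * I1) + ν * h) + Cg with hK
  have hK0 : 0 ≤ K := by positivity
  have ht01 : t0 ∈ Icc t0 tb := ⟨le_rfl, ht.1.trans ht.2⟩
  suffices H : ∀ e > 0, y i0 t - y i0 t0 ≤ ε + K * (t - t0) + e * (1 + (t - t0)) by
    refine le_of_forall_pos_le_add ?_
    intro e he
    have h1 : 0 < 1 + (t - t0) := by linarith [ht.1]
    have := H (e / (1 + (t - t0))) (by positivity)
    rwa [div_mul_cancel₀ _ h1.ne'] at this
  intro e he
  have key := MP (Finset.range (I1+1))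
    (fun i s => y i s - y i0 t0 - ε - C * (h * i - h * i0) ^ 2 - K * (s - t0) - e * (1 + (s - t0))) t0 tb
    (fun i hi => by
      rw [Finset.mem_range] at hi
      have h1 := hcont i (by omega)
      fun_prop)
    (fun i hi => by
      rw [Finset.mem_range] at hi
      have h1 := (abs_le.1 (hinit i (by omega))).2
      simp only [sub_self, mul_zero, add_zero]; linarith)
    (fun s hs i hi hQ hall => by
      rw [Finset.mem_range] at hi
      have hsI : s ∈ Icc t0 tb := ⟨hs.1.le, hs.2⟩
      have hKs : 0 ≤ K * (s - t0) := mul_nonneg hK0 (by linarith [hs.1])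
      have hes : 0 < e * (1 + (s - t0)) := mul_pos he (by linarith [hs.1])
      have hiI : i < I1 := by
        rcases Nat.lt_or_ge i I1 with h | h
        · exact h
        · exfalso
          have : i = I1 := by omega
          rw [this] at hQ
          have h1 := abs_le.1 (hy I1 le_rfl s hsI)
          have h2 := abs_le.1 (hy i0 hi0 t0 ht01)
          linarith [h1.2, h2.1]
      have hcmp : ∀ j ≤ I1, y j s - C * (h * j - h * i0) ^ 2 ≤ y i s - C * (h * i - h * i0) ^ 2 := by
        intro j hj
        have := hall j (Finset.mem_range.2 (by omega))
        linarith
      have hLi : Lq ν h (fun l => y l s) i ≤ C * (2 * ν * (h * i - h * i0) + 8 * (h * i) + ν * h) := by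
        rw [← Lq_sq hh]
        have : C * Lq ν h (fun l => (h * (l:ℝ) - h * i0) ^ 2) i = Lq ν h (fun l => C * (h * (l:ℝ) - h * i0) ^ 2) i := by
          unfold Lq; ring
        rw [this]
        apply Lq_le hν hh
        · linarith [hcmp (i+1) (by omega)]
        · linarith [hcmp (i-1) (by omega)]
      refine ⟨_, ?_, (((((hder i hiI s hsI).sub_const (y i0 t0)).sub_const ε).sub_const
        (C * (h * i - h * i0) ^ 2)).sub (((hasDerivAt_id s).sub_const t0).const_mul K)).sub
        ((((hasDerivAt_id s).sub_const t0).const_add 1).const_mul e)⟩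
      have hgi := (abs_le.1 (hg i (by omega) s hsI)).2
      have hai := hal i (by omega) s hsI
      have hiΞ : h * (i:ℝ) ≤ h * I1 := by
        have : (i:ℝ) ≤ I1 := by exact_mod_cast hiI.le
        exact mul_le_mul_of_nonneg_left this hh.le
      have hi0n : 0 ≤ h * (i0:ℝ) := by positivity
      have e1 : 2 * ν * (h * i - h * i0) + 8 * (h * i) + ν * h ≤ (2 * ν + 8) * (h * I1) + ν * h := by
        have := mul_le_mul_of_nonneg_left (by linarith : h * (i:ℝ) - h * i0 ≤ h * I1) (by positivity : 0 ≤ 2 * ν)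
        linarith
      have h3 : a i s * Lq ν h (fun l => y l s) i ≤ Ab * C * ((2 * ν + 8) * (h * I1) + ν * h) := by
        calc _ ≤ a i s * (C * ((2 * ν + 8) * (h * I1) + ν * h)) :=
              mul_le_mul_of_nonneg_left (hLi.trans (mul_le_mul_of_nonneg_left e1 hC)) hai
          _ ≤ Ab * (C * ((2 * ν + 8) * (h * I1) + ν * h)) :=
              mul_le_mul_of_nonneg_right (hau i (by omega) s hsI) (by positivity)
          _ = _ := by ring
      simp only [mul_one]
      rw [hK]
      linarith)
    t ht i0 (Finset.mem_range.2 (by omega))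
  simp only [sub_self] at key
  norm_num at key
  linarith

lemma timemod {ν h t0 tb Ab Cg C0 C ε : ℝ} {I1 i0 : ℕ} {y a g : ℕ → ℝ → ℝ} (hν : 0 ≤ ν) (hh : 0 < h)
    (hcont : ∀ i ≤ I1, ContinuousOn (y i) (Icc t0 tb))
    (hder : ∀ i < I1, ∀ t ∈ Icc t0 tb, HasDerivAt (y i) (a i t * Lq ν h (fun j => y j t) i + g i t) t)
    (hal : ∀ i ≤ I1, ∀ t ∈ Icc t0 tb, 0 ≤ a i t) (hau : ∀ i ≤ I1, ∀ t ∈ Icc t0 tb, a i t ≤ Ab)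
    (hg : ∀ i ≤ I1, ∀ t ∈ Icc t0 tb, |g i t| ≤ Cg)
    (hy : ∀ i ≤ I1, ∀ t ∈ Icc t0 tb, |y i t| ≤ C0) (hC : 0 ≤ C) (hε : 0 ≤ ε) (hAb : 0 ≤ Ab) (hCg : 0 ≤ Cg)
    (hi0 : i0 ≤ I1) (hinit : ∀ i ≤ I1, |y i t0 - y i0 t0| ≤ ε + C * (h * i - h * i0) ^ 2)
    (hbig : 2 * C0 ≤ C * (h * I1 - h * i0) ^ 2) {t : ℝ} (ht : t ∈ Icc t0 tb) :
    |y i0 t - y i0 t0| ≤ ε + (Ab * C * ((2 * ν + 8) * (h * I1) + ν * h) + Cg) * (t - t0) := by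
  rw [abs_le']
  constructor
  · exact timemod_one hν hh hcont hder hal hau hg hy hC hε hAb hCg hi0 hinit hbig ht
  · have := timemod_one (y := fun i t => - y i t) (a := a) (g := fun i t => - g i t) (C0 := C0) (i0 := i0) hν hh
      (fun i hi => (hcont i hi).neg)
      (fun i hi t ht => by
        have h1 := (hder i hi t ht).neg
        refine h1.congr_deriv ?_
        rw [Lq_neg]; ring) hal hau
      (fun i hi t ht => by rw [abs_neg]; exact hg i hi t ht)
      (fun i hi t ht => by rw [abs_neg]; exact hy i hi t ht) hC hε hAb hCg hi0
      (fun i hi => by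
        have := hinit i hi
        rw [← abs_neg] at this
        convert this using 2; ring) hbig ht
    linarith

namespace LSol
variable {p ν h T m M : ℝ} {N : ℕ} {u : ℕ → ℝ → ℝ}

/-- local positivity -/
lemma locpos (S : LSol p ν h T m M N u) {μ Ξ : ℝ} (hμ : 0 < μ) (hΞ : 0 < Ξ) (hΞN : Ξ ≤ N * h)
    (hinit : ∀ i : ℕ, i * h ≤ Ξ → μ < u i 0) {t : ℝ} (ht : t ∈ Icc 0 T) {i : ℕ} :
    μ / Ξ * exp (-((ν * μ ^ p / Ξ + 1) * t)) * (Ξ - i * h) ≤ u i t := by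
  have hν0 : 0 < ν := by linarith [S.hν]
  have hh := S.hh
  set K := ν * μ ^ p / Ξ + 1 with hK
  have hK0 : 0 < K := by positivity
  by_cases hi : N ≤ i
  · have : Ξ ≤ i * h := by
      have : (N:ℝ) ≤ i := by exact_mod_cast hi
      exact hΞN.trans (mul_le_mul_of_nonneg_right this hh.le)
    refine le_trans ?_ (S.pos ht).le
    exact mul_nonpos_of_nonneg_of_nonpos (by positivity) (by linarith)
  have key := MP (Finset.range (N+1)) (fun i s => μ / Ξ * exp (-(K * s)) * (Ξ - i * h) - u i s) 0 T
    (fun i hi => by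
      have := S.cont i
      fun_prop)
    (fun i hi => by
      simp only [mul_zero, neg_zero, exp_zero, mul_one]
      by_cases hc : (i:ℝ) * h ≤ Ξ
      · have h1 := hinit i hc
        have : μ / Ξ * (Ξ - i * h) ≤ μ := by
          rw [div_mul_eq_mul_div, div_le_iff₀ hΞ]
          have : 0 ≤ (i:ℝ) * h := by positivity
          nlinarith
        linarith
      · push Not at hc
        have h1 := S.pos (i := i) (t := 0) ⟨le_rfl, S.hT.le⟩
        have : μ / Ξ * (Ξ - i * h) ≤ 0 := mul_nonpos_of_nonneg_of_nonpos (by positivity) (by linarith)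
        linarith)
    (fun s hs i hi hQ hall => by
      rw [Finset.mem_range] at hi
      have hsI : s ∈ Icc 0 T := ⟨hs.1.le, hs.2⟩
      have hu := S.pos (i := i) hsI
      set β := μ / Ξ * exp (-(K * s)) with hβ
      have hβ0 : 0 < β := by positivity
      have hbu : β * (Ξ - i * h) = u i s := by linarith
      have hpos : 0 < Ξ - i * h := by
        rw [← hbu] at hu; exact pos_of_mul_pos_right hu hβ0.le
      have hiN : i < N := by
        have : (i:ℝ) * h < N * h := by linarith
        exact_mod_cast lt_of_mul_lt_mul_right this hh.le
      have hcmp : ∀ j ≤ N, β * (Ξ - j * h) ≤ u j s := by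
        intro j hj
        have := hall j (Finset.mem_range.2 (by omega))
        linarith
      have hL : -(ν * β) ≤ sL ν h u i s := by
        have h1 : Lq ν h (fun j => β * (Ξ - (j:ℝ) * h)) i ≤ sL ν h u i s := by
          unfold sL
          apply Lq_le hν0.le hh
          · linarith [hcmp (i+1) (by omega)]
          · linarith [hcmp (i-1) (by omega)]
        refine le_trans (le_of_eq ?_) h1
        unfold Lq
        rcases i with _ | k
        · simp; field_simp; ring
        · simp only [Nat.add_sub_cancel]; push_cast; field_simp; ring
      refine ⟨_, ?_, (((((hasDerivAt_id s).const_mul K).neg.exp).const_mul (μ / Ξ)).mul_const (Ξ - i * h)).sub (S.der i hsI)⟩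
      have e1 : μ / Ξ * (exp (-(K * id s)) * -(K * 1)) * (Ξ - i * h) = - K * u i s := by
        rw [← hbu, hβ]; simp only [id]; ring
      change μ / Ξ * (exp (-(K * id s)) * -(K * 1)) * (Ξ - i * h) - zL p ν h N u i s < 0
      rw [e1, zL_eq hiN]
      have hup : 0 < u i s ^ p := rpow_pos_of_pos hu _
      have h2 : -(u i s ^ p * (ν * β)) ≤ u i s ^ p * sL ν h u i s := by
        have := mul_le_mul_of_nonneg_left hL hup.le
        linarith
      have hβle : β ≤ μ / Ξ := by
        rw [hβ]
        have : exp (-(K * s)) ≤ 1 := by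
          rw [exp_le_one_iff]; have := mul_pos hK0 hs.1; linarith
        exact mul_le_of_le_one_right (by positivity) this
      have hule : u i s ≤ μ := by
        rw [← hbu]
        calc β * (Ξ - i * h) ≤ μ / Ξ * (Ξ - i * h) := mul_le_mul_of_nonneg_right hβle hpos.le
          _ ≤ μ / Ξ * Ξ := mul_le_mul_of_nonneg_left (by have : 0 ≤ (i:ℝ) * h := by positivity
                                                         linarith) (by positivity)
          _ = μ := by field_simp
      have h3 : u i s ^ p * (ν * β) ≤ u i s * (ν * μ ^ p / Ξ) := by
        have e2 : u i s ^ p = u i s * u i s ^ (p-1) := by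
          rw [rpow_sub_one hu.ne']; field_simp
        have e3 : u i s ^ (p-1) ≤ μ ^ (p-1) := rpow_le_rpow hu.le hule (by linarith [S.hp])
        have e4 : μ ^ p = μ ^ (p-1) * μ := by rw [rpow_sub_one hμ.ne']; field_simp
        rw [e2, e4, mul_assoc]
        apply mul_le_mul_of_nonneg_left _ hu.le
        calc u i s ^ (p-1) * (ν * β) ≤ μ ^ (p-1) * (ν * (μ / Ξ)) := by gcongr
          _ = _ := by ring
      rw [hK]
      nlinarith)
    t ht i (Finset.mem_range.2 (by omega))
  linarith

end LSol

/-- A family of lattice approximations. -/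
structure Fam (p ν T M : ℝ) (f : ℝ → ℝ) (h : ℕ → ℝ) (N : ℕ → ℕ) (u : ℕ → ℕ → ℝ → ℝ) : Prop where
  hf : Continuous f
  fanti : Antitone f
  fpos : ∀ x, 0 < f x
  fM : ∀ x, f x ≤ M
  sol : ∀ k, LSol p ν (h k) T (f (k + 1)) M (N k) (u k)
  hNh : ∀ k, (N k : ℝ) * h k = k + 1
  init : ∀ k i, u k i 0 = f (min (i * h k) (k + 1))
  hsmall : ∀ k, h k ≤ 1 / ((k:ℝ) + 1)
  hC : ∀ k, h k * Csc p ν (f (k + 1)) M (1 / ((k:ℝ) + 1)) (N k * h k) ≤ 1 / 8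

lemma exists_Fam {p ν T M : ℝ} {f : ℝ → ℝ} (hp : 1 ≤ p) (hν : 2 ≤ ν) (hT : 0 < T) (hM : 1 ≤ M)
    (hf : Continuous f) (fanti : Antitone f) (fpos : ∀ x, 0 < f x) (fM : ∀ x, f x ≤ M) :
    ∃ h N u, Fam p ν T M f h N u := by
  have hex : ∀ k : ℕ, ∃ Nk : ℕ, 0 < Nk ∧ ((k:ℝ) + 1) / Nk ≤ 1 / ((k:ℝ) + 1) ∧
      ((k:ℝ) + 1) / Nk * Csc p ν (f (k + 1)) M (1 / ((k:ℝ) + 1)) (k + 1) ≤ 1 / 8 := by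
    intro k
    have hk : (0:ℝ) < (k:ℝ) + 1 := by positivity
    set c := Csc p ν (f (k + 1)) M (1 / ((k:ℝ) + 1)) (k + 1)
    obtain ⟨Nk, hNk⟩ := exists_nat_gt (((k:ℝ)+1)^2 + ((k:ℝ)+1) * |c| * 8)
    have h0 : 0 < ((k:ℝ)+1)^2 + ((k:ℝ)+1) * |c| * 8 := by positivity
    have hN0 : (0:ℝ) < Nk := h0.trans hNk
    refine ⟨Nk, by exact_mod_cast hN0, ?_, ?_⟩
    · rw [div_le_div_iff₀ hN0 hk]
      have : 0 ≤ ((k:ℝ)+1) * |c| * 8 := by positivity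
      nlinarith
    · rw [div_mul_eq_mul_div, div_le_iff₀ hN0]
      have := mul_le_mul_of_nonneg_left (le_abs_self c) hk.le
      nlinarith
  choose N hN0 hN1 hN2 using hex
  have hex2 : ∀ k : ℕ, ∃ u, LSol p ν (((k:ℝ) + 1) / N k) T (f (k + 1)) M (N k) u ∧
      ∀ i : ℕ, u i 0 = f (min (i * (((k:ℝ) + 1) / N k)) (k + 1)) := by
    intro k
    have hNk : (0:ℝ) < N k := by exact_mod_cast hN0 k
    have hhk : 0 < ((k:ℝ) + 1) / N k := by positivity
    apply exists_LSol p ν (((k:ℝ) + 1) / N k) T (f (k + 1)) M (N k)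
      (fun i => f (min (i * (((k:ℝ) + 1) / N k)) (k + 1))) hp hν hhk hT (fpos _) hM
    · intro i; exact fanti (min_le_right _ _)
    · intro i; exact fM _
    · intro i; apply fanti; apply min_le_min_right; push_cast; nlinarith
    · intro i hi
      have : ((k:ℝ) + 1) ≤ i * (((k:ℝ) + 1) / N k) := by
        have h1 : (N k:ℝ) ≤ i := by exact_mod_cast hi
        calc ((k:ℝ) + 1) = N k * (((k:ℝ) + 1) / N k) := by field_simp
          _ ≤ _ := mul_le_mul_of_nonneg_right h1 hhk.le
      simp only [min_eq_right this]
  choose u hu1 hu2 using hex2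
  have e : ∀ k, (N k : ℝ) * (((k:ℝ) + 1) / N k) = k + 1 := by
    intro k
    have hNk : (0:ℝ) < N k := by exact_mod_cast hN0 k
    field_simp
  refine ⟨fun k => ((k:ℝ) + 1) / N k, N, u, ⟨hf, fanti, fpos, fM, hu1, e, hu2, hN1, ?_⟩⟩
  intro k
  simp only [e]
  exact hN2 k

namespace Fam
variable {p ν T M : ℝ} {f : ℝ → ℝ} {h : ℕ → ℝ} {N : ℕ → ℕ} {u : ℕ → ℕ → ℝ → ℝ}

lemma hpos (F : Fam p ν T M f h N u) (k : ℕ) : 0 < h k := (F.sol k).hh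

lemma lt_N (F : Fam p ν T M f h N u) {k i : ℕ} (hi : i * h k < k + 1) : i < N k := by
  rw [← F.hNh k] at hi
  exact_mod_cast lt_of_mul_lt_mul_right hi (F.hpos k).le

lemma lower (F : Fam p ν T M f h N u) {Ξ : ℝ} (hΞ : 0 < Ξ) : ∃ m1 > 0, ∀ k : ℕ, 2 * Ξ ≤ k + 1 → ∀ i : ℕ,
    i * h k ≤ Ξ → ∀ t ∈ Icc 0 T, m1 ≤ u k i t := by
  set μ := f (2 * Ξ) / 2 with hμ
  have hfp := F.fpos (2 * Ξ)
  have hμ0 : 0 < μ := by positivity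
  have hν : 0 < ν := by linarith [(F.sol 0).hν]
  refine ⟨μ / (2 * Ξ) * exp (-((ν * μ ^ p / (2 * Ξ) + 1) * T)) * Ξ, by positivity, ?_⟩
  intro k hk i hi t ht
  have h1 := (F.sol k).locpos hμ0 (by positivity : 0 < 2 * Ξ) (by rw [F.hNh]; exact hk)
    (fun j hj => by
      rw [F.init k j]
      have : f (2 * Ξ) ≤ f (min (j * h k) (k + 1)) := F.fanti ((min_le_left _ _).trans hj)
      linarith) ht (i := i)
  refine le_trans ?_ h1
  have : exp (-((ν * μ ^ p / (2 * Ξ) + 1) * T)) ≤ exp (-((ν * μ ^ p / (2 * Ξ) + 1) * t)) := by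
    apply exp_le_exp.2
    have : 0 ≤ ν * μ ^ p / (2 * Ξ) + 1 := by positivity
    have := mul_le_mul_of_nonneg_left ht.2 this
    linarith
  gcongr
  linarith

/-- uniform local bounds. -/
lemma bounds (F : Fam p ν T M f h N u) {Ξ t0 : ℝ} (hΞ : 0 < Ξ) (ht0 : 0 < t0) : ∃ m1 > 0, ∃ C > 0, ∃ k0 : ℕ,
    ∀ k ≥ k0, 2 * Ξ ≤ k + 1 ∧ ∀ i : ℕ, i * h k ≤ Ξ → ∀ t ∈ Icc t0 T, m1 ≤ u k i t ∧
     u k i t - u k (i+1) t ≤ h k * C ∧ |zL p ν (h k) (N k) (u k) i t| ≤ C := by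
  obtain ⟨m1, hm1, hlow⟩ := F.lower hΞ
  have hν : 0 < ν := by linarith [(F.sol 0).hν]
  have hp : 0 < p := by linarith [(F.sol 0).hp]
  have hM : 1 ≤ M := (F.sol 0).hM
  set c1 := m1 ^ (1 - p) / (ν * p * t0) with hc1
  have hc1p : 0 < c1 := by positivity
  set c2 := (Ξ * c1 + M) * (4 / t0) with hc2
  have hc2p : 0 < c2 := by positivity
  obtain ⟨k0, hk0⟩ := exists_nat_gt (2 * Ξ + 2 / t0)
  refine ⟨m1, hm1, c1 + c2 + M / (p * t0), by positivity, k0, ?_⟩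
  intro k hk
  have hkk : (k0:ℝ) ≤ k := by exact_mod_cast hk
  have h2t : 0 < 2 / t0 := by positivity
  have hkΞ : 2 * Ξ ≤ k + 1 := by linarith
  refine ⟨hkΞ, ?_⟩
  have hk1 : 1 / ((k:ℝ) + 1) ≤ t0 / 2 := by
    rw [div_le_div_iff₀ (by positivity) (by positivity)]
    have : 2 / t0 < (k:ℝ) + 1 := by linarith
    rw [div_lt_iff₀ ht0] at this
    linarith
  intro i hi t ht
  have S := F.sol k
  have htI : t ∈ Icc 0 T := ⟨ht0.le.trans ht.1, ht.2⟩
  have htp : 0 < t := ht0.trans_le ht.1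
  have hgr : ∀ j : ℕ, j * h k ≤ Ξ → u k j t - u k (j+1) t ≤ h k * c1 := by
    intro j hj
    have hjN : j < N k := F.lt_N (by linarith)
    refine (S.grad_bd ⟨htp, ht.2⟩ j hjN).trans ?_
    apply mul_le_mul_of_nonneg_left _ S.hh.le
    have hm := hlow k hkΞ j hj t htI
    have : u k j t ^ (1 - p) ≤ m1 ^ (1 - p) := rpow_le_rpow_of_nonpos hm1 hm (by linarith [S.hp])
    rw [hc1]
    have hm0 : 0 < m1 ^ (1 - p) := by positivity
    gcongr
    exact ht.1
  refine ⟨hlow k hkΞ i hi t htI, ?_, ?_⟩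
  · refine (hgr i hi).trans (mul_le_mul_of_nonneg_left ?_ S.hh.le)
    have : 0 < M / (p * t0) := by positivity
    linarith
  · rw [abs_le]
    constructor
    · have h1 := S.BC i htI
      have h2 := S.hi i t htI
      have h3 : u k i t / p ≤ M / p := by gcongr
      have h4 : -(M / p) ≤ t * zL p ν (h k) (N k) (u k) i t := by linarith
      by_contra hc
      push Not at hc
      have h5 : zL p ν (h k) (N k) (u k) i t < - (M / (p * t0)) := by linarith
      have h6 : 0 < M / (p * t0) := by positivity
      have h7 : t * zL p ν (h k) (N k) (u k) i t < t * (- (M / (p * t0))) := mul_lt_mul_of_pos_left h5 htp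
      have h8 : t0 * (M / (p * t0)) = M / p := by field_simp
      have h9 : t0 * (M / (p * t0)) ≤ t * (M / (p * t0)) := mul_le_mul_of_nonneg_right ht.1 h6.le
      linarith
    · have h1 := S.scaling (t1 := 1 / ((k:ℝ) + 1)) (by positivity) (F.hC k) ⟨by linarith [ht.1], ht.2⟩ i
      have h2 : (i:ℝ) * (u k (i-1) t - u k i t) ≤ Ξ * c1 := by
        rcases i with _ | j
        · simp; positivity
        · simp only [Nat.add_sub_cancel]
          have hj : (j:ℝ) * h k ≤ Ξ := by
            have := S.hh
            push_cast at hi; linarith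
          calc ((j+1:ℕ):ℝ) * (u k j t - u k (j+1) t) ≤ ((j+1:ℕ):ℝ) * (h k * c1) :=
                mul_le_mul_of_nonneg_left (hgr j hj) (by positivity)
            _ = (((j+1:ℕ):ℝ) * h k) * c1 := by ring
            _ ≤ _ := mul_le_mul_of_nonneg_right hi hc1p.le
      have h3 : t0 / 4 ≤ (t - 1 / ((k:ℝ) + 1)) / 2 := by linarith [ht.1]
      have h6 : 0 < M / (p * t0) := by positivity
      by_contra hc
      push Not at hc
      have hz : c2 < zL p ν (h k) (N k) (u k) i t := by linarith
      have h7 : t0 / 4 * c2 < (t - 1 / ((k:ℝ) + 1)) / 2 * zL p ν (h k) (N k) (u k) i t := by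
        calc t0 / 4 * c2 < t0 / 4 * zL p ν (h k) (N k) (u k) i t := mul_lt_mul_of_pos_left hz (by positivity)
          _ ≤ _ := mul_le_mul_of_nonneg_right h3 (by linarith)
      have h8 : t0 / 4 * c2 = Ξ * c1 + M := by rw [hc2]; field_simp
      linarith

end Fam

lemma exists_I1 {Ξ h : ℝ} (hh : 0 < h) (hΞ : h ≤ Ξ) : ∃ I1 : ℕ, 2 * Ξ ≤ h * I1 ∧ h * I1 ≤ 3 * Ξ := by
  refine ⟨⌈2 * Ξ / h⌉₊, ?_, ?_⟩
  · have := Nat.le_ceil (2 * Ξ / h)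
    rw [div_le_iff₀ hh] at this; linarith
  · have := Nat.ceil_lt_add_one (a := 2 * Ξ / h) (by have : 0 < Ξ := hh.trans_le hΞ
                                                     positivity)
    have h2 := mul_lt_mul_of_pos_left this hh
    have h3 : h * (2 * Ξ / h + 1) = 2 * Ξ + h := by field_simp
    linarith

namespace Fam
variable {p ν T M : ℝ} {f : ℝ → ℝ} {h : ℕ → ℝ} {N : ℕ → ℕ} {u : ℕ → ℕ → ℝ → ℝ}

lemma h_small (F : Fam p ν T M f h N u) {ε : ℝ} (hε : 0 < ε) : ∃ k0 : ℕ, ∀ k ≥ k0, h k ≤ ε := by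
  obtain ⟨k0, hk0⟩ := exists_nat_gt (1 / ε)
  refine ⟨k0, fun k hk => (F.hsmall k).trans ?_⟩
  have hkk : (k0:ℝ) ≤ k := by exact_mod_cast hk
  rw [div_le_iff₀ (by positivity)]
  rw [div_lt_iff₀ hε] at hk0
  nlinarith

set_option maxHeartbeats 1000000 in
lemma holder (F : Fam p ν T M f h N u) {Ξ t0 : ℝ} (hΞ : 0 < Ξ) (ht0 : 0 < t0) : ∃ Λ > 0, ∃ k0 : ℕ,
    ∀ k ≥ k0, ∀ i j : ℕ, i * h k ≤ Ξ → j * h k ≤ Ξ → ∀ t ∈ Icc t0 T,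
      |zL p ν (h k) (N k) (u k) i t - zL p ν (h k) (N k) (u k) j t| ≤ Λ * √(h k * |(i:ℝ) - j|) := by
  obtain ⟨m1, hm1, C0, hC0, k1, hB⟩ := F.bounds (Ξ := 3 * Ξ) (t0 := t0 / 2) (by positivity) (by positivity)
  obtain ⟨k2, hk2⟩ := F.h_small hΞ
  have hν : 0 < ν := by linarith [(F.sol 0).hν]
  have hp : 0 < p := by linarith [(F.sol 0).hp]
  have hM : 0 < M := by linarith [(F.sol 0).hM]
  set a0 := m1 ^ p with ha0d
  have ha0 : 0 < a0 := by positivity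
  set Ab := M ^ p with hAbd
  have hAb : 0 < Ab := by positivity
  set Cg := p * C0 ^ 2 / m1 with hCg
  have hCg0 : 0 < Cg := by positivity
  set Q := Ab * (8 * C0 / Ξ ^ 2) * ((2 * ν + 8) * (3 * Ξ) + ν * Ξ) + 4 * C0 / t0 + 2 * Cg with hQ
  have hQ0 : 0 < Q := by positivity
  set Λ := 2 * C0 / √(Ξ / 2) + (Q + 1) * (√(3 * Ξ) / a0) with hΛ
  have hΛ0 : 0 < Λ := by positivity
  refine ⟨Λ, hΛ0, max k1 k2, ?_⟩
  intro k hk i j hi hj t ht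
  obtain ⟨hkΞ, hBk⟩ := hB k (le_trans (le_max_left _ _) hk)
  have S := F.sol k
  have hh := S.hh
  have hhΞ : h k ≤ Ξ := hk2 k (le_trans (le_max_right _ _) hk)
  obtain ⟨I1, hI1, hI2⟩ := exists_I1 hh hhΞ
  have hsub : ∀ s ∈ Icc (t0/2) t, s ∈ Icc (t0/2) T ∧ s ∈ Icc 0 T := fun s hs =>
    ⟨⟨hs.1, hs.2.trans ht.2⟩, ⟨by linarith [hs.1], hs.2.trans ht.2⟩⟩
  have hil : ∀ l ≤ I1, (l:ℝ) * h k ≤ 3 * Ξ := by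
    intro l hl
    have : (l:ℝ) ≤ I1 := by exact_mod_cast hl
    nlinarith
  have hjI : j ≤ I1 := by
    have : h k * (j:ℝ) ≤ h k * I1 := by linarith
    exact_mod_cast le_of_mul_le_mul_left this hh
  have hΞ' : 0 < h k * I1 := by linarith
  have hsq : √(h k * I1) ≤ √(3 * Ξ) := sqrt_le_sqrt hI2
  have hsq0 : 0 < √(h k * I1) := by positivity
  refine doubling (ν := ν) (h := h k) (t0 := t0/2) (tb := t) (a0 := a0) (Ab := Ab) (Cg := Cg) (C0 := C0)
    (Λ := Λ) (K := 32 * C0 / (h k * I1)^2) (K' := 2 * C0 / (t - t0/2)) (Ξ := h k * I1) (I1 := I1) (i0 := i)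
    (y := zL p ν (h k) (N k) (u k)) (a := fun l s => u k l s ^ p)
    (g := fun l s => p * zL p ν (h k) (N k) (u k) l s ^ 2 / u k l s)
    hν.le hh (by linarith [ht.1]) ha0 hC0 rfl hΞ' hΛ0 ?_ ?_ ?_ ?_ ?_ ?_ ?_ ?_ rfl rfl ?_ ?_ hjI
  · intro l hl
    exact (S.contz l).mono (fun s hs => (hsub s hs).2)
  · intro l hl s hs
    exact S.derz (F.lt_N (by have := hil l hl.le; linarith)) (hsub s hs).2
  · intro a ha b hb s hs
    exact rpow_le_rpow (S.pos (hsub s hs).2).le (S.anti (hsub s hs).2 hb) hp.le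
  · intro l hl s hs
    exact rpow_le_rpow hm1.le (hBk l (hil l hl) s (hsub s hs).1).1 hp.le
  · intro l hl s hs
    exact rpow_le_rpow (S.pos (hsub s hs).2).le (S.hi l s (hsub s hs).2) hp.le
  · intro l hl s hs
    obtain ⟨b1, -, b3⟩ := hBk l (hil l hl) s (hsub s hs).1
    have hup := hm1.trans_le b1
    rw [abs_of_nonneg (by positivity), hCg]
    have : zL p ν (h k) (N k) (u k) l s ^ 2 ≤ C0 ^ 2 := sq_le_sq' (abs_le.1 b3).1 (abs_le.1 b3).2
    gcongr
  · intro l hl s hs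
    exact (hBk l (hil l hl) s (hsub s hs).1).2.2
  · linarith
  · have h1 : √(Ξ/2) ≤ √(h k * I1 / 4) := sqrt_le_sqrt (by linarith)
    have h2 : 0 < √(Ξ/2) := by positivity
    calc 2 * C0 = 2 * C0 / √(Ξ / 2) * √(Ξ/2) := by field_simp
      _ ≤ Λ * √(h k * I1 / 4) := by
        apply mul_le_mul _ h1 h2.le hΛ0.le
        rw [hΛ]
        have : 0 ≤ (Q + 1) * (√(3 * Ξ) / a0) := by positivity
        linarith
  · have h1 : Ab * (32 * C0 / (h k * I1)^2) * ((2 * ν + 8) * (h k * I1) + ν * h k) + 2 * C0 / (t - t0/2) + 2 * Cg ≤ Q := by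
      rw [hQ]
      have e1 : 32 * C0 / (h k * I1)^2 ≤ 8 * C0 / Ξ ^ 2 := by
        rw [show 8 * C0 / Ξ ^ 2 = 32 * C0 / (2 * Ξ)^2 by field_simp; ring]
        gcongr
      have e2 : 2 * C0 / (t - t0/2) ≤ 4 * C0 / t0 := by
        rw [show 4 * C0 / t0 = 2 * C0 / (t0 / 2) by field_simp; ring]
        gcongr
        linarith [ht.1]
      have e3 : (2 * ν + 8) * (h k * I1) + ν * h k ≤ (2 * ν + 8) * (3 * Ξ) + ν * Ξ := by gcongr
      have e4 : Ab * (32 * C0 / (h k * I1)^2) * ((2 * ν + 8) * (h k * I1) + ν * h k) ≤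
        Ab * (8 * C0 / Ξ ^ 2) * ((2 * ν + 8) * (3 * Ξ) + ν * Ξ) := by gcongr
      linarith
    have h2 : Q + 1 ≤ Λ * (a0 / √(h k * I1)) := by
      have h3 : 0 ≤ 2 * C0 / √(Ξ / 2) := by positivity
      calc Q + 1 = (Q + 1) * (√(3 * Ξ) / a0) * (a0 / √(3 * Ξ)) := by
            have : 0 < √(3 * Ξ) := by positivity
            field_simp
        _ ≤ Λ * (a0 / √(h k * I1)) := by
            apply mul_le_mul _ _ (by positivity) hΛ0.le
            · rw [hΛ]; linarith
            · gcongr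
    linarith

set_option maxHeartbeats 1000000 in
lemma ztime (F : Fam p ν T M f h N u) {Ξ t0 : ℝ} (hΞ : 0 < Ξ) (ht0 : 0 < t0) {ε : ℝ} (hε : 0 < ε) : ∃ δ > 0, ∃ k0 : ℕ,
    ∀ k ≥ k0, ∀ i : ℕ, i * h k ≤ Ξ → ∀ s t, t0 ≤ s → s ≤ t → t ≤ T → t ≤ s + δ →
      |zL p ν (h k) (N k) (u k) i t - zL p ν (h k) (N k) (u k) i s| ≤ ε := by
  obtain ⟨m1, hm1, C0, hC0, k1, hB⟩ := F.bounds (Ξ := 3 * Ξ) (t0 := t0) (by positivity) (by positivity)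
  obtain ⟨k2, hk2⟩ := F.h_small hΞ
  obtain ⟨Λ, hΛ0, k3, hH⟩ := F.holder (Ξ := 3 * Ξ) (by positivity) ht0
  have hν : 0 < ν := by linarith [(F.sol 0).hν]
  have hp : 0 < p := by linarith [(F.sol 0).hp]
  have hM : 0 < M := by linarith [(F.sol 0).hM]
  set Ab := M ^ p with hAbd
  have hAb : 0 < Ab := by positivity
  set Cg := p * C0 ^ 2 / m1 with hCg
  have hCg0 : 0 < Cg := by positivity
  set e := ε / 2 with he
  have he0 : 0 < e := by positivity
  set C := Λ ^ 4 / e ^ 3 + 2 * C0 / Ξ ^ 2 with hCd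
  have hCp : 0 < C := by positivity
  set Q := Ab * C * ((2 * ν + 8) * (3 * Ξ) + ν * Ξ) + Cg with hQ
  have hQ0 : 0 < Q := by positivity
  refine ⟨e / Q, by positivity, max k1 (max k2 k3), ?_⟩
  intro k hk i hi s t hs hst htT htδ
  obtain ⟨hkΞ, hBk⟩ := hB k (le_trans (le_max_left _ _) hk)
  have hHk := hH k (le_trans (le_trans (le_max_right _ _) (le_max_right _ _)) hk)
  have S := F.sol k
  have hh := S.hh
  have hhΞ : h k ≤ Ξ := hk2 k (le_trans (le_trans (le_max_left _ _) (le_max_right _ _)) hk)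
  obtain ⟨I1, hI1, hI2⟩ := exists_I1 hh hhΞ
  have hsub : ∀ r ∈ Icc s t, r ∈ Icc t0 T ∧ r ∈ Icc 0 T := fun r hr =>
    ⟨⟨hs.trans hr.1, hr.2.trans htT⟩, ⟨by linarith [hr.1], hr.2.trans htT⟩⟩
  have hil : ∀ l ≤ I1, (l:ℝ) * h k ≤ 3 * Ξ := by
    intro l hl
    have : (l:ℝ) ≤ I1 := by exact_mod_cast hl
    nlinarith
  have hiI : i ≤ I1 := by
    have : h k * (i:ℝ) ≤ h k * I1 := by linarith
    exact_mod_cast le_of_mul_le_mul_left this hh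
  have key := timemod (ν := ν) (h := h k) (t0 := s) (tb := t) (Ab := Ab) (Cg := Cg) (C0 := C0)
    (C := C) (ε := e) (I1 := I1) (i0 := i)
    (y := zL p ν (h k) (N k) (u k)) (a := fun l s => u k l s ^ p)
    (g := fun l s => p * zL p ν (h k) (N k) (u k) l s ^ 2 / u k l s)
    hν.le hh
    (fun l hl => (S.contz l).mono (fun s hs => (hsub s hs).2))
    (fun l hl s hs => S.derz (F.lt_N (by have := hil l hl.le; linarith)) (hsub s hs).2)
    (fun l hl s hs => rpow_nonneg (S.pos (hsub s hs).2).le _)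
    (fun l hl s hs => rpow_le_rpow (S.pos (hsub s hs).2).le (S.hi l s (hsub s hs).2) hp.le)
    (fun l hl s hs => by
      obtain ⟨b1, -, b3⟩ := hBk l (hil l hl) s (hsub s hs).1
      have hup := hm1.trans_le b1
      rw [abs_of_nonneg (by positivity), hCg]
      have : zL p ν (h k) (N k) (u k) l s ^ 2 ≤ C0 ^ 2 := sq_le_sq' (abs_le.1 b3).1 (abs_le.1 b3).2
      gcongr)
    (fun l hl s hs => (hBk l (hil l hl) s (hsub s hs).1).2.2)
    hCp.le he0.le hAb.le hCg0.le hiI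
    (fun l hl => by
      refine (hHk l i (hil l hl) (hil i hiI) s ⟨hs, hst.trans htT⟩).trans ?_
      set r := √(h k * |(l:ℝ) - i|) with hr
      have hr0 : 0 ≤ r := sqrt_nonneg _
      have hr2 : (h k * l - h k * i) ^ 2 = r ^ 4 := by
        have : r ^ 2 = h k * |(l:ℝ) - i| := sq_sqrt (by positivity)
        calc (h k * l - h k * i) ^ 2 = (h k) ^ 2 * ((l:ℝ) - i) ^ 2 := by ring
          _ = (h k) ^ 2 * |(l:ℝ) - i| ^ 2 := by rw [sq_abs]
          _ = (r ^ 2) ^ 2 := by rw [this]; ring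
          _ = r ^ 4 := by ring
      rw [hr2]
      have h1 : Λ ^ 4 / e ^ 3 * r ^ 4 ≤ C * r ^ 4 := by
        apply mul_le_mul_of_nonneg_right _ (by positivity)
        rw [hCd]
        have : 0 ≤ 2 * C0 / Ξ ^ 2 := by positivity
        linarith
      refine le_trans ?_ (add_le_add_right h1 e)
      set x := Λ * r / e with hx
      have hx0 : 0 ≤ x := by positivity
      have e1 : Λ * r = e * x := by rw [hx]; field_simp
      have e2 : Λ ^ 4 / e ^ 3 * r ^ 4 = e * x ^ 4 := by rw [hx]; field_simp
      rw [e1, e2]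
      have : x ≤ 1 + x ^ 4 := by nlinarith [sq_nonneg (x^2 - 1/2), sq_nonneg (x - 1/2)]
      nlinarith)
    (by
      have h1 : Ξ ≤ h k * I1 - h k * i := by linarith
      calc 2 * C0 = 2 * C0 / Ξ ^ 2 * Ξ ^ 2 := by field_simp
        _ ≤ C * (h k * I1 - h k * i) ^ 2 := by
          have : 2 * C0 / Ξ ^ 2 ≤ C := by
            rw [hCd]
            have : 0 ≤ Λ ^ 4 / e ^ 3 := by positivity
            linarith
          gcongr)
    (t := t) ⟨hst, le_rfl⟩
  refine key.trans ?_
  have h1 : Ab * C * ((2 * ν + 8) * (h k * I1) + ν * h k) + Cg ≤ Q := by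
    rw [hQ]; gcongr
  calc e + (Ab * C * ((2 * ν + 8) * (h k * I1) + ν * h k) + Cg) * (t - s) ≤ e + Q * (e / Q) := by
        have : t - s ≤ e / Q := by linarith
        have h0 : 0 ≤ t - s := by linarith
        gcongr
    _ = ε := by rw [mul_div_cancel₀ _ hQ0.ne', he]; ring

set_option maxHeartbeats 1000000 in
lemma utime0 (F : Fam p ν T M f h N u) {Ξ : ℝ} (hΞ : 0 < Ξ) {ε : ℝ} (hε : 0 < ε) : ∃ δ > 0, ∃ k0 : ℕ,
    ∀ k ≥ k0, ∀ i : ℕ, i * h k ≤ Ξ → ∀ t ∈ Icc 0 T, t ≤ δ → |u k i t - f (i * h k)| ≤ ε := by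
  obtain ⟨k2, hk2⟩ := F.h_small hΞ
  obtain ⟨k1, hk1⟩ := exists_nat_gt (3 * Ξ)
  have hν : 0 < ν := by linarith [(F.sol 0).hν]
  have hp : 0 < p := by linarith [(F.sol 0).hp]
  have hM : 0 < M := by linarith [(F.sol 0).hM]
  set Ab := M ^ p with hAbd
  have hAb : 0 < Ab := by positivity
  set e := ε / 2 with he
  have he0 : 0 < e := by positivity
  have huc : UniformContinuousOn f (Icc 0 (3 * Ξ)) :=
    isCompact_Icc.uniformContinuousOn_of_continuous F.hf.continuousOn
  rw [Metric.uniformContinuousOn_iff] at huc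
  obtain ⟨δ0, hδ0, huc⟩ := huc e he0
  set C := 2 * M / δ0 ^ 2 + 2 * M / Ξ ^ 2 with hCd
  have hCp : 0 < C := by positivity
  set Q := Ab * C * ((2 * ν + 8) * (3 * Ξ) + ν * Ξ) with hQ
  have hQ0 : 0 < Q := by positivity
  refine ⟨e / Q, by positivity, max k1 k2, ?_⟩
  intro k hk i hi t ht htδ
  have hk1' : 3 * Ξ < (k:ℝ) + 1 := by
    have : (k1:ℝ) ≤ k := by exact_mod_cast le_trans (le_max_left _ _) hk
    linarith
  have S := F.sol k
  have hh := S.hh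
  have hhΞ : h k ≤ Ξ := hk2 k (le_trans (le_max_right _ _) hk)
  obtain ⟨I1, hI1, hI2⟩ := exists_I1 hh hhΞ
  have hil : ∀ l ≤ I1, (l:ℝ) * h k ≤ 3 * Ξ := by
    intro l hl
    have : (l:ℝ) ≤ I1 := by exact_mod_cast hl
    nlinarith
  have hiI : i ≤ I1 := by
    have : h k * (i:ℝ) ≤ h k * I1 := by linarith
    exact_mod_cast le_of_mul_le_mul_left this hh
  have hini : ∀ l ≤ I1, u k l 0 = f (l * h k) := by
    intro l hl
    rw [F.init, min_eq_left (by linarith [hil l hl])]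
  have hfab : ∀ x, |f x| ≤ M := fun x => by rw [abs_of_pos (F.fpos x)]; exact F.fM x
  have key := timemod (ν := ν) (h := h k) (t0 := 0) (tb := T) (Ab := Ab) (Cg := 0) (C0 := M)
    (C := C) (ε := e) (I1 := I1) (i0 := i)
    (y := u k) (a := fun l s => u k l s ^ p)
    (g := fun l s => 0)
    hν.le hh
    (fun l hl => S.cont l)
    (fun l hl s hs => by
      rw [add_zero]
      exact S.hd l (F.lt_N (by have := hil l hl.le; linarith)) s hs)
    (fun l hl s hs => rpow_nonneg (S.pos hs).le _)
    (fun l hl s hs => rpow_le_rpow (S.pos hs).le (S.hi l s hs) hp.le)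
    (fun l hl s hs => by simp)
    (fun l hl s hs => by rw [abs_of_pos (S.pos hs)]; exact S.hi l s hs)
    hCp.le he0.le hAb.le le_rfl hiI
    (fun l hl => by
      rw [hini l hl, hini i hiI]
      have hn : 0 ≤ C * (h k * l - h k * i) ^ 2 := by positivity
      by_cases hc : |h k * l - h k * i| < δ0
      · have := huc (l * h k) ⟨by positivity, hil l hl⟩ (i * h k) ⟨by positivity, hil i hiI⟩
          (by rw [Real.dist_eq, mul_comm, mul_comm (i:ℝ)]; exact hc)
        rw [Real.dist_eq] at this
        linarith
      · push Not at hc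
        have h1 : δ0 ^ 2 ≤ (h k * l - h k * i) ^ 2 := by
          rw [← sq_abs (h k * l - h k * i)]; gcongr
        have h2 : 2 * M / δ0 ^ 2 ≤ C := by
          rw [hCd]
          have : 0 ≤ 2 * M / Ξ ^ 2 := by positivity
          linarith
        have h3 : 2 * M ≤ C * (h k * l - h k * i) ^ 2 := by
          calc 2 * M = 2 * M / δ0 ^ 2 * δ0 ^ 2 := by field_simp
            _ ≤ _ := by gcongr
        have h4 := abs_sub (f (l * h k)) (f (i * h k))
        have h5 := hfab (l * h k)
        have h6 := hfab (i * h k)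
        linarith)
    (by
      have h1 : Ξ ≤ h k * I1 - h k * i := by linarith
      calc 2 * M = 2 * M / Ξ ^ 2 * Ξ ^ 2 := by field_simp
        _ ≤ C * (h k * I1 - h k * i) ^ 2 := by
          have : 2 * M / Ξ ^ 2 ≤ C := by
            rw [hCd]
            have : 0 ≤ 2 * M / δ0 ^ 2 := by positivity
            linarith
          gcongr)
    (t := t) ht
  rw [hini i hiI] at key
  refine key.trans ?_
  have h1 : Ab * C * ((2 * ν + 8) * (h k * I1) + ν * h k) + 0 ≤ Q := by
    rw [hQ, add_zero]; gcongr
  calc e + (Ab * C * ((2 * ν + 8) * (h k * I1) + ν * h k) + 0) * (t - 0) ≤ e + Q * (e / Q) := by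
        have : t - 0 ≤ e / Q := by linarith
        have h0 : 0 ≤ t - 0 := by linarith [ht.1]
        gcongr
    _ = ε := by rw [mul_div_cancel₀ _ hQ0.ne', he]; ring

end Fam

/-- convergence filter for lattice functions near `(ξ,t)`. -/
def FF (h : ℕ → ℝ) (l : Filter ℕ) (D : Set ℝ) (ξ t : ℝ) : Filter (ℕ × ℕ × ℝ) where
  sets := {P | ∃ δ > 0, ∀ᶠ k in l, ∀ i : ℕ, ∀ s : ℝ, |i * h k - ξ| < δ → s ∈ D → |s - t| < δ → (k, i, s) ∈ P}
  univ_sets := ⟨1, one_pos, Eventually.of_forall (fun _ _ _ _ _ _ => mem_univ _)⟩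
  sets_of_superset := by
    rintro P Q ⟨δ, hδ, hP⟩ hPQ
    exact ⟨δ, hδ, hP.mono (fun k hk i s h1 h2 h3 => hPQ (hk i s h1 h2 h3))⟩
  inter_sets := by
    rintro P Q ⟨δ, hδ, hP⟩ ⟨δ', hδ', hQ⟩
    refine ⟨min δ δ', lt_min hδ hδ', ?_⟩
    filter_upwards [hP, hQ] with k h1 h2 i s a b c
    exact ⟨h1 i s (a.trans_le (min_le_left _ _)) b (c.trans_le (min_le_left _ _)),
      h2 i s (a.trans_le (min_le_right _ _)) b (c.trans_le (min_le_right _ _))⟩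

section FFlemmas
variable {h : ℕ → ℝ} {l : Filter ℕ} {D : Set ℝ} {ξ t : ℝ}

lemma FF_ev {P : ℕ × ℕ × ℝ → Prop} : (∀ᶠ a in FF h l D ξ t, P a) ↔
    ∃ δ > 0, ∀ᶠ k in l, ∀ i : ℕ, ∀ s : ℝ, |i * h k - ξ| < δ → s ∈ D → |s - t| < δ → P (k, i, s) := Iff.rfl

lemma FF_tendsto {q : ℕ → ℕ → ℝ → ℝ} {c : ℝ} :
    Tendsto (fun a : ℕ × ℕ × ℝ => q a.1 a.2.1 a.2.2) (FF h l D ξ t) (nhds c) ↔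
    ∀ ε > 0, ∃ δ > 0, ∀ᶠ k in l, ∀ i : ℕ, ∀ s : ℝ, |i * h k - ξ| < δ → s ∈ D → |s - t| < δ → |q k i s - c| < ε := by
  rw [Metric.tendsto_nhds]
  rfl

lemma FF_mono {D' : Set ℝ} (hD : D ⊆ D') : FF h l D ξ t ≤ FF h l D' ξ t := by
  rintro P ⟨δ, hδ, hP⟩
  exact ⟨δ, hδ, hP.mono (fun k hk i s h1 h2 h3 => hk i s h1 (hD h2) h3)⟩

lemma floor_close {x y : ℝ} (hy : 0 < y) (hx : 0 ≤ x) : |(⌊x / y⌋₊:ℝ) * y - x| ≤ y := by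
  have h1 := Nat.floor_le (a := x / y) (by positivity)
  have h2 := Nat.lt_floor_add_one (x / y)
  rw [le_div_iff₀ hy] at h1
  rw [div_lt_iff₀ hy] at h2
  rw [abs_le]; constructor <;> nlinarith

lemma FF_seq (hpos : ∀ k, 0 < h k) (hh : Tendsto h l (nhds 0)) (hξ : 0 ≤ ξ) (ht : t ∈ D) :
    Tendsto (fun k => ((k, ⌊ξ / h k⌋₊, t) : ℕ × ℕ × ℝ)) l (FF h l D ξ t) := by
  rintro P ⟨δ, hδ, hP⟩
  have h2 : ∀ᶠ k in l, h k < δ := hh.eventually (gt_mem_nhds hδ)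
  rw [mem_map]
  filter_upwards [hP, h2] with k hk h2k
  exact hk _ _ ((floor_close (hpos k) hξ).trans_lt h2k) ht (by simpa using hδ)

lemma FF_shift (hh : Tendsto h l (nhds 0)) :
    Tendsto (fun a : ℕ × ℕ × ℝ => ((a.1, a.2.1 + 1, a.2.2) : ℕ × ℕ × ℝ)) (FF h l D ξ t) (FF h l D ξ t) := by
  rintro P ⟨δ, hδ, hP⟩
  refine ⟨δ / 2, by positivity, ?_⟩
  have h2 : ∀ᶠ k in l, |h k| < δ / 2 := by
    have := hh.abs; rw [abs_zero] at this
    exact this.eventually (gt_mem_nhds (by positivity))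
  filter_upwards [hP, h2] with k hk h2k i s a b c
  refine hk _ _ ?_ b (by linarith)
  have : ((i+1:ℕ):ℝ) * h k - ξ = (i * h k - ξ) + h k := by push_cast; ring
  rw [this]
  linarith [abs_add_le (i * h k - ξ) (h k)]

lemma FF_pos : Tendsto (fun a : ℕ × ℕ × ℝ => (a.2.1 : ℝ) * h a.1) (FF h l D ξ t) (nhds ξ) := by
  rw [Metric.tendsto_nhds]
  intro ε hε
  exact ⟨ε, hε, Eventually.of_forall (fun k i s a b c => a)⟩

lemma FF_cont [l.NeBot] {q : ℕ → ℕ → ℝ → ℝ} {Q : ℝ → ℝ → ℝ} (hpos : ∀ k, 0 < h k) (hh : Tendsto h l (nhds 0))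
    (hq : ∀ ξ ≥ 0, ∀ t ∈ D, Tendsto (fun a : ℕ × ℕ × ℝ => q a.1 a.2.1 a.2.2) (FF h l D ξ t) (nhds (Q ξ t))) :
    ContinuousOn (fun z : ℝ × ℝ => Q z.1 z.2) {z | 0 ≤ z.1 ∧ z.2 ∈ D} := by
  rw [Metric.continuousOn_iff]
  rintro ⟨ξ, t⟩ ⟨hξ, ht⟩ ε hε
  obtain ⟨δ, hδ, hd⟩ := FF_tendsto.1 (hq ξ hξ t ht) (ε / 2) (by positivity)
  refine ⟨δ / 2, by positivity, ?_⟩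
  rintro ⟨η, s⟩ ⟨hη, hs⟩ hdist
  rw [Prod.dist_eq, max_lt_iff, Real.dist_eq, Real.dist_eq] at hdist
  simp only at hdist hη hs hξ ht ⊢
  have h1 := (hq η hη s hs).comp (FF_seq hpos hh hη hs)
  have h2 : Tendsto (fun k => |q k ⌊η / h k⌋₊ s - Q ξ t|) l (nhds |Q η s - Q ξ t|) := (h1.sub_const _).abs
  rw [Real.dist_eq]
  refine lt_of_le_of_lt (b := ε / 2) ?_ (by linarith)
  apply le_of_tendsto h2
  have h3 : ∀ᶠ k in l, h k < δ / 2 := hh.eventually (gt_mem_nhds (by positivity))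
  filter_upwards [hd, h3] with k hk h3k
  refine (hk _ _ ?_ hs (by linarith [hdist.2])).le
  have h4 := floor_close (hpos k) hη
  have h5 := abs_sub_le ((⌊η / h k⌋₊:ℝ) * h k) η ξ
  linarith [hdist.1]

lemma FF_exists {l : Ultrafilter ℕ} {q : ℕ → ℕ → ℝ → ℝ} (hpos : ∀ k, 0 < h k) (hh : Tendsto h l (nhds 0))
    (hξ : 0 ≤ ξ)
    (hb : ∃ C, ∀ᶠ k in (l : Filter ℕ), ∀ i : ℕ, |i * h k - ξ| < 1 → |q k i t| ≤ C)
    (hec : ∀ ε > 0, ∃ δ > 0, ∀ᶠ k in (l : Filter ℕ), ∀ i j : ℕ, ∀ s : ℝ, |i * h k - ξ| < δ → |j * h k - ξ| < δ →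
      s ∈ D → |s - t| < δ → |q k i s - q k j t| < ε) :
    ∃ c, Tendsto (fun a : ℕ × ℕ × ℝ => q a.1 a.2.1 a.2.2) (FF h l D ξ t) (nhds c) := by
  obtain ⟨C, hC⟩ := hb
  have hsm : ∀ δ > 0, ∀ᶠ k in (l : Filter ℕ), |(⌊ξ / h k⌋₊:ℝ) * h k - ξ| < δ := by
    intro δ hδ
    filter_upwards [hh.eventually (gt_mem_nhds hδ)] with k hk
    exact (floor_close (hpos k) hξ).trans_lt hk
  have h1 : ∀ᶠ k in (l : Filter ℕ), q k ⌊ξ / h k⌋₊ t ∈ Icc (-C) C := by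
    filter_upwards [hC, hsm 1 one_pos] with k hk h2
    exact abs_le.1 (hk _ h2)
  have h2 := (isCompact_Icc (a := -C) (b := C)).ultrafilter_le_nhds (l.map (fun k => q k ⌊ξ / h k⌋₊ t))
    (by rw [le_principal_iff]; exact h1)
  obtain ⟨c, -, hc⟩ := h2
  have hc' : Tendsto (fun k => q k ⌊ξ / h k⌋₊ t) l (nhds c) := hc
  refine ⟨c, FF_tendsto.2 ?_⟩
  intro ε hε
  obtain ⟨δ, hδ, hd⟩ := hec (ε / 2) (by positivity)
  refine ⟨δ, hδ, ?_⟩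
  have h3 : ∀ᶠ k in (l : Filter ℕ), |q k ⌊ξ / h k⌋₊ t - c| < ε / 2 :=
    Metric.tendsto_nhds.1 hc' (ε / 2) (by positivity)
  filter_upwards [hd, hsm δ hδ, h3] with k a b c' i s d e f
  have := a i _ s d b e f
  have h5 := abs_sub_le (q k i s) (q k ⌊ξ / h k⌋₊ t) c
  linarith

lemma disc_int {q : ℕ → ℝ} {h c ε : ℝ} (hh : 0 < h) {a b : ℕ} (hab : a ≤ b)
    (hq : ∀ i, a ≤ i → i < b → |(q (i+1) - q i) / h - c| ≤ ε) :
    |q b - q a - ((b:ℝ) - a) * h * c| ≤ ε * (((b:ℝ) - a) * h) := by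
  induction b, hab using Nat.le_induction with
  | base => simp
  | succ b hb ih =>
    have h1 := ih (fun i h1 h2 => hq i h1 (by omega))
    have h2 := hq b hb (by omega)
    have h3 : |q (b+1) - q b - h * c| ≤ ε * h := by
      have : q (b+1) - q b - h * c = h * ((q (b+1) - q b) / h - c) := by field_simp
      rw [this, abs_mul, abs_of_pos hh, mul_comm]
      exact mul_le_mul_of_nonneg_right h2 hh.le
    have h4 : q (b+1) - q a - (((b+1:ℕ):ℝ) - a) * h * c = (q b - q a - ((b:ℝ) - a) * h * c) + (q (b+1) - q b - h * c) := by
      push_cast; ring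
    rw [h4]
    refine (abs_add_le _ _).trans ?_
    push_cast
    linarith

lemma FF_dspace [l.NeBot] {q : ℕ → ℕ → ℝ → ℝ} {Q : ℝ → ℝ} {c : ℝ} (hpos : ∀ k, 0 < h k) (hh : Tendsto h l (nhds 0))
    (hξ : 0 ≤ ξ) {X : Set ℝ} (hX : X ⊆ Ici 0) (hξX : ξ ∈ X)
    (hq : ∀ η ∈ X, Tendsto (fun a : ℕ × ℕ × ℝ => q a.1 a.2.1 a.2.2) (FF h l {t} η t) (nhds (Q η)))
    (hd : Tendsto (fun a : ℕ × ℕ × ℝ => (q a.1 (a.2.1 + 1) a.2.2 - q a.1 a.2.1 a.2.2) / h a.1) (FF h l {t} ξ t) (nhds c)) :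
    HasDerivWithinAt Q c X ξ := by
  rw [hasDerivWithinAt_iff_isLittleO, Asymptotics.isLittleO_iff]
  intro ε hε
  obtain ⟨δ, hδ, hev⟩ := (FF_tendsto (q := fun k i s => (q k (i + 1) s - q k i s) / h k)).1 hd ε hε
  rw [eventually_nhdsWithin_iff]
  filter_upwards [Metric.ball_mem_nhds ξ (half_pos hδ)] with η hη hηX
  rw [Metric.mem_ball, Real.dist_eq] at hη
  have hη0 : 0 ≤ η := hX hηX
  have t1 := (hq η hηX).comp (FF_seq hpos hh hη0 (mem_singleton t))
  have t2 := (hq ξ hξX).comp (FF_seq hpos hh hξ (mem_singleton t))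
  have t3 := FF_pos.comp (FF_seq hpos hh hη0 (mem_singleton t))
  have t4 := FF_pos.comp (FF_seq hpos hh hξ (mem_singleton t))
  simp only [Function.comp_def] at t1 t2 t3 t4
  have t5 := (((t1.sub t2).sub ((t3.sub t4).mul_const c))).abs
  have t6 := ((t3.sub t4).abs).const_mul ε
  rw [Real.norm_eq_abs, Real.norm_eq_abs, smul_eq_mul]
  refine le_of_tendsto_of_tendsto t5 t6 ?_
  have h3 : ∀ᶠ k in l, h k < δ / 2 := hh.eventually (gt_mem_nhds (by positivity))
  filter_upwards [hev, h3] with k hk h3k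
  have b1 := floor_close (hpos k) hη0
  have b2 := floor_close (hpos k) hξ
  set a := ⌊η / h k⌋₊
  set b := ⌊ξ / h k⌋₊
  have b1' := abs_le.1 b1
  have b2' := abs_le.1 b2
  have hη' := abs_lt.1 hη
  have hp := hpos k
  have hall : ∀ i : ℕ, (min a b) ≤ i → i ≤ max a b → |(q k (i+1) t - q k i t) / h k - c| ≤ ε := by
    intro i h1 h2
    refine (hk i t ?_ rfl (by simpa using hδ)).le
    have hlo : ξ - δ < i * h k := by
      rcases min_choice a b with hm | hm <;> rw [hm] at h1
      · have : (a:ℝ) * h k ≤ i * h k := mul_le_mul_of_nonneg_right (by exact_mod_cast h1) hp.le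
        linarith
      · have : (b:ℝ) * h k ≤ i * h k := mul_le_mul_of_nonneg_right (by exact_mod_cast h1) hp.le
        linarith
    have hhi : i * h k < ξ + δ := by
      rcases max_choice a b with hm | hm <;> rw [hm] at h2
      · have : (i:ℝ) * h k ≤ a * h k := mul_le_mul_of_nonneg_right (by exact_mod_cast h2) hp.le
        linarith
      · have : (i:ℝ) * h k ≤ b * h k := mul_le_mul_of_nonneg_right (by exact_mod_cast h2) hp.le
        linarith
    rw [abs_lt]; constructor <;> linarith
  rcases le_total a b with hab | hab
  · have := disc_int (q := fun i => q k i t) hp hab (c := c) (ε := ε)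
      (fun i h1 h2 => hall i ((min_le_left _ _).trans h1) (h2.le.trans (le_max_right _ _)))
    have hab' : (a:ℝ) ≤ b := by exact_mod_cast hab
    have e1 : |(a:ℝ) * h k - b * h k| = ((b:ℝ) - a) * h k := by
      rw [abs_sub_comm, ← sub_mul, abs_of_nonneg (mul_nonneg (by linarith) hp.le)]
    rw [e1]
    refine le_trans (le_of_eq ?_) this
    rw [← abs_neg]; congr 1; ring
  · have := disc_int (q := fun i => q k i t) hp hab (c := c) (ε := ε)
      (fun i h1 h2 => hall i ((min_le_right _ _).trans h1) (h2.le.trans (le_max_left _ _)))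
    have hab' : (b:ℝ) ≤ a := by exact_mod_cast hab
    have e1 : |(a:ℝ) * h k - b * h k| = ((a:ℝ) - b) * h k := by
      rw [← sub_mul, abs_of_nonneg (mul_nonneg (by linarith) hp.le)]
    rw [e1]
    refine le_trans (le_of_eq ?_) this
    congr 1; ring

lemma FF_dtime [l.NeBot] {q z : ℕ → ℕ → ℝ → ℝ} {Q : ℝ → ℝ} {c : ℝ} (hpos : ∀ k, 0 < h k) (hh : Tendsto h l (nhds 0))
    (hξ : 0 ≤ ξ) (hD : D ∈ nhds t)
    (hder : ∀ k i, ∀ s ∈ D, HasDerivAt (q k i) (z k i s) s)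
    (hq : ∀ s ∈ D, Tendsto (fun a : ℕ × ℕ × ℝ => q a.1 a.2.1 a.2.2) (FF h l D ξ s) (nhds (Q s)))
    (hz : Tendsto (fun a : ℕ × ℕ × ℝ => z a.1 a.2.1 a.2.2) (FF h l D ξ t) (nhds c)) :
    HasDerivAt Q c t := by
  rw [hasDerivAt_iff_isLittleO, Asymptotics.isLittleO_iff]
  intro ε hε
  obtain ⟨δ, hδ, hev⟩ := FF_tendsto.1 hz ε hε
  obtain ⟨r, hr, hrD⟩ := Metric.mem_nhds_iff.1 hD
  have hm : 0 < min r δ := lt_min hr hδ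
  have htD : t ∈ D := mem_of_mem_nhds hD
  filter_upwards [Metric.ball_mem_nhds t hm] with s hs
  have hsD : s ∈ D := hrD (ball_subset_ball (min_le_left _ _) hs)
  have t1 := (hq s hsD).comp (FF_seq hpos hh hξ hsD)
  have t2 := (hq t htD).comp (FF_seq hpos hh hξ htD)
  simp only [Function.comp_def] at t1 t2
  have t5 := (((t1.sub t2).sub_const ((s - t) * c))).abs
  rw [Real.norm_eq_abs, Real.norm_eq_abs, smul_eq_mul]
  refine le_of_tendsto t5 ?_
  have h3 : ∀ᶠ k in l, h k < δ := hh.eventually (gt_mem_nhds hδ)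
  filter_upwards [hev, h3] with k hk h3k
  have b2 := floor_close (hpos k) hξ
  set i := ⌊ξ / h k⌋₊
  have := (convex_ball t (min r δ)).norm_image_sub_le_of_norm_hasDerivWithin_le
    (f := fun x => q k i x - x * c) (f' := fun x => z k i x - 1 * c) (C := ε)
    (fun x hx => ((hder k i x (hrD (ball_subset_ball (min_le_left _ _) hx))).sub
      ((hasDerivAt_id x).mul_const c)).hasDerivWithinAt)
    (fun x hx => by
      rw [one_mul, Real.norm_eq_abs]
      refine (hk i x (b2.trans_lt h3k) (hrD (ball_subset_ball (min_le_left _ _) hx)) ?_).le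
      rw [Metric.mem_ball, Real.dist_eq] at hx
      exact hx.trans_le (min_le_right _ _))
    (mem_ball_self hm) hs
  rw [Real.norm_eq_abs, Real.norm_eq_abs] at this
  refine le_trans (le_of_eq ?_) this
  congr 1; ring

end FFlemmas

lemma disc_lip {q : ℕ → ℝ} {h C : ℝ} (hh : 0 < h) {i j : ℕ}
    (hq : ∀ m, min i j ≤ m → m ≤ max i j → |(q (m+1) - q m) / h| ≤ C) :
    |q i - q j| ≤ C * |i * h - j * h| := by
  rcases le_total i j with hab | hab
  · have h1 := disc_int (q := q) hh hab (c := 0) (ε := C) (fun m h1 h2 => by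
      rw [sub_zero]; exact hq m (by omega) (by omega))
    have hab' : (i:ℝ) ≤ j := by exact_mod_cast hab
    rw [abs_sub_comm (i * h), ← sub_mul, abs_of_nonneg (mul_nonneg (by linarith) hh.le), abs_sub_comm]
    simpa using h1
  · have h1 := disc_int (q := q) hh hab (c := 0) (ε := C) (fun m h1 h2 => by
      rw [sub_zero]; exact hq m (by omega) (by omega))
    have hab' : (j:ℝ) ≤ i := by exact_mod_cast hab
    rw [← sub_mul, abs_of_nonneg (mul_nonneg (by linarith) hh.le)]
    simpa using h1

lemma w_rec {ν c ε : ℝ} (hν : 0 < ν) {w σ : ℕ → ℝ} {I : ℕ}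
    (hrec : ∀ i ≤ I, σ i = (4 * (i:ℝ) + ν) * w i - 4 * i * w (i - 1))
    (hσ : ∀ i ≤ I, |σ i - c| ≤ ε) : ∀ i ≤ I, |w i - c / ν| ≤ ε / ν := by
  have hε : 0 ≤ ε := (abs_nonneg _).trans (hσ 0 (by omega))
  have key : ∀ i ≤ I, |w (i-1) - c / ν| ≤ ε / ν ∨ i = 0 → |w i - c / ν| ≤ ε / ν := by
    intro i hi hw
    have h1 := hrec i hi
    have h2 := hσ i hi
    have h3 : (4 * (i:ℝ) + ν) * (w i - c / ν) = (σ i - c) + 4 * i * (w (i-1) - c / ν) := by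
      rw [h1]; field_simp; ring
    have h4 : |4 * (i:ℝ) * (w (i-1) - c / ν)| ≤ 4 * i * (ε / ν) := by
      rcases hw with hw | hw
      · rw [abs_mul, abs_of_nonneg (by positivity : (0:ℝ) ≤ 4 * i)]
        gcongr
      · subst hw; simp
    have h5 : (4 * (i:ℝ) + ν) * |w i - c / ν| ≤ (4 * (i:ℝ) + ν) * (ε / ν) := by
      rw [← abs_of_pos (by positivity : (0:ℝ) < 4 * i + ν), ← abs_mul, h3, abs_of_pos (by positivity : (0:ℝ) < 4 * i + ν)]
      refine (abs_add_le _ _).trans ?_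
      have : (4 * (i:ℝ) + ν) * (ε / ν) = ε + 4 * i * (ε / ν) := by field_simp; ring
      linarith
    exact le_of_mul_le_mul_left h5 (by positivity)
  intro i
  induction i with
  | zero => intro hi; exact key 0 hi (Or.inr rfl)
  | succ i ih => intro hi; exact key (i+1) hi (Or.inl (ih (by omega)))

namespace Fam
variable {p ν T M : ℝ} {f : ℝ → ℝ} {h : ℕ → ℝ} {N : ℕ → ℕ} {u : ℕ → ℕ → ℝ → ℝ}

lemma ev_of {P : ℕ → Prop} (hP : ∃ k0, ∀ k ≥ k0, P k) : ∀ᶠ k in (hyperfilter ℕ : Filter ℕ), P k :=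
  (eventually_atTop.2 hP).filter_mono Nat.hyperfilter_le_atTop

lemma h_tendsto (F : Fam p ν T M f h N u) : Tendsto h (hyperfilter ℕ : Filter ℕ) (nhds 0) := by
  rw [Metric.tendsto_nhds]
  intro ε hε
  apply ev_of
  obtain ⟨k0, hk0⟩ := F.h_small (half_pos hε)
  refine ⟨k0, fun k hk => ?_⟩
  rw [Real.dist_eq, sub_zero, abs_of_pos (F.hpos k)]
  linarith [hk0 k hk]

lemma u_lim0 (F : Fam p ν T M f h N u) {ξ : ℝ} (hξ : 0 ≤ ξ) :
    Tendsto (fun a : ℕ × ℕ × ℝ => u a.1 a.2.1 a.2.2) (FF h (hyperfilter ℕ : Filter ℕ) (Ico 0 T) ξ 0) (nhds (f ξ)) := by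
  rw [FF_tendsto]
  intro ε hε
  obtain ⟨δ1, hδ1, k0, hk0⟩ := F.utime0 (Ξ := ξ + 1) (by linarith) (half_pos hε)
  obtain ⟨δ2, hδ2, hf2⟩ := Metric.continuous_iff.1 F.hf ξ (ε / 2) (half_pos hε)
  refine ⟨min 1 (min δ1 δ2), by positivity, ev_of ⟨k0, ?_⟩⟩
  intro k hk i s hi hs hst
  rw [lt_min_iff, lt_min_iff] at hi hst
  rw [sub_zero] at hst
  have h1 := hk0 k hk i (by linarith [(abs_lt.1 hi.1).2]) s ⟨hs.1, hs.2.le⟩ (by linarith [le_abs_self s, hst.2.1])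
  have h2 := hf2 (i * h k) hi.2.2
  rw [Real.dist_eq] at h2
  have h3 := abs_sub_le (u k i s) (f (i * h k)) (f ξ)
  linarith

lemma w_bd (F : Fam p ν T M f h N u) {Ξ t0 : ℝ} (hΞ : 0 < Ξ) (ht0 : 0 < t0) : ∃ C > 0, ∃ k0 : ℕ,
    ∀ k ≥ k0, ∀ i : ℕ, i * h k ≤ Ξ → ∀ t ∈ Icc t0 T, |(u k (i+1) t - u k i t) / h k| ≤ C := by
  obtain ⟨m1, hm1, C, hC, k0, hB⟩ := F.bounds hΞ ht0
  refine ⟨C, hC, k0, ?_⟩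
  intro k hk i hi t ht
  have h1 := ((hB k hk).2 i hi t ht).2.1
  have h2 := (F.sol k).mono i (t := t) ⟨ht0.le.trans ht.1, ht.2⟩
  have hp := F.hpos k
  rw [abs_div, abs_of_pos hp, div_le_iff₀ hp, abs_le]
  constructor <;> nlinarith

lemma u_lim (F : Fam p ν T M f h N u) {ξ t : ℝ} (hξ : 0 ≤ ξ) (ht : t ∈ Ioo 0 T) :
    ∃ c, Tendsto (fun a : ℕ × ℕ × ℝ => u a.1 a.2.1 a.2.2) (FF h (hyperfilter ℕ : Filter ℕ) (Ico 0 T) ξ t) (nhds c) := by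
  have ht0 := ht.1
  apply FF_exists F.hpos F.h_tendsto hξ
  · refine ⟨M, Eventually.of_forall (fun k i _ => ?_)⟩
    have htI : t ∈ Icc 0 T := ⟨ht.1.le, ht.2.le⟩
    rw [abs_of_pos ((F.sol k).pos htI)]
    exact (F.sol k).hi i t htI
  · intro ε hε
    obtain ⟨C, hC, k0, hw⟩ := F.w_bd (Ξ := ξ + 1) (t0 := t / 2) (by linarith) (half_pos ht0)
    obtain ⟨m1, hm1, C', hC', k1, hB⟩ := F.bounds (Ξ := ξ + 1) (t0 := t / 2) (by linarith) (half_pos ht0)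
    refine ⟨min 1 (min (t / 2) (ε / (C' + 2 * C))), by positivity, ev_of ⟨max k0 k1, ?_⟩⟩
    intro k hk i j s hi hj hs hst
    rw [lt_min_iff, lt_min_iff] at hi hj hst
    have hs' : t / 2 ≤ s := by linarith [(abs_lt.1 hst.2.1).1]
    have hi' := abs_lt.1 hi.1
    have hj' := abs_lt.1 hj.1
    have hp := F.hpos k
    have h1 : |u k i t - u k j t| ≤ C * |i * h k - j * h k| := by
      apply disc_lip (q := fun m => u k m t) hp
      intro m h1 h2
      apply hw k (le_trans (le_max_left _ _) hk) m _ t ⟨by linarith, ht.2.le⟩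
      rcases max_choice i j with hm | hm <;> rw [hm] at h2
      · have : (m:ℝ) * h k ≤ i * h k := mul_le_mul_of_nonneg_right (by exact_mod_cast h2) hp.le
        linarith
      · have : (m:ℝ) * h k ≤ j * h k := mul_le_mul_of_nonneg_right (by exact_mod_cast h2) hp.le
        linarith
    have h2 : |u k i s - u k i t| ≤ C' * |s - t| := by
      have := (convex_Ico (t/2) T).norm_image_sub_le_of_norm_hasDerivWithin_le
        (f := u k i) (f' := zL p ν (h k) (N k) (u k) i) (C := C')
        (fun x hx => ((F.sol k).der i ⟨by linarith [hx.1], hx.2.le⟩).hasDerivWithinAt)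
        (fun x hx => ((hB k (le_trans (le_max_right _ _) hk)).2 i (by linarith) x ⟨hx.1, hx.2.le⟩).2.2)
        (x := t) (y := s) ⟨by linarith, ht.2⟩ ⟨hs', hs.2⟩
      simpa [Real.norm_eq_abs] using this
    have h3 := abs_sub_le (u k i s) (u k i t) (u k j t)
    have h4 := abs_sub_le ((i:ℝ) * h k) ξ (j * h k)
    rw [abs_sub_comm ξ] at h4
    have h5 : C' * (ε / (C' + 2 * C)) + C * (2 * (ε / (C' + 2 * C))) = ε := by field_simp
    have h6 : C' * |s - t| < C' * (ε / (C' + 2 * C)) := mul_lt_mul_of_pos_left hst.2.2 hC'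
    have h7 : C * |(i:ℝ) * h k - j * h k| ≤ C * (2 * (ε / (C' + 2 * C))) :=
      mul_le_mul_of_nonneg_left (by linarith [hi.2.2, hj.2.2]) hC.le
    linarith

lemma z_lim (F : Fam p ν T M f h N u) {ξ t : ℝ} (hξ : 0 ≤ ξ) (ht : t ∈ Ioo 0 T) :
    ∃ c, Tendsto (fun a : ℕ × ℕ × ℝ => zL p ν (h a.1) (N a.1) (u a.1) a.2.1 a.2.2)
      (FF h (hyperfilter ℕ : Filter ℕ) (Ioo 0 T) ξ t) (nhds c) := by
  have ht0 := ht.1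
  apply FF_exists (q := fun k => zL p ν (h k) (N k) (u k)) F.hpos F.h_tendsto hξ
  · obtain ⟨m1, hm1, C', hC', k1, hB⟩ := F.bounds (Ξ := ξ + 1) (t0 := t / 2) (by linarith) (half_pos ht0)
    refine ⟨C', ev_of ⟨k1, fun k hk i hi => ?_⟩⟩
    exact ((hB k hk).2 i (by linarith [(abs_lt.1 hi).2]) t ⟨by linarith, ht.2.le⟩).2.2
  · intro ε hε
    obtain ⟨δ1, hδ1, k0, hT⟩ := F.ztime (Ξ := ξ + 1) (t0 := t / 2) (by linarith) (half_pos ht0) (ε := ε / 3) (by positivity)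
    obtain ⟨Λ, hΛ, k1, hH⟩ := F.holder (Ξ := ξ + 1) (t0 := t / 2) (by linarith) (half_pos ht0)
    refine ⟨min (min 1 δ1) (min (t / 2) ((ε / (3 * Λ)) ^ 2 / 2)), by positivity, ev_of ⟨max k0 k1, ?_⟩⟩
    intro k hk i j s hi hj hs hst
    rw [lt_min_iff, lt_min_iff, lt_min_iff] at hi hj hst
    have hs' := abs_lt.1 hst.2.1
    have hi' := abs_lt.1 hi.1.1
    have hj' := abs_lt.1 hj.1.1
    have hst' := abs_lt.1 hst.1.2
    have hp := F.hpos k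
    have hT' := hT k (le_trans (le_max_left _ _) hk) i (by linarith)
    have h1 : |zL p ν (h k) (N k) (u k) i s - zL p ν (h k) (N k) (u k) i t| ≤ ε / 3 := by
      rcases le_total s t with hst2 | hst2
      · rw [abs_sub_comm]
        exact hT' s t (by linarith) hst2 ht.2.le (by linarith)
      · exact hT' t s (by linarith) hst2 hs.2.le (by linarith)
    have h2 := hH k (le_trans (le_max_right _ _) hk) i j (by linarith) (by linarith) t ⟨by linarith, ht.2.le⟩
    have h4 := abs_sub_le ((i:ℝ) * h k) ξ (j * h k)
    rw [abs_sub_comm ξ, ← sub_mul, abs_mul, abs_of_pos hp, mul_comm] at h4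
    have h5 : √(h k * |(i:ℝ) - j|) ≤ ε / (3 * Λ) := by
      rw [sqrt_le_left (by positivity)]
      linarith [hi.2.2, hj.2.2]
    have h6 : Λ * √(h k * |(i:ℝ) - j|) ≤ ε / 3 := by
      calc _ ≤ Λ * (ε / (3 * Λ)) := mul_le_mul_of_nonneg_left h5 hΛ.le
        _ = ε / 3 := by field_simp
    have h3 := abs_sub_le (zL p ν (h k) (N k) (u k) i s) (zL p ν (h k) (N k) (u k) i t) (zL p ν (h k) (N k) (u k) j t)
    linarith

lemma V_pos (F : Fam p ν T M f h N u) {ξ t c : ℝ} (hξ : 0 ≤ ξ) (ht : t ∈ Ico 0 T)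
    (hc : Tendsto (fun a : ℕ × ℕ × ℝ => u a.1 a.2.1 a.2.2) (FF h (hyperfilter ℕ : Filter ℕ) (Ico 0 T) ξ t) (nhds c)) :
    0 < c := by
  obtain ⟨m1, hm1, hl⟩ := F.lower (Ξ := ξ + 1) (by linarith)
  refine hm1.trans_le (ge_of_tendsto (hc.comp (FF_seq F.hpos F.h_tendsto hξ ht)) ?_)
  apply ev_of
  obtain ⟨k0, hk0⟩ := F.h_small (one_pos)
  obtain ⟨k1, hk1⟩ := exists_nat_gt (2 * (ξ + 1))
  refine ⟨max k0 k1, fun k hk => ?_⟩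
  have : (k1:ℝ) ≤ k := by exact_mod_cast le_trans (le_max_right _ _) hk
  refine hl k (by linarith) _ ?_ t ⟨ht.1, ht.2.le⟩
  have h1 := hk0 k (le_trans (le_max_left _ _) hk)
  have := (abs_le.1 (floor_close (F.hpos k) hξ)).2
  linarith

lemma V_le (F : Fam p ν T M f h N u) {ξ t c B : ℝ} (hξ : 0 ≤ ξ) (ht : t ∈ Ico 0 T)
    (hc : Tendsto (fun a : ℕ × ℕ × ℝ => u a.1 a.2.1 a.2.2) (FF h (hyperfilter ℕ : Filter ℕ) (Ico 0 T) ξ t) (nhds c))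
    (hB : ∃ k0, ∀ k ≥ k0, u k 0 t ≤ B) : c ≤ B := by
  refine le_of_tendsto (hc.comp (FF_seq F.hpos F.h_tendsto hξ ht)) ?_
  apply ev_of
  obtain ⟨k0, hk0⟩ := hB
  refine ⟨k0, fun k hk => ?_⟩
  exact ((F.sol k).anti (t := t) ⟨ht.1, ht.2.le⟩ (Nat.zero_le _)).trans (hk0 k hk)

lemma ev_lt_N (F : Fam p ν T M f h N u) {ξ t : ℝ} {D : Set ℝ} :
    ∀ᶠ a in FF h (hyperfilter ℕ : Filter ℕ) D ξ t, a.2.1 < N a.1 := by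
  rw [FF_ev]
  obtain ⟨k1, hk1⟩ := exists_nat_gt (ξ + 1)
  refine ⟨1, one_pos, ev_of ⟨k1, fun k hk i s hi _ _ => F.lt_N ?_⟩⟩
  have : (k1:ℝ) ≤ k := by exact_mod_cast hk
  linarith [(abs_lt.1 hi).2]

lemma s_lim (F : Fam p ν T M f h N u) {ξ t c z : ℝ} {D : Set ℝ} (hc0 : 0 < c)
    (hc : Tendsto (fun a : ℕ × ℕ × ℝ => u a.1 a.2.1 a.2.2) (FF h (hyperfilter ℕ : Filter ℕ) D ξ t) (nhds c))
    (hz : Tendsto (fun a : ℕ × ℕ × ℝ => zL p ν (h a.1) (N a.1) (u a.1) a.2.1 a.2.2)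
      (FF h (hyperfilter ℕ : Filter ℕ) D ξ t) (nhds z)) :
    Tendsto (fun a : ℕ × ℕ × ℝ => sL ν (h a.1) (u a.1) a.2.1 a.2.2) (FF h (hyperfilter ℕ : Filter ℕ) D ξ t) (nhds (z / c ^ p)) := by
  have h1 := hz.div (hc.rpow_const (p := p) (Or.inl hc0.ne')) (rpow_pos_of_pos hc0 p).ne'
  refine h1.congr' ?_
  filter_upwards [F.ev_lt_N, hc.eventually (lt_mem_nhds hc0)] with a ha hu
  rw [Pi.div_apply, LSol.zL_eq ha, mul_div_cancel_left₀ _ (rpow_pos_of_pos hu p).ne']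

/-- discrete gradient. -/
noncomputable def wL (h : ℕ → ℝ) (u : ℕ → ℕ → ℝ → ℝ) (k i : ℕ) (t : ℝ) : ℝ := (u k (i+1) t - u k i t) / h k

lemma sw (F : Fam p ν T M f h N u) (k i : ℕ) (t : ℝ) :
    sL ν (h k) (u k) i t = (4 * (i:ℝ) + ν) * wL h u k i t - 4 * i * wL h u k (i-1) t := by
  have := (F.hpos k).ne'
  unfold sL Lq wL
  rcases i with _ | i
  · simp; ring
  · simp only [Nat.add_sub_cancel]
    field_simp; ring

lemma w_lim0 (F : Fam p ν T M f h N u) {t σ : ℝ} 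
    (hs : Tendsto (fun a : ℕ × ℕ × ℝ => sL ν (h a.1) (u a.1) a.2.1 a.2.2) (FF h (hyperfilter ℕ : Filter ℕ) {t} 0 t) (nhds σ)) :
    Tendsto (fun a : ℕ × ℕ × ℝ => wL h u a.1 a.2.1 a.2.2) (FF h (hyperfilter ℕ : Filter ℕ) {t} 0 t) (nhds (σ / ν)) := by
  have hν : 0 < ν := by linarith [(F.sol 0).hν]
  rw [FF_tendsto]
  intro ε hε
  obtain ⟨δ, hδ, hd⟩ := (FF_tendsto (q := fun k => sL ν (h k) (u k))).1 hs (ε * ν / 2) (by positivity)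
  refine ⟨δ, hδ, ?_⟩
  filter_upwards [hd] with k hk i s hi hst _
  rw [mem_singleton_iff] at hst
  subst hst
  have hp := F.hpos k
  have := w_rec hν (w := fun i => wL h u k i s) (σ := fun i => sL ν (h k) (u k) i s) (I := i) (c := σ) (ε := ε * ν / 2)
    (fun j hj => F.sw k j s)
    (fun j hj => by
      refine (hk j s ?_ rfl (by simpa using hδ)).le
      have h1 : (j:ℝ) * h k ≤ i * h k := mul_le_mul_of_nonneg_right (by exact_mod_cast hj) hp.le
      have h2 : 0 ≤ (j:ℝ) * h k := by positivity
      rw [sub_zero, abs_of_nonneg h2]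
      rw [sub_zero, abs_of_nonneg (h2.trans h1)] at hi
      linarith) i le_rfl
  refine this.trans_lt ?_
  rw [div_lt_iff₀ hν]
  nlinarith [mul_pos hε hν]

lemma w_diff (F : Fam p ν T M f h N u) (k i : ℕ) (t : ℝ) :
    (wL h u k (i+1) t - wL h u k i t) / h k = (sL ν (h k) (u k) (i+1) t - ν * wL h u k (i+1) t) / (4 * (((i+1:ℕ):ℝ) * h k)) := by
  have h1 := (F.hpos k).ne'
  rw [F.sw k (i+1) t]
  simp only [Nat.add_sub_cancel]
  have h2 : (((i+1:ℕ):ℝ)) ≠ 0 := by positivity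
  field_simp
  ring

lemma w_lim1 (F : Fam p ν T M f h N u) {ξ t : ℝ} (hξ : 0 < ξ) (ht : t ∈ Ioo 0 T) :
    ∃ c, Tendsto (fun a : ℕ × ℕ × ℝ => wL h u a.1 a.2.1 a.2.2) (FF h (hyperfilter ℕ : Filter ℕ) {t} ξ t) (nhds c) := by
  have ht0 := ht.1
  have hν : 0 < ν := by linarith [(F.sol 0).hν]
  have hpp : 0 < p := by linarith [(F.sol 0).hp]
  obtain ⟨C, hC, k0, hw⟩ := F.w_bd (Ξ := ξ + 3) (t0 := t) (by linarith) ht0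
  obtain ⟨m1, hm1, C', hC', k1, hB⟩ := F.bounds (Ξ := ξ + 3) (t0 := t) (by linarith) ht0
  obtain ⟨k2, hk2⟩ := F.h_small one_pos
  have htI : t ∈ Icc t T := ⟨le_rfl, ht.2.le⟩
  apply FF_exists F.hpos F.h_tendsto hξ.le
  · exact ⟨C, ev_of ⟨k0, fun k hk i hi => hw k hk i (by linarith [(abs_lt.1 hi).2]) t htI⟩⟩
  · intro ε hε
    set L := (C' / m1 ^ p + ν * C) / (2 * ξ) with hL
    have hL0 : 0 < L := by positivity
    refine ⟨min (min 1 (ξ / 2)) (ε / (2 * L)), by positivity, ev_of ⟨max k0 (max k1 k2), ?_⟩⟩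
    intro k hk i j s hi hj hs hst
    rw [mem_singleton_iff] at hs
    subst hs
    rw [lt_min_iff, lt_min_iff] at hi hj
    have hi' := abs_lt.1 hi.1.1
    have hj' := abs_lt.1 hj.1.1
    have hi2 := abs_lt.1 hi.1.2
    have hj2 := abs_lt.1 hj.1.2
    have hp := F.hpos k
    have hk0 : k0 ≤ k := le_trans (le_max_left _ _) hk
    have hk1 : k1 ≤ k := le_trans (le_trans (le_max_left _ _) (le_max_right _ _)) hk
    have hhk : h k ≤ 1 := hk2 k (le_trans (le_trans (le_max_right _ _) (le_max_right _ _)) hk)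
    have h1 : |wL h u k i s - wL h u k j s| ≤ L * |i * h k - j * h k| := by
      apply disc_lip (q := fun m => wL h u k m s) hp
      intro m h1 h2
      have hmhi : (m:ℝ) * h k ≤ ξ + 1 := by
        rcases max_choice i j with hm | hm <;> rw [hm] at h2
        · have : (m:ℝ) * h k ≤ i * h k := mul_le_mul_of_nonneg_right (by exact_mod_cast h2) hp.le
          linarith
        · have : (m:ℝ) * h k ≤ j * h k := mul_le_mul_of_nonneg_right (by exact_mod_cast h2) hp.le
          linarith
      have hmlo : ξ / 2 ≤ (m:ℝ) * h k := by
        rcases min_choice i j with hm | hm <;> rw [hm] at h1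
        · have : (i:ℝ) * h k ≤ m * h k := mul_le_mul_of_nonneg_right (by exact_mod_cast h1) hp.le
          linarith
        · have : (j:ℝ) * h k ≤ m * h k := mul_le_mul_of_nonneg_right (by exact_mod_cast h1) hp.le
          linarith
      have hm1' : ((m+1:ℕ):ℝ) * h k ≤ ξ + 3 := by push_cast; linarith
      have hm2' : ξ / 2 ≤ ((m+1:ℕ):ℝ) * h k := by push_cast; linarith
      obtain ⟨hkΞ, hBk⟩ := hB k hk1
      obtain ⟨b1, b2, b3⟩ := hBk (m+1) hm1' s htI
      have hw1 : |wL h u k (m+1) s| ≤ C := hw k hk0 (m+1) hm1' s htI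
      have hlt : m + 1 < N k := F.lt_N (by linarith)
      have hs1 : |sL ν (h k) (u k) (m+1) s| ≤ C' / m1 ^ p := by
        rw [LSol.zL_eq hlt, abs_mul] at b3
        have hu1 : m1 ^ p ≤ u k (m+1) s ^ p := rpow_le_rpow hm1.le b1 hpp.le
        have hm1p : 0 < m1 ^ p := by positivity
        rw [abs_of_pos (hm1p.trans_le hu1)] at b3
        rw [le_div_iff₀ hm1p]
        nlinarith [abs_nonneg (sL ν (h k) (u k) (m+1) s)]
      rw [F.w_diff, abs_div, abs_of_pos (by linarith : 0 < 4 * (((m+1:ℕ):ℝ) * h k)), hL]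
      have hnum : |sL ν (h k) (u k) (m+1) s - ν * wL h u k (m+1) s| ≤ C' / m1 ^ p + ν * C := by
        refine (abs_sub _ _).trans ?_
        rw [abs_mul, abs_of_pos hν]
        have := mul_le_mul_of_nonneg_left hw1 hν.le
        linarith
      exact div_le_div₀ (by positivity) hnum (by positivity) (by linarith)
    have h4 := abs_sub_le ((i:ℝ) * h k) ξ (j * h k)
    rw [abs_sub_comm ξ] at h4
    refine h1.trans_lt ?_
    calc L * |(i:ℝ) * h k - j * h k| < L * (2 * (ε / (2 * L))) := mul_lt_mul_of_pos_left (by linarith [hi.2, hj.2]) hL0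
      _ = ε := by field_simp

end Fam

namespace Fam
variable {p ν T M : ℝ} {f : ℝ → ℝ} {h : ℕ → ℝ} {N : ℕ → ℕ} {u : ℕ → ℕ → ℝ → ℝ}

lemma limit (F : Fam p ν T M f h N u) : ∃ V : ℝ → ℝ → ℝ,
    ContinuousOn (fun z : ℝ × ℝ => V z.1 z.2) {z | 0 ≤ z.1 ∧ z.2 ∈ Ico 0 T} ∧
    (∀ ξ ≥ 0, V ξ 0 = f ξ) ∧ (∀ ξ ≥ 0, ∀ t ∈ Ico 0 T, 0 < V ξ t) ∧
    (∀ t ∈ Ioo 0 T, ∃ S W : ℝ → ℝ, ContinuousOn S (Ici 0) ∧ ContinuousOn W (Ici 0) ∧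
      (∀ ξ ≥ 0, HasDerivWithinAt (fun ξ => V ξ t) (W ξ) (Ici 0) ξ) ∧
      (∀ ξ > 0, HasDerivAt W ((S ξ - ν * W ξ) / (4 * ξ)) ξ) ∧
      W 0 = S 0 / ν ∧ ∀ ξ ≥ 0, HasDerivAt (fun t => V ξ t) (V ξ t ^ p * S ξ) t) ∧
    (∀ t ∈ Ico 0 T, ∀ B, (∃ k0, ∀ k ≥ k0, u k 0 t ≤ B) → ∀ ξ ≥ 0, V ξ t ≤ B) := by
  have hT : 0 < T := (F.sol 0).hT
  have hν : 0 < ν := by linarith [(F.sol 0).hν]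
  have hVex : ∀ ξ t, ∃ c, 0 ≤ ξ → t ∈ Ico 0 T → Tendsto (fun a : ℕ × ℕ × ℝ => u a.1 a.2.1 a.2.2)
      (FF h (hyperfilter ℕ : Filter ℕ) (Ico 0 T) ξ t) (nhds c) := by
    intro ξ t
    by_cases hc : 0 ≤ ξ ∧ t ∈ Ico 0 T
    · rcases eq_or_lt_of_le hc.2.1 with h0 | h0
      · subst h0
        exact ⟨f ξ, fun _ _ => F.u_lim0 hc.1⟩
      · obtain ⟨c, hc'⟩ := F.u_lim hc.1 ⟨h0, hc.2.2⟩
        exact ⟨c, fun _ _ => hc'⟩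
    · exact ⟨0, fun h1 h2 => absurd ⟨h1, h2⟩ hc⟩
  choose V hV using hVex
  have hVpos : ∀ ξ ≥ 0, ∀ t ∈ Ico 0 T, 0 < V ξ t := fun ξ hξ t ht => F.V_pos hξ ht (hV ξ t hξ ht)
  refine ⟨V, FF_cont F.hpos F.h_tendsto (fun ξ hξ t ht => hV ξ t hξ ht), ?_, hVpos, ?_, ?_⟩
  · intro ξ hξ
    have h0 : (0:ℝ) ∈ Ico 0 T := ⟨le_rfl, hT⟩
    exact tendsto_nhds_unique ((hV ξ 0 hξ h0).comp (FF_seq F.hpos F.h_tendsto hξ h0))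
      ((F.u_lim0 hξ).comp (FF_seq F.hpos F.h_tendsto hξ h0))
  · intro t ht
    have htI : t ∈ Ico 0 T := ⟨ht.1.le, ht.2⟩
    have hZex : ∀ ξ, ∃ c, 0 ≤ ξ → Tendsto (fun a : ℕ × ℕ × ℝ => zL p ν (h a.1) (N a.1) (u a.1) a.2.1 a.2.2)
      (FF h (hyperfilter ℕ : Filter ℕ) (Ioo 0 T) ξ t) (nhds c) := by
      intro ξ
      by_cases hc : 0 ≤ ξ
      · obtain ⟨c, hc'⟩ := F.z_lim hc ht
        exact ⟨c, fun _ => hc'⟩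
      · exact ⟨0, fun h1 => absurd h1 hc⟩
    choose Z hZ using hZex
    set S : ℝ → ℝ := fun ξ => Z ξ / V ξ t ^ p with hS
    have hm1 : ∀ ξ, FF h (hyperfilter ℕ : Filter ℕ) {t} ξ t ≤ FF h (hyperfilter ℕ : Filter ℕ) (Ico 0 T) ξ t :=
      fun ξ => FF_mono (by intro s hs; rw [mem_singleton_iff.1 hs]; exact htI)
    have hm2 : ∀ ξ, FF h (hyperfilter ℕ : Filter ℕ) {t} ξ t ≤ FF h (hyperfilter ℕ : Filter ℕ) (Ioo 0 T) ξ t :=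
      fun ξ => FF_mono (by intro s hs; rw [mem_singleton_iff.1 hs]; exact ht)
    have hV1 : ∀ ξ ≥ 0, Tendsto (fun a : ℕ × ℕ × ℝ => u a.1 a.2.1 a.2.2)
      (FF h (hyperfilter ℕ : Filter ℕ) {t} ξ t) (nhds (V ξ t)) := fun ξ hξ => (hV ξ t hξ htI).mono_left (hm1 ξ)
    have hS1 : ∀ ξ ≥ 0, Tendsto (fun a : ℕ × ℕ × ℝ => sL ν (h a.1) (u a.1) a.2.1 a.2.2)
      (FF h (hyperfilter ℕ : Filter ℕ) {t} ξ t) (nhds (S ξ)) :=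
      fun ξ hξ => F.s_lim (hVpos ξ hξ t htI) (hV1 ξ hξ) ((hZ ξ hξ).mono_left (hm2 ξ))
    have hWex : ∀ ξ, ∃ c, 0 ≤ ξ → Tendsto (fun a : ℕ × ℕ × ℝ => wL h u a.1 a.2.1 a.2.2)
      (FF h (hyperfilter ℕ : Filter ℕ) {t} ξ t) (nhds c) := by
      intro ξ
      by_cases hc : 0 ≤ ξ
      · rcases eq_or_lt_of_le hc with h0 | h0
        · subst h0
          exact ⟨_, fun _ => F.w_lim0 (hS1 0 le_rfl)⟩
        · obtain ⟨c, hc'⟩ := F.w_lim1 h0 ht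
          exact ⟨c, fun _ => hc'⟩
      · exact ⟨0, fun h1 => absurd h1 hc⟩
    choose W hW using hWex
    have hcont : ∀ {q : ℕ → ℕ → ℝ → ℝ} {Q : ℝ → ℝ}, (∀ ξ ≥ 0, Tendsto (fun a : ℕ × ℕ × ℝ => q a.1 a.2.1 a.2.2)
        (FF h (hyperfilter ℕ : Filter ℕ) {t} ξ t) (nhds (Q ξ))) → ContinuousOn Q (Ici 0) := by
      intro q Q hq
      have := FF_cont (Q := fun ξ _ => Q ξ) (D := {t}) F.hpos F.h_tendsto
        (fun ξ hξ s hs => by rw [mem_singleton_iff.1 hs]; exact hq ξ hξ)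
      have h2 : ContinuousOn (fun ξ : ℝ => (ξ, t)) (Ici 0) := by fun_prop
      exact this.comp h2 (fun ξ hξ => ⟨hξ, rfl⟩)
    refine ⟨S, W, hcont (q := fun k => sL ν (h k) (u k)) hS1, hcont hW, ?_, ?_, ?_, ?_⟩
    · intro ξ hξ
      exact FF_dspace (q := u) F.hpos F.h_tendsto hξ (Subset.refl _) hξ hV1 (hW ξ hξ)
    · intro ξ hξ
      have := FF_dspace (q := wL h u) (t := t) (Q := W) (c := (S ξ - ν * W ξ) / (4 * ξ)) F.hpos F.h_tendsto hξ.le (Subset.refl _) (mem_Ici.2 hξ.le) hW ?_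
      · exact this.hasDerivAt (Ici_mem_nhds hξ)
      · have h1 := ((hS1 ξ hξ.le).sub ((hW ξ hξ.le).const_mul ν)).div (FF_pos.const_mul 4) (by positivity : 4 * ξ ≠ 0)
        have h2 := h1.comp (FF_shift F.h_tendsto)
        refine h2.congr ?_
        intro a
        simp only [Function.comp_def, Pi.div_apply]
        exact (F.w_diff a.1 a.2.1 a.2.2).symm
    · exact tendsto_nhds_unique ((hW 0 le_rfl).comp (FF_seq F.hpos F.h_tendsto le_rfl rfl))
        ((F.w_lim0 (hS1 0 le_rfl)).comp (FF_seq F.hpos F.h_tendsto le_rfl rfl))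
    · intro ξ hξ
      have h1 : V ξ t ^ p * S ξ = Z ξ := by
        rw [hS]
        have := (rpow_pos_of_pos (hVpos ξ hξ t htI) p).ne'
        field_simp
      rw [h1]
      refine FF_dtime (q := u) (z := fun k => zL p ν (h k) (N k) (u k)) F.hpos F.h_tendsto hξ (Ioo_mem_nhds ht.1 ht.2) ?_ ?_ (hZ ξ hξ)
      · intro k i s hs
        exact (F.sol k).der i ⟨hs.1.le, hs.2.le⟩
      · intro s hs
        exact (hV ξ s hξ ⟨hs.1.le, hs.2⟩).mono_left (FF_mono Ioo_subset_Ico_self)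
  · intro t ht B hB ξ hξ
    exact F.V_le hξ ht (hV ξ t hξ ht) hB

end Fam

section Radial
variable {n : ℕ}

noncomputable def Jc (n : ℕ) : EuclideanSpace ℝ (Fin n) →L[ℝ] (EuclideanSpace ℝ (Fin n) →L[ℝ] ℝ) :=
  LinearMap.toContinuousLinearMap
    { toFun := fun x => innerSL ℝ x
      map_add' := fun x y => by simp
      map_smul' := fun c x => by simp }

lemma Jc_apply (x y : EuclideanSpace ℝ (Fin n)) : Jc n x y = inner ℝ x y := rfl

lemma nsq (x : EuclideanSpace ℝ (Fin n)) : HasFDerivAt (fun y : EuclideanSpace ℝ (Fin n) => ‖y‖ ^ 2) (2 • innerSL ℝ x) x :=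
  (hasStrictFDerivAt_norm_sq x).hasFDerivAt

noncomputable def gR (n : ℕ) (W : ℝ → ℝ) (x : EuclideanSpace ℝ (Fin n)) : EuclideanSpace ℝ (Fin n) := (2 * W (‖x‖ ^ 2)) • x

noncomputable def cR (n : ℕ) (ν : ℝ) (S W : ℝ → ℝ) (x : EuclideanSpace ℝ (Fin n)) : ℝ :=
  (S (‖x‖ ^ 2) - ν * W (‖x‖ ^ 2)) / ‖x‖ ^ 2

noncomputable def HR (n : ℕ) (ν : ℝ) (S W : ℝ → ℝ) (x : EuclideanSpace ℝ (Fin n)) :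
    EuclideanSpace ℝ (Fin n) →L[ℝ] EuclideanSpace ℝ (Fin n) :=
  (2 * W (‖x‖ ^ 2)) • ContinuousLinearMap.id ℝ _ + cR n ν S W x • (innerSL ℝ x).smulRight x

lemma contR {W : ℝ → ℝ} (hW : ContinuousOn W (Ici 0)) : Continuous (fun x : EuclideanSpace ℝ (Fin n) => W (‖x‖ ^ 2)) := by
  apply hW.comp_continuous (by fun_prop)
  intro x; exact sq_nonneg ‖x‖

lemma dF {G W : ℝ → ℝ} (hG : ∀ ξ ≥ 0, HasDerivWithinAt G (W ξ) (Ici 0) ξ) (x : EuclideanSpace ℝ (Fin n)) :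
    HasFDerivAt (fun y : EuclideanSpace ℝ (Fin n) => G (‖y‖ ^ 2)) (Jc n (gR n W x)) x := by
  have h1 := (hG (‖x‖ ^ 2) (sq_nonneg _)).comp_hasFDerivWithinAt x (nsq x).hasFDerivWithinAt (s := univ)
    (fun y _ => sq_nonneg ‖y‖)
  rw [hasFDerivWithinAt_univ] at h1
  refine h1.congr_fderiv ?_
  ext y
  simp [Jc_apply, gR]
  ring

lemma dg {ν : ℝ} {S W : ℝ → ℝ} (hWc : ContinuousOn W (Ici 0))
    (hW : ∀ ξ > 0, HasDerivAt W ((S ξ - ν * W ξ) / (4 * ξ)) ξ) (x : EuclideanSpace ℝ (Fin n)) :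
    HasFDerivAt (gR n W) (HR n ν S W x) x := by
  by_cases hx : x = 0
  · subst hx
    rw [hasFDerivAt_iff_isLittleO]
    have h1 : (fun x' : EuclideanSpace ℝ (Fin n) => gR n W x' - gR n W 0 - (HR n ν S W 0) (x' - 0)) =
        fun x' => (2 * (W (‖x'‖ ^ 2) - W 0)) • x' := by
      funext y
      simp [gR, HR, cR]
      rw [← sub_smul]; congr 1; ring
    rw [h1]
    have h2 : Tendsto (fun x' : EuclideanSpace ℝ (Fin n) => 2 * (W (‖x'‖ ^ 2) - W 0)) (nhds 0) (nhds 0) := by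
      have := (contR (n := n) hWc).continuousAt (x := 0)
      have h3 := (this.tendsto.sub_const (W 0)).const_mul 2
      simpa using h3
    have h3 := ((Asymptotics.isLittleO_one_iff ℝ).2 h2).smul_isBigO
      (Asymptotics.isBigO_refl (fun x' : EuclideanSpace ℝ (Fin n) => x') (nhds 0))
    simpa using h3
  · have hpos : 0 < ‖x‖ ^ 2 := by positivity
    have h1 := (hW _ hpos).comp_hasFDerivAt x (nsq x)
    have h2 := (h1.const_mul 2).smul (hasFDerivAt_id x)
    refine h2.congr_fderiv ?_
    ext y i
    simp [HR, cR]
    field_simp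
    ring

lemma cont_HR {ν : ℝ} {S W : ℝ → ℝ} (hν : ν ≠ 0) (hSc : ContinuousOn S (Ici 0)) (hWc : ContinuousOn W (Ici 0)) (h0 : W 0 = S 0 / ν) :
    Continuous (HR n ν S W) := by
  have hW1 := contR (n := n) hWc
  have hS1 := contR (n := n) hSc
  have hsm : Continuous (fun x : EuclideanSpace ℝ (Fin n) => (innerSL ℝ x).smulRight x) := by
    have h1 : Continuous (fun x : EuclideanSpace ℝ (Fin n) => (innerSL ℝ x : EuclideanSpace ℝ (Fin n) →L[ℝ] ℝ)) := (Jc n).continuous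
    have := (ContinuousLinearMap.smulRightL ℝ (EuclideanSpace ℝ (Fin n)) (EuclideanSpace ℝ (Fin n))).continuous₂
    exact this.comp (h1.prodMk continuous_id)
  unfold HR
  apply Continuous.add
  · exact (continuous_const.mul hW1).smul continuous_const
  · rw [continuous_iff_continuousAt]
    intro x
    by_cases hx : x = 0
    · subst hx
      unfold ContinuousAt
      have hz : cR n ν S W 0 • (innerSL ℝ (0 : EuclideanSpace ℝ (Fin n))).smulRight (0 : EuclideanSpace ℝ (Fin n)) = 0 := by
        ext y; simp
      beta_reduce
      rw [hz]
      have hlim : Tendsto (fun x : EuclideanSpace ℝ (Fin n) => |S (‖x‖ ^ 2) - ν * W (‖x‖ ^ 2)|) (nhds 0) (nhds 0) := by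
        have hc : Continuous (fun x : EuclideanSpace ℝ (Fin n) => |S (‖x‖ ^ 2) - ν * W (‖x‖ ^ 2)|) :=
          (hS1.sub (continuous_const.mul hW1)).abs
        have e : |S (‖(0 : EuclideanSpace ℝ (Fin n))‖ ^ 2) - ν * W (‖(0 : EuclideanSpace ℝ (Fin n))‖ ^ 2)| = 0 := by
          have hz0 : ‖(0 : EuclideanSpace ℝ (Fin n))‖ ^ 2 = 0 := by simp
          rw [hz0, h0, mul_div_cancel₀ _ hν, sub_self, abs_zero]
        have h3 := hc.tendsto 0
        rwa [e] at h3
      refine squeeze_zero_norm (fun x => ?_) hlim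
      rw [norm_smul, ContinuousLinearMap.norm_smulRight_apply, innerSL_apply_norm, Real.norm_eq_abs, cR, abs_div]
      by_cases hx : x = 0
      · subst hx; simp
      · have : 0 < ‖x‖ := norm_pos_iff.2 hx
        rw [abs_of_pos (by positivity : 0 < ‖x‖ ^ 2)]
        apply le_of_eq; field_simp
    · have hpos : ‖x‖ ^ 2 ≠ 0 := by positivity
      have hc : ContinuousAt (cR n ν S W) x :=
        ((hS1.sub (continuous_const.mul hW1)).continuousAt).div (by fun_prop) hpos
      exact hc.smul hsm.continuousAt

theorem radial {ν : ℝ} (hν : ν = 2 * n) (hn : 1 ≤ n) {G S W : ℝ → ℝ} (hSc : ContinuousOn S (Ici 0)) (hWc : ContinuousOn W (Ici 0))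
    (hG : ∀ ξ ≥ 0, HasDerivWithinAt G (W ξ) (Ici 0) ξ)
    (hW : ∀ ξ > 0, HasDerivAt W ((S ξ - ν * W ξ) / (4 * ξ)) ξ) (h0 : W 0 = S 0 / ν) :
    ContDiff ℝ 2 (fun y : EuclideanSpace ℝ (Fin n) => G (‖y‖ ^ 2)) ∧
    ∀ x : EuclideanSpace ℝ (Fin n), lap (fun y : EuclideanSpace ℝ (Fin n) => G (‖y‖ ^ 2)) x = S (‖x‖ ^ 2) := by
  have hn0 : (0:ℝ) < n := by exact_mod_cast hn
  have hν0 : ν ≠ 0 := by rw [hν]; positivity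
  constructor
  · have hg : ContDiff ℝ 1 (gR n W) := by
      have h := (contDiff_succ_iff_hasFDerivAt (𝕜 := ℝ) (f := gR n W) (n := 0)).2
      simp only [Nat.cast_zero, zero_add] at h
      exact h ⟨HR n ν S W, contDiff_zero.2 (cont_HR hν0 hSc hWc h0), dg hWc hW⟩
    have h := (contDiff_succ_iff_hasFDerivAt (𝕜 := ℝ) (f := fun y : EuclideanSpace ℝ (Fin n) => G (‖y‖ ^ 2)) (n := 1)).2
    simp only [Nat.cast_one, one_add_one_eq_two] at h
    exact h ⟨fun x => Jc n (gR n W x), (Jc n).contDiff.comp hg, dF hG⟩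
  · intro x
    unfold lap
    have h1 : ∀ i : Fin n, (fun y : EuclideanSpace ℝ (Fin n) => fderiv ℝ (fun y : EuclideanSpace ℝ (Fin n) => G (‖y‖ ^ 2)) y
        (EuclideanSpace.single i 1)) = fun y => (gR n W y) i := by
      intro i; funext y
      rw [(dF hG y).fderiv, Jc_apply]
      simp [EuclideanSpace.inner_single_right]
    have h2 : ∀ i : Fin n, fderiv ℝ (fun y : EuclideanSpace ℝ (Fin n) => (gR n W y) i) x (EuclideanSpace.single i 1)
        = 2 * W (‖x‖ ^ 2) + cR n ν S W x * (x i) ^ 2 := by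
      intro i
      have := ((EuclideanSpace.proj (𝕜 := ℝ) i).hasFDerivAt).comp x (dg (n := n) hWc hW x)
      have h3 : HasFDerivAt (fun y : EuclideanSpace ℝ (Fin n) => (gR n W y) i)
        ((EuclideanSpace.proj (𝕜 := ℝ) i).comp (HR n ν S W x)) x := this
      rw [h3.fderiv]
      simp [HR, EuclideanSpace.inner_single_right, -mul_eq_mul_left_iff]
      ring
    simp only [h1, h2]
    rw [Finset.sum_add_distrib, ← Finset.mul_sum Finset.univ _ (cR n ν S W x), ← EuclideanSpace.real_norm_sq_eq]
    simp only [Finset.sum_const, Finset.card_univ, Fintype.card_fin, nsmul_eq_mul]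
    by_cases hx : x = 0
    · subst hx
      simp [cR, h0, hν]
      field_simp
    · have hpos : ‖x‖ ^ 2 ≠ 0 := by positivity
      rw [cR, div_mul_cancel₀ _ hpos, hν]
      ring

end Radial

section Final

lemma main_bound {n : ℕ} (hn : 1 ≤ n) {p : ℝ} (hp : 1 ≤ p) {u₀ : EuclideanSpace ℝ (Fin n) → ℝ}
    {f : ℝ → ℝ} (hf : Continuous f) (fanti : Antitone f) (fpos : ∀ x, 0 < f x) {M : ℝ} (hM : 1 ≤ M)
    (fM : ∀ x, f x ≤ M) (huf : ∀ x, u₀ x = f (‖x‖ ^ 2))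
    {u : EuclideanSpace ℝ (Fin n) → ℝ → ℝ}
    (hmin : ∀ T > (0:ℝ), ∀ v, IsSolOn n p u₀ v T → ∀ x, ∀ t, 0 ≤ t → t < T → u x t ≤ v x t)
    {τ Ξ : ℝ} (hτ2 : 2 ≤ τ) (hτM : exp 1 * M ≤ τ) (hΞ : 0 ≤ Ξ) (hfΞ : f Ξ ≤ (τ ^ 132)⁻¹)
    (x : EuclideanSpace ℝ (Fin n)) : u x τ ≤ ((4 * Ξ + 2) / τ) ^ (1 / p) := by
  have hn1 : (1:ℝ) ≤ n := by exact_mod_cast hn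
  have hτ0 : 0 < τ := by linarith
  obtain ⟨h, N, w, F⟩ := exists_Fam (p := p) (ν := 2 * n) (T := 2 * τ) hp (by linarith) (by linarith) hM
    hf fanti fpos fM
  obtain ⟨V, hVc, hV0, hVp, hVs, hVB⟩ := F.limit
  have hsol : IsSolOn n p u₀ (fun x t => V (‖x‖ ^ 2) t) (2 * τ) := by
    refine ⟨?_, ?_, ?_, ?_, ?_⟩
    · have hg : Continuous (fun z : EuclideanSpace ℝ (Fin n) × ℝ => ((‖z.1‖ ^ 2, z.2) : ℝ × ℝ)) := by fun_prop
      exact hVc.comp hg.continuousOn (fun z hz => ⟨sq_nonneg ‖z.1‖, hz⟩)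
    · intro y; rw [huf]; exact hV0 _ (sq_nonneg _)
    · intro y t h0 hT; exact hVp _ (sq_nonneg _) t ⟨h0.le, hT⟩
    · intro t h0 hT
      obtain ⟨S, W, hS, hW, h1, h2, h3, -⟩ := hVs t ⟨h0, hT⟩
      exact (radial rfl hn hS hW h1 h2 h3).1
    · intro y t h0 hT
      obtain ⟨S, W, hS, hW, h1, h2, h3, h4⟩ := hVs t ⟨h0, hT⟩
      rw [(radial rfl hn hS hW h1 h2 h3).2]
      exact h4 _ (sq_nonneg _)
  refine (hmin (2 * τ) (by linarith) _ hsol x τ hτ0.le (by linarith)).trans ?_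
  refine hVB τ ⟨hτ0.le, by linarith⟩ _ ?_ _ (sq_nonneg _)
  obtain ⟨k1, hk1⟩ := F.h_small (ε := 1 / 12) (by norm_num)
  obtain ⟨k2, hk2⟩ := exists_nat_gt (2 * n * τ * M ^ p)
  obtain ⟨k3, hk3⟩ := exists_nat_gt Ξ
  refine ⟨max k1 (max k2 k3), fun k hk => ?_⟩
  have hk1' := hk1 k ((le_max_left _ _).trans hk)
  have hk2' : (k2 : ℝ) ≤ k := by exact_mod_cast ((le_max_left _ _).trans (le_max_right _ _)).trans hk
  have hk3' : (k3 : ℝ) ≤ k := by exact_mod_cast ((le_max_right _ _).trans (le_max_right _ _)).trans hk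
  have hh := F.hpos k
  have hI1 : Ξ ≤ (⌈Ξ / h k⌉₊ : ℝ) * h k := by
    have := Nat.le_ceil (Ξ / h k)
    rwa [div_le_iff₀ hh] at this
  have hI2 : (⌈Ξ / h k⌉₊ : ℝ) * h k ≤ Ξ + h k := by
    have := (Nat.ceil_lt_add_one (div_nonneg hΞ hh.le)).le
    calc _ ≤ (Ξ / h k + 1) * h k := by gcongr
      _ = _ := by field_simp
  have hd := (F.sol k).decay hτ2 (by linarith) hτM (I0 := ⌈Ξ / h k⌉₊ + 1) (by omega) (fun i hi => ?_)
    (by rw [F.hNh]; linarith)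
  · have hu0 : 0 < w k 0 τ := lt_of_lt_of_le (F.sol k).hm ((F.sol k).lo 0 τ ⟨hτ0.le, by linarith⟩)
    have h1 : w k 0 τ ^ p ≤ (4 * Ξ + 2) / τ := by
      refine hd.trans ?_
      push_cast
      apply div_le_div_of_nonneg_right _ hτ0.le
      linarith
    have h2 := Real.rpow_le_rpow (by positivity) h1 (by positivity : 0 ≤ 1 / p)
    rwa [← Real.rpow_mul hu0.le, mul_one_div_cancel (by linarith), Real.rpow_one] at h2
  · rw [F.init]
    refine (fanti ?_).trans hfΞ
    refine le_min (hI1.trans ?_) (by linarith)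
    gcongr
    exact_mod_cast (by omega : ⌈Ξ / h k⌉₊ ≤ i)

lemma profile {n : ℕ} (hn : 1 ≤ n) {u₀ : EuclideanSpace ℝ (Fin n) → ℝ}
    (hu₀cont : Continuous u₀) (hu₀pos : ∀ x, 0 < u₀ x)
    {w : ℝ → ℝ} (hw : AntitoneOn w (Set.Ici 0)) (huw : ∀ x, u₀ x = w ‖x‖) :
    Continuous (fun ξ => w √ξ) ∧ Antitone (fun ξ => w √ξ) ∧ (∀ ξ, 0 < w √ξ) ∧
      (∀ x, u₀ x = w √(‖x‖ ^ 2)) := by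
  let e : EuclideanSpace ℝ (Fin n) := EuclideanSpace.single ⟨0, hn⟩ 1
  have he : ‖e‖ = 1 := by simp [e]
  have hk : ∀ ξ, w √ξ = u₀ (√ξ • e) := by
    intro ξ
    rw [huw, norm_smul, he, mul_one, Real.norm_of_nonneg (Real.sqrt_nonneg _)]
  refine ⟨?_, ?_, ?_, ?_⟩
  · simp only [hk]; fun_prop
  · intro a b hab
    exact hw (Real.sqrt_nonneg _) (Real.sqrt_nonneg _) (Real.sqrt_le_sqrt hab)
  · intro ξ; rw [hk]; exact hu₀pos _
  · intro x; rw [Real.sqrt_sq (norm_nonneg _)]; exact huw x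

/-- volume comparison -/
lemma vol_lower {n : ℕ} (hn : 1 ≤ n) : ∃ c > (0:ℝ), ∀ r > 0,
    (volume (ball (0 : EuclideanSpace ℝ (Fin n)) r)).toReal = c * r ^ n := by
  have : Nonempty (Fin n) := ⟨⟨0, hn⟩⟩
  refine ⟨(volume (ball (0 : EuclideanSpace ℝ (Fin n)) 1)).toReal, ?_, fun r hr => ?_⟩
  · exact ENNReal.toReal_pos (measure_ball_pos _ _ one_pos).ne' measure_ball_lt_top.ne
  · rw [Measure.addHaar_ball_of_pos _ _ hr, ENNReal.toReal_mul, ENNReal.toReal_ofReal (by positivity)]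
    simp [mul_comm]

lemma tail_bound {n : ℕ} (hn : 1 ≤ n) {κ η : ℝ} (hκ : 0 < κ) (hη : 0 < η) {u₀ : EuclideanSpace ℝ (Fin n) → ℝ}
    (hu₀cont : Continuous u₀) (hu₀pos : ∀ x, 0 < u₀ x)
    {w : ℝ → ℝ} (hw : AntitoneOn w (Set.Ici 0)) (huw : ∀ x, u₀ x = w ‖x‖)
    (hu₀lim : Filter.Tendsto u₀ (Filter.cocompact _) (nhds 0))
    (hu₀int : IntegrableOn (fun x => Real.log (Real.log (1 / u₀ x)) ^ (-κ))
      {x | u₀ x < η} volume) :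
    ∃ c > (0:ℝ), ∃ R > (0:ℝ), ∀ r ≥ R, (c * r ^ n) ^ (1 / κ) ≤ log (log (1 / w r)) ∧ 0 < w r ∧ w r < exp (-exp 1) := by
  let e : EuclideanSpace ℝ (Fin n) := EuclideanSpace.single ⟨0, hn⟩ 1
  have he : ‖e‖ = 1 := by simp [e]
  have hk : ∀ r ≥ 0, w r = u₀ (r • e) := by
    intro r hr
    rw [huw, norm_smul, he, mul_one, Real.norm_of_nonneg hr]
  have hwpos : ∀ r ≥ 0, 0 < w r := fun r hr => by rw [hk r hr]; exact hu₀pos _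
  have hδ : 0 < min η (exp (-exp 1)) := by positivity
  have hev := hu₀lim.eventually (gt_mem_nhds hδ)
  rw [← Metric.cobounded_eq_cocompact, ← comap_norm_atTop] at hev
  obtain ⟨r1, hr1⟩ := (eventually_atTop.1 (eventually_comap.1 hev))
  set r0 := max r1 1 with hr0
  have hr0pos : 0 < r0 := lt_of_lt_of_le one_pos (le_max_right _ _)
  have hsm : ∀ r ≥ r0, w r < min η (exp (-exp 1)) := by
    intro r hr
    have hr' : 0 ≤ r := hr0pos.le.trans hr
    rw [hk r hr']
    exact hr1 r ((le_max_left _ _).trans hr) _ (by rw [norm_smul, he, mul_one, Real.norm_of_nonneg hr'])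
  have hLpos : ∀ r ≥ r0, 1 < log (log (1 / w r)) := by
    intro r hr
    have h1 := hwpos r (hr0pos.le.trans hr)
    have h2 := (hsm r hr).trans_le (min_le_right _ _)
    rw [one_div, Real.log_inv]
    have h3 : exp 1 < - log (w r) := by
      have := Real.log_lt_log h1 h2
      rw [Real.log_exp] at this; linarith
    rw [Real.lt_log_iff_exp_lt (by linarith [Real.exp_pos 1])]; exact h3
  have hLmono : ∀ r s, r0 ≤ r → r ≤ s → log (log (1 / w r)) ≤ log (log (1 / w s)) := by
    intro r s hr hrs
    have hr' : 0 ≤ r := hr0pos.le.trans hr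
    have h1 := hwpos r hr'
    have h1' := hwpos s (hr'.trans hrs)
    have h2 := (hsm r hr).trans_le (min_le_right _ _)
    have h3 : w s ≤ w r := hw hr' (hr'.trans hrs) hrs
    have h4 : 0 < log (1 / w r) := by
      apply Real.log_pos
      rw [lt_div_iff₀ h1, one_mul]
      refine h2.trans ?_
      have h9 : exp (-exp 1) < exp 0 := Real.exp_lt_exp.2 (by linarith [Real.exp_pos 1])
      rwa [Real.exp_zero] at h9
    apply Real.log_le_log h4
    apply Real.log_le_log (by positivity)
    gcongr
  obtain ⟨v, hv, hvol⟩ := vol_lower hn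
  set g := fun x : EuclideanSpace ℝ (Fin n) => Real.log (Real.log (1 / u₀ x)) ^ (-κ) with hg
  set I := ∫ x in ({x | u₀ x < η} ∩ (ball 0 r0)ᶜ), g x with hI
  have hIntg : IntegrableOn g ({x | u₀ x < η} ∩ (ball 0 r0)ᶜ) volume := hu₀int.mono_set inter_subset_left
  have hmeas : MeasurableSet ({x | u₀ x < η} ∩ (ball 0 r0)ᶜ) :=
    (isOpen_lt hu₀cont continuous_const).measurableSet.inter measurableSet_ball.compl
  have hkey : ∀ r ≥ 2 * r0, v * r ^ n / 2 * (log (log (1 / w r))) ^ (-κ) ≤ I := by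
    intro r hr
    have hr' : r0 ≤ r := by linarith
    have hsub : ball (0 : EuclideanSpace ℝ (Fin n)) r \ ball 0 r0 ⊆ {x | u₀ x < η} ∩ (ball 0 r0)ᶜ := by
      rintro x ⟨hx1, hx2⟩
      refine ⟨?_, hx2⟩
      rw [mem_ball_zero_iff, not_lt] at hx2
      show u₀ x < η
      rw [huw]
      exact (hsm _ hx2).trans_le (min_le_left _ _)
    have hmd : MeasurableSet (ball (0 : EuclideanSpace ℝ (Fin n)) r \ ball 0 r0) :=
      measurableSet_ball.diff measurableSet_ball
    have hfin : volume (ball (0 : EuclideanSpace ℝ (Fin n)) r \ ball 0 r0) ≠ ⊤ :=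
      ((measure_mono sdiff_subset).trans_lt measure_ball_lt_top).ne
    have hdv : v * r ^ n / 2 ≤ volume.real (ball (0 : EuclideanSpace ℝ (Fin n)) r \ ball 0 r0) := by
      rw [measureReal_sdiff (ball_subset_ball hr') measurableSet_ball]
      have e1 := hvol r (by linarith)
      have e2 := hvol r0 hr0pos
      simp only [Measure.real]
      rw [e1, e2]
      have : r0 ^ n ≤ r ^ n / 2 := by
        have h1 : (2 * r0) ^ n ≤ r ^ n := by gcongr
        rw [mul_pow] at h1
        have h2 : (2:ℝ) ≤ 2 ^ n := by
          calc (2:ℝ) = 2 ^ 1 := by norm_num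
            _ ≤ 2 ^ n := pow_le_pow_right₀ (by norm_num) hn
        have h3 : 2 * r0 ^ n ≤ 2 ^ n * r0 ^ n := by gcongr
        linarith
      nlinarith
    have h1 : ∫ x in ball (0 : EuclideanSpace ℝ (Fin n)) r \ ball 0 r0, (log (log (1 / w r))) ^ (-κ)
        ≤ ∫ x in ball (0 : EuclideanSpace ℝ (Fin n)) r \ ball 0 r0, g x := by
      refine setIntegral_mono_on (integrableOn_const hfin) (hIntg.mono_set hsub) hmd ?_
      rintro x ⟨hx1, hx2⟩
      rw [mem_ball_zero_iff] at hx1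
      rw [mem_ball_zero_iff, not_lt] at hx2
      simp only [hg, huw]
      exact Real.rpow_le_rpow_of_nonpos (by linarith [hLpos _ hx2]) (hLmono _ _ hx2 hx1.le) (by linarith)
    have h2 : ∫ x in ball (0 : EuclideanSpace ℝ (Fin n)) r \ ball 0 r0, g x ≤ I := by
      refine setIntegral_mono_set hIntg ?_ hsub.eventuallyLE
      rw [EventuallyLE, ae_restrict_iff' hmeas]
      refine Eventually.of_forall ?_
      rintro x ⟨-, hx2⟩
      rw [mem_compl_iff, mem_ball_zero_iff, not_lt] at hx2
      simp only [hg, huw, Pi.zero_apply]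
      exact Real.rpow_nonneg (by linarith [hLpos _ hx2]) _
    rw [setIntegral_const, smul_eq_mul] at h1
    refine le_trans ?_ (h1.trans h2)
    gcongr
    exact Real.rpow_nonneg (by linarith [hLpos _ hr']) _
  have hIpos : 0 < I := by
    refine lt_of_lt_of_le ?_ (hkey (2 * r0) le_rfl)
    have := hLpos (2 * r0) (by linarith)
    have : 0 < (log (log (1 / w (2 * r0)))) ^ (-κ) := Real.rpow_pos_of_pos (by linarith) _
    positivity
  refine ⟨v / (2 * I), by positivity, 2 * r0, by positivity, fun r hr => ⟨?_, hwpos r (by linarith), ?_⟩⟩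
  · have hL := hLpos r (by linarith)
    have h1 := hkey r hr
    rw [Real.rpow_neg (by linarith)] at h1
    have hLk : 0 < log (log (1 / w r)) ^ κ := Real.rpow_pos_of_pos (by linarith) _
    have hr' : 0 < r := by linarith
    have h2 : v / (2 * I) * r ^ n ≤ log (log (1 / w r)) ^ κ := by
      rw [← div_eq_mul_inv, div_le_iff₀ hLk] at h1
      rw [div_mul_eq_mul_div, div_le_iff₀ (by positivity)]
      linarith
    have h3 := Real.rpow_le_rpow (by positivity) h2 (by positivity : 0 ≤ 1 / κ)
    rwa [← Real.rpow_mul (by linarith), mul_one_div_cancel hκ.ne', Real.rpow_one] at h3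
  · exact (hsm r (by linarith)).trans_le (min_le_right _ _)

theorem final_bound (n : ℕ) (hn : 1 ≤ n)
    (p κ η : ℝ) (hp : 1 ≤ p) (hκ : 0 < κ) (hη : 0 < η)
    (u₀ : EuclideanSpace ℝ (Fin n) → ℝ)
    (hu₀cont : Continuous u₀) (hu₀pos : ∀ x, 0 < u₀ x)
    (hu₀rad : ∃ w : ℝ → ℝ, AntitoneOn w (Set.Ici 0) ∧ ∀ x, u₀ x = w ‖x‖)
    (hu₀lim : Filter.Tendsto u₀ (Filter.cocompact _) (nhds 0))
    (hu₀int : IntegrableOn (fun x => Real.log (Real.log (1 / u₀ x)) ^ (-κ))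
      {x | u₀ x < η} volume)
    (u : EuclideanSpace ℝ (Fin n) → ℝ → ℝ)
    (hmin : ∀ T > (0:ℝ), ∀ v, IsSolOn n p u₀ v T → ∀ x, ∀ t, 0 ≤ t → t < T → u x t ≤ v x t) :
    ∃ t₀ > Real.exp 1, ∃ C > (0:ℝ), ∀ t ≥ t₀, ∀ x,
      u x t ≤ C * t ^ (-(1:ℝ)/p) * Real.log (Real.log t) ^ (2*κ/((n:ℝ)*p)) := by
  obtain ⟨w, hw, huw⟩ := hu₀rad
  obtain ⟨hf, fanti, fpos, huf⟩ := profile hn hu₀cont hu₀pos hw huw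
  obtain ⟨c, hc, R, hR, hcR⟩ := tail_bound hn hκ hη hu₀cont hu₀pos hw huw hu₀lim hu₀int
  have hn0 : (0:ℝ) < n := by exact_mod_cast hn
  set M := max (w 0) 1 with hM
  have fM : ∀ ξ, w √ξ ≤ M := fun ξ =>
    (hw (le_refl (0:ℝ)) (Real.sqrt_nonneg _) (Real.sqrt_nonneg _)).trans (le_max_left _ _)
  set A := ((2:ℝ) ^ κ / c) ^ (1 / (n:ℝ)) with hA
  have hApos : 0 < A := by positivity
  have hAn : A ^ n = 2 ^ κ / c := by
    rw [hA, ← Real.rpow_natCast, ← Real.rpow_mul (by positivity), one_div_mul_cancel hn0.ne', Real.rpow_one]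
  have hLL : Tendsto (fun t : ℝ => log (log t)) atTop atTop := Real.tendsto_log_atTop.comp Real.tendsto_log_atTop
  have hLr : Tendsto (fun t : ℝ => A * log (log t) ^ (κ / n)) atTop atTop :=
    ((tendsto_rpow_atTop (by positivity : 0 < κ / n)).comp hLL).const_mul_atTop hApos
  have hev := (hLL.eventually_ge_atTop (max 1 (log 132))).and ((hLr.eventually_ge_atTop R).and
    (eventually_ge_atTop (max 2 (exp 1 * M))))
  obtain ⟨t1, ht1⟩ := eventually_atTop.1 hev
  refine ⟨max t1 (exp 1 + 1), lt_of_lt_of_le (by linarith) (le_max_right _ _),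
    (4 * A ^ 2 + 2) ^ (1 / p), by positivity, fun t ht x => ?_⟩
  obtain ⟨hL, hr, htM⟩ := ht1 t ((le_max_left _ _).trans ht)
  have ht2 : 2 ≤ t := (le_max_left _ _).trans htM
  have ht0 : 0 < t := by linarith
  have hte : exp 1 < t := lt_of_lt_of_le (by linarith) ((le_max_right _ _).trans ht)
  have hlogt : 1 < log t := by
    rw [Real.lt_log_iff_exp_lt ht0]; exact hte
  set L := log (log t) with hLdef
  have hL1 : 1 ≤ L := (le_max_left _ _).trans hL
  have hL2 : log 132 ≤ L := (le_max_right _ _).trans hL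
  set r := A * L ^ (κ / n) with hrdef
  have hr0 : 0 < r := by positivity
  obtain ⟨h1, h2, h3⟩ := hcR r hr
  have hrn : c * r ^ n = (2 * L) ^ κ := by
    rw [hrdef, mul_pow, hAn, ← Real.rpow_natCast (L ^ (κ / n)), ← Real.rpow_mul (by linarith),
      div_mul_cancel₀ _ hn0.ne', Real.mul_rpow (by norm_num) (by linarith)]
    field_simp
  rw [hrn, ← Real.rpow_mul (by linarith), mul_one_div_cancel hκ.ne', Real.rpow_one] at h1
  have hwr : w r ≤ (t ^ 132)⁻¹ := by
    have h4 : log (132 * log t) ≤ log (log (1 / w r)) := by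
      rw [Real.log_mul (by norm_num) (by linarith)]; linarith
    have hlw : 0 < log (1 / w r) := by
      rw [one_div, Real.log_inv]
      have := Real.log_lt_log h2 h3
      rw [Real.log_exp] at this
      linarith [Real.exp_pos 1]
    have h5 := (Real.log_le_log_iff (by positivity) hlw).1 h4
    have h6 : (132:ℝ) * log t = log (t ^ 132) := by rw [Real.log_pow]; norm_num
    rw [h6] at h5
    have h7 := (Real.log_le_log_iff (by positivity) (by positivity)).1 h5
    rw [le_div_iff₀ h2] at h7
    rw [← one_div, le_div_iff₀ (by positivity)]
    linarith
  have hb := main_bound hn hp hf fanti fpos (M := M) (le_max_right _ _) fM huf hmin ht2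
    ((le_max_right _ _).trans htM) (Ξ := r ^ 2) (sq_nonneg _) (by rw [Real.sqrt_sq hr0.le]; exact hwr) x
  refine hb.trans ?_
  have hr2 : r ^ 2 = A ^ 2 * L ^ (2 * κ / n) := by
    rw [hrdef, mul_pow, ← Real.rpow_natCast (L ^ (κ / n)), ← Real.rpow_mul (by linarith)]
    congr 2; push_cast; ring
  have hLp : 1 ≤ L ^ (2 * κ / n) := Real.one_le_rpow hL1 (by positivity)
  have h8 : (4 * r ^ 2 + 2) / t ≤ (4 * A ^ 2 + 2) * t⁻¹ * L ^ (2 * κ / n) := by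
    rw [hr2, div_eq_mul_inv, mul_right_comm]
    gcongr
    nlinarith [sq_nonneg A]
  have h9 := Real.rpow_le_rpow (by positivity) h8 (by positivity : 0 ≤ 1 / p)
  refine h9.trans (le_of_eq ?_)
  rw [Real.mul_rpow (by positivity) (by positivity), Real.mul_rpow (by positivity) (by positivity),
    ← Real.rpow_mul (by linarith), Real.inv_rpow ht0.le, ← Real.rpow_neg ht0.le]
  congr 2
  · congr 1; ring
  · field_simp

end Final

/-- Corollary 3.12 of Fila–Winkler.
If `p ≥ 1` and the positive, radially symmetric, radially nonincreasing continuous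
initial data satisfy `u₀(x) → 0` as `|x| → ∞` and
`∫_{u₀ < η} (ln ln(1/u₀))^{-κ} < ∞` for some `κ > 0`, `η > 0`, then there are `t₀ > e`
and `C > 0` such that the minimal solution satisfies
`‖u(·,t)‖_{L^∞} ≤ C t^{-1/p} (ln ln t)^{2κ/(np)}` for all `t ≥ t₀`
(stated pointwise, which is equivalent for a continuous function). -/
theorem stmt_18 (n : ℕ) (hn : 1 ≤ n)
    (p κ η : ℝ) (hp : 1 ≤ p) (hκ : 0 < κ) (hη : 0 < η)
    (u₀ : EuclideanSpace ℝ (Fin n) → ℝ)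
    (hu₀cont : Continuous u₀) (hu₀pos : ∀ x, 0 < u₀ x)
    (hu₀rad : ∃ w : ℝ → ℝ, AntitoneOn w (Set.Ici 0) ∧ ∀ x, u₀ x = w ‖x‖)
    (hu₀lim : Filter.Tendsto u₀ (Filter.cocompact _) (nhds 0))
    (hu₀int : IntegrableOn (fun x => Real.log (Real.log (1 / u₀ x)) ^ (-κ))
      {x | u₀ x < η} volume)
    (u : EuclideanSpace ℝ (Fin n) → ℝ → ℝ)
    (hu : IsMinimalSol n p u₀ u) :
    ∃ t₀ > Real.exp 1, ∃ C > (0:ℝ), ∀ t ≥ t₀, ∀ x,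
      u x t ≤ C * t ^ (-(1:ℝ)/p) * Real.log (Real.log t) ^ (2*κ/((n:ℝ)*p)) := by
  exact final_bound n hn p κ η hp hκ hη u₀ hu₀cont hu₀pos hu₀rad hu₀lim hu₀int u hu.2
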